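/- Fix integers ℓ ≥ r ≥ 2 and let H_{ℓ+1}^r denote the r-uniform expansion of the complete graph K_{ℓ+1}. There exist constants N_0 and c = c(ℓ,r) > 0 such that for all integers n ≥ N_0 and all integers t with 0 ≤ t ≤ c·n, one has EX(n,(t+1)H_{ℓ+1}^r) = { K_t^r ⋈ T_r(n−t,ℓ) }. -/

import Mathlib

open Filter

namespace DensityCH

/-- An `r`-uniform hypergraph with vertices in `ℕ`:
a finite vertex set together with a set of `r`-element edges. -/
structure HGraph (r : ℕ) where
  verts : Finset ℕ
  edges : Finset (Finset ℕ)
  edges_sub : ∀ e ∈ edges, e ⊆ verts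
  edges_card : ∀ e ∈ edges, e.card = r

namespace HGraph

/-- Build an `r`-graph from a vertex set and a set of candidate edges,
keeping exactly the well-formed candidates. -/
def ofEdges (r : ℕ) (V : Finset ℕ) (E : Finset (Finset ℕ)) : HGraph r where
  verts := V
  edges := E.filter fun e => e ⊆ V ∧ e.card = r
  edges_sub := fun e he => ((Finset.mem_filter.mp he).2).1
  edges_card := fun e he => ((Finset.mem_filter.mp he).2).2

variable {r : ℕ}

/-- `H` contains a copy of `F`, i.e. a subgraph isomorphic to `F`. -/
def IsCopyIn (F H : HGraph r) : Prop :=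
  ∃ f : ℕ → ℕ, Set.InjOn f ↑F.verts ∧ (∀ v ∈ F.verts, f v ∈ H.verts) ∧
    ∀ e ∈ F.edges, e.image f ∈ H.edges

/-- The subgraph of `H` induced on `S`. -/
def induce (H : HGraph r) (S : Finset ℕ) : HGraph r :=
  ofEdges r (H.verts ∩ S) (H.edges.filter fun e => e ⊆ S)

/-- Delete a vertex from `H`. -/
def deleteVert (H : HGraph r) (v : ℕ) : HGraph r :=
  ofEdges r (H.verts.erase v) (H.edges.filter fun e => v ∉ e)

/-- The degree of a vertex. -/
def deg (H : HGraph r) (v : ℕ) : ℕ := (H.edges.filter fun e => v ∈ e).card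

/-- The maximum degree `Δ(H)`. -/
def maxDeg (H : HGraph r) : ℕ := H.verts.sup H.deg

/-- The minimum degree `δ(H)`. -/
def minDeg (H : HGraph r) : ℕ :=
  if h : H.verts.Nonempty then H.verts.inf' h H.deg else 0

/-- The average degree `d(H) = r·|E(H)|/|V(H)|`. -/
noncomputable def avgDeg (H : HGraph r) : ℝ :=
  (r : ℝ) * (H.edges.card : ℝ) / (H.verts.card : ℝ)

/-- `H` contains `k` pairwise vertex-disjoint copies of `F`, i.e. `ν(F,H) ≥ k`. -/
def HasMatching (F H : HGraph r) (k : ℕ) : Prop :=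
  ∃ S : Fin k → Finset ℕ,
    (∀ i, S i ⊆ H.verts ∧ (S i).card = F.verts.card) ∧
    (∀ i j, i ≠ j → Disjoint (S i) (S j)) ∧
    ∀ i, F.IsCopyIn (H.induce (S i))

/-- Isomorphism of hypergraphs. -/
def Iso (G H : HGraph r) : Prop :=
  ∃ f : ℕ → ℕ, Set.BijOn f ↑G.verts ↑H.verts ∧
    ∀ e ∈ Finset.powersetCard r G.verts, (e ∈ G.edges ↔ e.image f ∈ H.edges)

/-- The join `G ⋈ H`: all edges of `G`, all edges of `H`, and all `r`-sets meeting
both vertex sets. -/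
def join (G H : HGraph r) : HGraph r :=
  ofEdges r (G.verts ∪ H.verts)
    (G.edges ∪ H.edges ∪ ((Finset.powersetCard r (G.verts ∪ H.verts)).filter
      fun e => (e ∩ G.verts).Nonempty ∧ (e ∩ H.verts).Nonempty))

end HGraph

/-- The complete `r`-graph on a vertex set `S`. -/
def completeOn (r : ℕ) (S : Finset ℕ) : HGraph r :=
  HGraph.ofEdges r S (Finset.powersetCard r S)

/-- The `r`-graph on `V` with no edges. -/
def emptyOn (r : ℕ) (V : Finset ℕ) : HGraph r := HGraph.ofEdges r V ∅

/-- The Turán number `ex(n,F)`. -/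
noncomputable def exN (r n : ℕ) (F : HGraph r) : ℕ :=
  sSup {m | ∃ H : HGraph r, H.verts.card = n ∧ ¬ F.IsCopyIn H ∧ H.edges.card = m}

/-- `d(n,F) = r·ex(n,F)/n`. -/
noncomputable def dN (r n : ℕ) (F : HGraph r) : ℝ := (r : ℝ) * (exN r n F : ℝ) / (n : ℝ)

/-- `δ(n,F) = ex(n,F) − ex(n−1,F)` (as a real number). -/
noncomputable def deltaN (r n : ℕ) (F : HGraph r) : ℝ := (exN r n F : ℝ) - (exN r (n-1) F : ℝ)

/-- `x` is the Turán density `π(F)`, i.e. the limit of `ex(n,F)/C(n,r)`. -/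
def HasTuranDensity (r : ℕ) (F : HGraph r) (x : ℝ) : Prop :=
  Tendsto (fun n : ℕ => (exN r n F : ℝ) / (n.choose r : ℝ)) atTop (nhds x)

/-- `ex(n,(t+1)F)`: the maximum number of edges of an `n`-vertex `r`-graph with no
`t+1` pairwise vertex-disjoint copies of `F`. -/
noncomputable def exMatchN (r n t : ℕ) (F : HGraph r) : ℕ :=
  sSup {m | ∃ H : HGraph r, H.verts.card = n ∧ ¬ F.HasMatching H (t+1) ∧ H.edges.card = m}

/-- `H ∈ EX(n,F)`. -/
def IsExtremalFree (r n : ℕ) (F H : HGraph r) : Prop :=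
  H.verts.card = n ∧ ¬ F.IsCopyIn H ∧ H.edges.card = exN r n F

/-- `H ∈ EX(n,(t+1)F)`. -/
def IsExtremalMatchingFree (r n t : ℕ) (F H : HGraph r) : Prop :=
  H.verts.card = n ∧ ¬ F.HasMatching H (t+1) ∧ H.edges.card = exMatchN r n t F

/-- `F` is `(f1, f2)`-bounded at `n`. -/
def BoundedAt (r n : ℕ) (F : HGraph r) (f1 f2 : ℝ) : Prop :=
  ∀ H : HGraph r, H.verts.card = n → ¬ F.IsCopyIn H →
    dN r n F - f1 ≤ H.avgDeg → (H.maxDeg : ℝ) ≤ dN r n F + f2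

/-- `ex(·,F)` is `g`-smooth at `n`: `|δ(n,F) − d(n−1,F)| ≤ g(n)`. -/
def SmoothAt (r n : ℕ) (F : HGraph r) (g : ℝ) : Prop :=
  |deltaN r n F - dN r (n-1) F| ≤ g

/-- The collection `H 0, …, H t` (on a common vertex set) has a rainbow `F`-matching. -/
def HasRainbowMatching (r t : ℕ) (F : HGraph r) (H : Fin (t+1) → HGraph r) : Prop :=
  ∃ S : Fin (t+1) → Finset ℕ,
    (∀ i, S i ⊆ (H i).verts ∧ (S i).card = F.verts.card) ∧
    (∀ i j, i ≠ j → Disjoint (S i) (S j)) ∧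
    ∀ i, F.IsCopyIn ((H i).induce (S i))

/-!  Patterns -/

/-- An `r`-uniform pattern: a finite index set together with a collection of
`r`-multisets on it. -/
structure Pattern (r : ℕ) where
  idx : Finset ℕ
  mE : Finset (Multiset ℕ)
  card_eq : ∀ s ∈ mE, Multiset.card s = r
  mem_idx : ∀ s ∈ mE, ∀ i ∈ s, i ∈ idx

namespace Pattern

variable {r : ℕ}

/-- The pattern `P − i`. -/
def erase (P : Pattern r) (i : ℕ) : Pattern r where
  idx := P.idx.erase i
  mE := P.mE.filter fun s => i ∉ s
  card_eq := fun s hs => P.card_eq s (Finset.mem_filter.mp hs).1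
  mem_idx := by
    intro s hs j hj
    have h1 := Finset.mem_filter.mp hs
    refine Finset.mem_erase.mpr ⟨?_, P.mem_idx s h1.1 j hj⟩
    rintro rfl
    exact h1.2 hj

/-- `H` is a `P`-construction: a blowup of the pattern `P`. -/
def IsConstruction (P : Pattern r) (H : HGraph r) : Prop :=
  ∃ part : ℕ → ℕ, (∀ v ∈ H.verts, part v ∈ P.idx) ∧
    ∀ e : Finset ℕ, e ∈ H.edges ↔ (e ⊆ H.verts ∧ e.card = r ∧ Multiset.map part e.val ∈ P.mE)

/-- `H` is a `P`-subconstruction: a subgraph of a `P`-construction. -/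
def IsSubconstruction (P : Pattern r) (H : HGraph r) : Prop :=
  ∃ G : HGraph r, P.IsConstruction G ∧ H.verts ⊆ G.verts ∧ H.edges ⊆ G.edges

end Pattern

/-- `Λ(P,n)`: the maximum number of edges of an `n`-vertex `P`-construction. -/
noncomputable def patEx (r : ℕ) (P : Pattern r) (n : ℕ) : ℕ :=
  sSup {m | ∃ H : HGraph r, P.IsConstruction H ∧ H.verts.card = n ∧ H.edges.card = m}

/-- The Lagrangian `λ(P) = lim Λ(P,n)/C(n,r)`. -/
noncomputable def patLagrangian (r : ℕ) (P : Pattern r) : ℝ :=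
  limUnder atTop fun n : ℕ => (patEx r P n : ℝ) / (n.choose r : ℝ)

/-- The pattern `P` is minimal: `λ(P−i) < λ(P)` for all `i`. -/
def Pattern.Minimal {r : ℕ} (P : Pattern r) : Prop :=
  ∀ i ∈ P.idx, patLagrangian r (P.erase i) < patLagrangian r P

/-- `(F,P)` is a Turán pair. -/
def IsTuranPair (r : ℕ) (F : HGraph r) (P : Pattern r) : Prop :=
  (∀ H : HGraph r, P.IsConstruction H → ¬ F.IsCopyIn H) ∧
  (∀ H : HGraph r, ¬ F.IsCopyIn H → H.edges.card = exN r H.verts.card F →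
    P.IsConstruction H)

/-- `F` is edge-stable with respect to `P` (with Turán density `π`). -/
def EdgeStable (r : ℕ) (F : HGraph r) (P : Pattern r) (π : ℝ) : Prop :=
  ∀ δ : ℝ, 0 < δ → ∃ N₀ : ℕ, ∃ ζ : ℝ, 0 < ζ ∧
    ∀ H : HGraph r, N₀ ≤ H.verts.card → ¬ F.IsCopyIn H →
      (π - ζ) * (H.verts.card.choose r : ℝ) ≤ (H.edges.card : ℝ) →
      ∃ H' : HGraph r, H'.verts ⊆ H.verts ∧ H'.edges ⊆ H.edges ∧
        (π - δ) * (H.verts.card.choose r : ℝ) ≤ (H'.edges.card : ℝ) ∧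
        P.IsSubconstruction H'

/-- `F` is weakly vertex-extendable with respect to `P` (with Turán density `π`). -/
def WeaklyVertexExtendable (r : ℕ) (F : HGraph r) (P : Pattern r) (π : ℝ) : Prop :=
  ∀ δ : ℝ, 0 < δ → ∃ N₀ : ℕ, ∃ ζ : ℝ, 0 < ζ ∧
    ∀ H : HGraph r, N₀ ≤ H.verts.card → ¬ F.IsCopyIn H →
      (π - ζ) * (((H.verts.card - 1).choose (r-1) : ℕ) : ℝ) ≤ (H.minDeg : ℝ) →
      ∀ v ∈ H.verts, P.IsSubconstruction (H.deleteVert v) →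
        (H.deg v : ℝ) ≤ (π + δ) * (((H.verts.card - 1).choose (r-1) : ℕ) : ℝ)

/-- `F` is degree-stable with respect to `P` (with Turán density `π`). -/
def DegreeStable (r : ℕ) (F : HGraph r) (P : Pattern r) (π : ℝ) : Prop :=
  ∃ ζ : ℝ, 0 < ζ ∧ ∃ N₀ : ℕ,
    ∀ H : HGraph r, N₀ ≤ H.verts.card → ¬ F.IsCopyIn H →
      (π - ζ) * (((H.verts.card - 1).choose (r-1) : ℕ) : ℝ) ≤ (H.minDeg : ℝ) →
      P.IsSubconstruction H

/-!  Concrete constructions -/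

/-- The generalized Turán graph `T_r(·,ℓ)` on vertex set `V` (parts are residue
classes mod `ℓ`; on an interval these are balanced). -/
def turanOn (r ℓ : ℕ) (V : Finset ℕ) : HGraph r :=
  HGraph.ofEdges r V ((Finset.powersetCard r V).filter
    fun e => ∀ u ∈ e, ∀ v ∈ e, u % ℓ = v % ℓ → u = v)

/-- The `r`-graph on `V₁ ∪ V₂` whose edges are all `r`-sets meeting both parts. -/
def crossOn (r : ℕ) (V₁ V₂ : Finset ℕ) : HGraph r :=
  HGraph.ofEdges r (V₁ ∪ V₂) ((Finset.powersetCard r (V₁ ∪ V₂)).filter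
    fun e => (e ∩ V₁).Nonempty ∧ (e ∩ V₂).Nonempty)

/-- The `r`-graph on `V₁ ∪ V₂` whose edges are all `r`-sets meeting `V₁` in an odd
number of vertices. -/
def oddCross (r : ℕ) (V₁ V₂ : Finset ℕ) : HGraph r :=
  HGraph.ofEdges r (V₁ ∪ V₂) ((Finset.powersetCard r (V₁ ∪ V₂)).filter
    fun e => Odd (e ∩ V₁).card)

/-- The Fano plane. -/
def fano : HGraph 3 :=
  HGraph.ofEdges 3 (Finset.Icc 1 7)
    {({1,2,3} : Finset ℕ), {3,4,5}, {5,6,1}, {1,7,4}, {2,7,5}, {3,7,6}, {2,4,6}}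

/-- The generalized triangle `𝕋_r`, with edges `{1,…,r}`, `{1,…,r−1,r+1}` and
`{r,…,2r−1}`. -/
def genTri (r : ℕ) : HGraph r :=
  HGraph.ofEdges r (Finset.Icc 1 (2*r - 1))
    {Finset.Icc 1 r, Finset.Icc 1 (r-1) ∪ {r+1}, Finset.Icc r (2*r - 1)}

/-- `G` is a blowup of the `r`-graph `W` (viewing `W` as a pattern). -/
def IsBlowupOf {r : ℕ} (W G : HGraph r) : Prop :=
  ∃ part : ℕ → ℕ, (∀ v ∈ G.verts, part v ∈ W.verts) ∧
    ∀ e : Finset ℕ, e ∈ G.edges ↔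
      (e ⊆ G.verts ∧ e.card = r ∧ ∃ f ∈ W.edges, Multiset.map part e.val = f.val)

/-- The expansion `H^F` of an `r`-graph `F`: for every pair of vertices not covered
by an edge of `F`, add an edge consisting of this pair plus `r−2` new vertices,
these sets of new vertices being pairwise disjoint. -/
def HGraph.expansion {r : ℕ} (F : HGraph r) : HGraph r :=
  HGraph.ofEdges r
    (F.verts ∪ (((F.verts ×ˢ F.verts).filter fun p =>
        p.1 < p.2 ∧ ∀ e ∈ F.edges, ¬ (p.1 ∈ e ∧ p.2 ∈ e)).biUnion fun p =>
      (Finset.range (r-2)).image fun s =>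
        (F.verts.sup id + 1) + (p.1 * (F.verts.sup id + 1) + p.2) * r + s))
    (F.edges ∪ (((F.verts ×ˢ F.verts).filter fun p =>
        p.1 < p.2 ∧ ∀ e ∈ F.edges, ¬ (p.1 ∈ e ∧ p.2 ∈ e)).image fun p =>
      insert p.1 (insert p.2 ((Finset.range (r-2)).image fun s =>
        (F.verts.sup id + 1) + (p.1 * (F.verts.sup id + 1) + p.2) * r + s))))

/-- A `2`-graph is a tree on `k` vertices: `k` vertices, `k−1` edges, connected. -/
def IsTreeGraph (k : ℕ) (T : HGraph 2) : Prop :=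
  T.verts.card = k ∧ T.edges.card = k - 1 ∧
  ∀ S : Finset ℕ, S ⊆ T.verts → S.Nonempty → S ≠ T.verts →
    ∃ e ∈ T.edges, (e ∩ S).Nonempty ∧ (e \ S).Nonempty

/-- `T` satisfies the Erdős–Sós property for `k`: every graph with average degree
greater than `k−2` contains `T`. -/
def ErdosSos (k : ℕ) (T : HGraph 2) : Prop :=
  ∀ G : HGraph 2, ((k : ℝ) - 2) * (G.verts.card : ℝ) < 2 * (G.edges.card : ℝ) →
    T.IsCopyIn G

/-- The `(r−2)`-expansion `Exp(T)` of a `2`-graph `T`: enlarge every edge by one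
common fixed set of `r−2` new vertices. -/
def expTree (r : ℕ) (T : HGraph 2) : HGraph r :=
  HGraph.ofEdges r
    (T.verts ∪ ((Finset.range (r-2)).image fun s => T.verts.sup id + 1 + s))
    (T.edges.image fun e =>
      e ∪ ((Finset.range (r-2)).image fun s => T.verts.sup id + 1 + s))

/-- The chromatic number of a `2`-graph. -/
noncomputable def chrom (F : HGraph 2) : ℕ :=
  sInf {k | ∃ c : ℕ → ℕ, (∀ v ∈ F.verts, c v < k) ∧
    ∀ e ∈ F.edges, ∀ u ∈ e, ∀ v ∈ e, u ≠ v → c u ≠ c v}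

/-- A graph is edge-critical if deleting some edge lowers its chromatic number. -/
def EdgeCritical (F : HGraph 2) : Prop :=
  ∃ e ∈ F.edges, chrom (HGraph.ofEdges 2 F.verts (F.edges.erase e)) < chrom F

/-- `H` is semibipartite: the vertex set splits into `V₁ ∪ V₂` so that every edge
has exactly one vertex in `V₁`. -/
def Semibipartite (r : ℕ) (H : HGraph r) : Prop :=
  ∃ V₁ ⊆ H.verts, ∀ e ∈ H.edges, (e ∩ V₁).card = 1

/-- `H` is a `K_ℓ^r`-subconstruction, i.e. an `ℓ`-partite `r`-graph. -/
def IsKlSub (r ℓ : ℕ) (H : HGraph r) : Prop :=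
  ∃ f : ℕ → ℕ, (∀ v ∈ H.verts, f v < ℓ) ∧
    ∀ e ∈ H.edges, ∀ u ∈ e, ∀ v ∈ e, f u = f v → u = v

/-- The Lagrangian `λ(W)` of an `r`-graph `W`, viewing `W` as a pattern. -/
noncomputable def hgLagrangian (r : ℕ) (W : HGraph r) : ℝ :=
  limUnder atTop fun n : ℕ =>
    ((sSup {m | ∃ G : HGraph r, IsBlowupOf W G ∧ G.verts.card = n ∧ G.edges.card = m} : ℕ) : ℝ)
      / (n.choose r : ℝ)

/-- The `r`-graph `B(r,ℓ+1)`. -/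
def BGraph (r ℓ : ℕ) : HGraph r :=
  HGraph.ofEdges r (Finset.Icc 1 (ℓ+1))
    (insert (Finset.Icc 1 r)
      ((Finset.powersetCard r (Finset.Icc 2 (ℓ+1))).filter
        fun e => (e ∩ Finset.Icc 2 r).card ≤ 1))

/-- The `r`-uniform matching of size two, `M_2^r`. -/
def matching2 (r : ℕ) : HGraph r :=
  HGraph.ofEdges r (Finset.Icc 1 (2*r)) {Finset.Icc 1 r, Finset.Icc (r+1) (2*r)}

/-- The expanded triangle `𝓒_3^{2r}`. -/
def expandedTriangle (r : ℕ) : HGraph (2*r) :=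
  HGraph.ofEdges (2*r) (Finset.Icc 1 (3*r))
    {Finset.Icc 1 (2*r), Finset.Icc (r+1) (3*r), Finset.Icc 1 r ∪ Finset.Icc (2*r+1) (3*r)}

/-- The `4`-graph `𝔽_{4,3}`. -/
def F43 : HGraph 4 :=
  HGraph.ofEdges 4 (Finset.Icc 1 7)
    {({1,2,3,4} : Finset ℕ), {1,2,3,5}, {1,2,3,6}, {1,2,3,7}, {4,5,6,7}}

/-- The `3`-graph `𝔽_{3,2}`. -/
def F32 : HGraph 3 :=
  HGraph.ofEdges 3 (Finset.Icc 1 5)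
    {({1,2,3} : Finset ℕ), {1,2,4}, {1,2,5}, {3,4,5}}

/-- `H` contains pairwise vertex-disjoint copies of `F i`, `ts i` many of each. -/
def HasMixedMatching (r k : ℕ) (F : Fin k → HGraph r) (ts : Fin k → ℕ)
    (H : HGraph r) : Prop :=
  ∃ S : (i : Fin k) → Fin (ts i) → Finset ℕ,
    (∀ i j, S i j ⊆ H.verts ∧ (S i j).card = (F i).verts.card) ∧
    (∀ p q : Σ i : Fin k, Fin (ts i), p ≠ q → Disjoint (S p.1 p.2) (S q.1 q.2)) ∧
    ∀ i j, (F i).IsCopyIn (H.induce (S i j))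

/-- `ex(n, ⊔ᵢ tᵢ Fᵢ)`. -/
noncomputable def exMixedN (r k : ℕ) (F : Fin k → HGraph r) (ts : Fin k → ℕ)
    (n : ℕ) : ℕ :=
  sSup {m | ∃ H : HGraph r, H.verts.card = n ∧ ¬ HasMixedMatching r k F ts H ∧
    H.edges.card = m}

/-- `ex(n, {F₁,…,F_k})`. -/
noncomputable def exFamN (r k : ℕ) (F : Fin k → HGraph r) (n : ℕ) : ℕ :=
  sSup {m | ∃ H : HGraph r, H.verts.card = n ∧ (∀ i, ¬ (F i).IsCopyIn H) ∧
    H.edges.card = m}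


section Cliques
open scoped Classical

/-- `s`-cliques of the relation `G` inside `V`. -/
noncomputable def kset (G : ℕ → ℕ → Prop) (V : Finset ℕ) (s : ℕ) : Finset (Finset ℕ) :=
  (Finset.powersetCard s V).filter fun Q => ∀ x ∈ Q, ∀ y ∈ Q, x ≠ y → G x y

/-- common neighbours -/
noncomputable def nbs (G : ℕ → ℕ → Prop) (V : Finset ℕ) (R : Finset ℕ) : Finset ℕ :=
  V.filter fun x => x ∉ R ∧ ∀ y ∈ R, G x y

lemma mem_kset {G : ℕ → ℕ → Prop} {V : Finset ℕ} {s : ℕ} {Q : Finset ℕ} :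
    Q ∈ kset G V s ↔ Q ⊆ V ∧ Q.card = s ∧ ∀ x ∈ Q, ∀ y ∈ Q, x ≠ y → G x y := by
  simp [kset, Finset.mem_powersetCard, and_assoc]

lemma mem_nbs {G : ℕ → ℕ → Prop} {V R : Finset ℕ} {x : ℕ} :
    x ∈ nbs G V R ↔ x ∈ V ∧ x ∉ R ∧ ∀ y ∈ R, G x y := by
  simp [nbs]

lemma kset_sum_erase {G : ℕ → ℕ → Prop} (hG : ∀ x y, G x y → G y x) (V : Finset ℕ) (s : ℕ)
    (φ : Finset ℕ → ℕ) :
    ∑ Q ∈ kset G V (s+1), ∑ x ∈ Q, φ (Q.erase x) = ∑ R ∈ kset G V s, (nbs G V R).card * φ R := by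
  have h2 : ∀ R ∈ kset G V s, (nbs G V R).card * φ R = ∑ x ∈ nbs G V R, φ R := by
    intro R _; simp
  rw [Finset.sum_congr rfl h2, Finset.sum_sigma', Finset.sum_sigma']
  refine Finset.sum_bij' (fun p _ => ⟨p.1.erase p.2, p.2⟩) (fun p _ => ⟨insert p.2 p.1, p.2⟩)
    ?_ ?_ ?_ ?_ ?_
  · rintro ⟨Q, x⟩ h
    simp only [Finset.mem_sigma, mem_kset, mem_nbs] at h ⊢
    obtain ⟨⟨h1, h2, h3⟩, h4⟩ := h
    refine ⟨⟨(Finset.erase_subset _ _).trans h1, ?_, ?_⟩, h1 h4, by simp, ?_⟩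
    · rw [Finset.card_erase_of_mem h4, h2]; rfl
    · intro a ha b hb hab
      exact h3 a (Finset.mem_of_mem_erase ha) b (Finset.mem_of_mem_erase hb) hab
    · intro y hy
      exact h3 x h4 y (Finset.mem_of_mem_erase hy) (Finset.ne_of_mem_erase hy).symm
  · rintro ⟨R, x⟩ h
    simp only [Finset.mem_sigma, mem_kset, mem_nbs] at h ⊢
    obtain ⟨⟨h1, h2, h3⟩, h4, h5, h6⟩ := h
    refine ⟨⟨?_, ?_, ?_⟩, by simp⟩
    · exact Finset.insert_subset h4 h1
    · rw [Finset.card_insert_of_notMem h5, h2]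
    · intro a ha b hb hab
      rcases Finset.mem_insert.1 ha with rfl | ha2 <;> rcases Finset.mem_insert.1 hb with rfl | hb2
      · exact absurd rfl hab
      · exact h6 b hb2
      · exact hG _ _ (h6 a ha2)
      · exact h3 a ha2 b hb2 hab
  · rintro ⟨Q, x⟩ h
    simp only [Finset.mem_sigma] at h
    simp [Finset.insert_erase h.2]
  · rintro ⟨R, x⟩ h
    simp only [Finset.mem_sigma, mem_nbs] at h
    simp [Finset.erase_insert h.2.2.1]
  · rintro ⟨Q, x⟩ h
    rfl

lemma kset_sum_nbs {G : ℕ → ℕ → Prop} (hG : ∀ x y, G x y → G y x) (V : Finset ℕ) (s : ℕ) :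
    ∑ R ∈ kset G V s, (nbs G V R).card = (s+1) * (kset G V (s+1)).card := by
  have h := kset_sum_erase hG V s (fun _ => 1)
  simp only [mul_one] at h
  rw [← h]
  have : ∀ Q ∈ kset G V (s+1), ∑ x ∈ Q, 1 = s + 1 := by
    intro Q hQ
    simp [(mem_kset.1 hQ).2.1]
  rw [Finset.sum_congr rfl this]
  simp [mul_comm]

lemma kset_pointwise {G : ℕ → ℕ → Prop} (V : Finset ℕ) (s : ℕ) (Q : Finset ℕ)
    (hQ : Q ∈ kset G V (s+1)) :
    ∑ x ∈ Q, (nbs G V (Q.erase x)).card ≤ V.card + s * (nbs G V Q).card := by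
  have e1 : ∀ x ∈ Q, (nbs G V (Q.erase x)).card =
      ∑ y ∈ V, if (y ∉ Q.erase x ∧ ∀ z ∈ Q.erase x, G y z) then 1 else 0 := by
    intro x _
    rw [nbs, Finset.card_filter]
  rw [Finset.sum_congr rfl e1, Finset.sum_comm]
  have e2 : V.card + s * (nbs G V Q).card =
      ∑ y ∈ V, (1 + s * if (y ∉ Q ∧ ∀ z ∈ Q, G y z) then 1 else 0) := by
    rw [Finset.sum_add_distrib, ← Finset.mul_sum, nbs, Finset.card_filter]; simp
  rw [e2]
  refine Finset.sum_le_sum fun y _ => ?_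
  rw [← Finset.card_filter]
  split_ifs with h
  · calc _ ≤ Q.card := Finset.card_filter_le _ _
      _ = _ := by rw [(mem_kset.1 hQ).2.1]; ring
  · rw [mul_zero, add_zero, Finset.card_le_one]
    intro a ha b hb
    by_contra hab
    simp only [Finset.mem_filter] at ha hb
    apply h
    refine ⟨?_, ?_⟩
    · intro hy
      have h1 := ha.2.1
      have h2 := hb.2.1
      simp only [Finset.mem_erase, not_and] at h1 h2
      have : y = a := by by_contra hh; exact h1 hh hy
      have : y = b := by by_contra hh; exact h2 hh hy
      omega
    · intro z hz
      by_cases hza : z = a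
      · exact hb.2.2 z (Finset.mem_erase.2 ⟨by omega, hz⟩)
      · exact ha.2.2 z (Finset.mem_erase.2 ⟨hza, hz⟩)

/-- Moon--Moser. -/
lemma moon_moser {G : ℕ → ℕ → Prop} (hG : ∀ x y, G x y → G y x) (V : Finset ℕ) (s : ℕ) :
    ((s+1) * (kset G V (s+1)).card)^2 ≤ (kset G V s).card *
      (V.card * (kset G V (s+1)).card + s * ((s+2) * (kset G V (s+2)).card)) := by
  rw [← kset_sum_nbs hG V s]
  have h1 := sq_sum_le_card_mul_sum_sq (s := kset G V s) (f := fun R => (nbs G V R).card)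
  refine h1.trans (Nat.mul_le_mul_left _ ?_)
  have h2 := kset_sum_erase hG V s (fun R => (nbs G V R).card)
  simp only [sq]
  rw [← h2]
  refine (Finset.sum_le_sum fun Q hQ => kset_pointwise V s Q hQ).trans ?_
  rw [Finset.sum_add_distrib, ← Finset.mul_sum, kset_sum_nbs hG V (s+1)]
  simp [mul_comm]

lemma zykov_step {G : ℕ → ℕ → Prop} (hG : ∀ x y, G x y → G y x) (V : Finset ℕ) (q : ℕ)
    (hq : 0 < q) (hfree : kset G V (q+1) = ∅) (d : ℕ) : ∀ s, s + d = q →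
    (s+1) * q * (kset G V (s+1)).card ≤ d * V.card * (kset G V s).card := by
  induction d with
  | zero =>
    intro s hs
    have : s = q := by omega
    subst this
    simp [hfree]
  | succ d ih =>
    intro s hs
    have h1 := ih (s+1) (by omega)
    have h2 := moon_moser hG V s
    set a := (kset G V s).card
    set b := (kset G V (s+1)).card
    set c := (kset G V (s+2)).card
    set n := V.card
    rcases Nat.eq_zero_or_pos b with hb | hb
    · rw [hb]; simp
    · have hqe : q = s + d + 1 := by omega
      have h3 : b * (s+1) * ((s+1) * q * b) ≤ b * (s+1) * ((d+1) * n * a) := by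
        calc b * (s+1) * ((s+1) * q * b) = q * ((s+1)*b)^2 := by ring
          _ ≤ q * (a * (n * b + s * ((s+2) * c))) := Nat.mul_le_mul_left _ h2
          _ = a * (q * n * b + s * ((s+1+1) * q * c)) := by ring
          _ ≤ a * (q * n * b + s * (d * n * b)) := by gcongr
          _ = b * (s+1) * ((d+1) * n * a) := by rw [hqe]; ring
      exact Nat.le_of_mul_le_mul_left h3 (by positivity)

/-- Zykov bound on the number of cliques. -/
lemma zykov {G : ℕ → ℕ → Prop} (hG : ∀ x y, G x y → G y x) (V : Finset ℕ) (q : ℕ)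
    (hq : 0 < q) (hfree : kset G V (q+1) = ∅) (s : ℕ) (hs : s ≤ q) :
    (kset G V s).card * q^s ≤ q.choose s * V.card^s := by
  induction s with
  | zero =>
    have : kset G V 0 ⊆ {∅} := by
      intro Q hQ
      have := (mem_kset.1 hQ).2.1
      simpa using this
    simpa using Finset.card_le_card this
  | succ s ih =>
    have h1 := ih (by omega)
    have h2 := zykov_step hG V q hq hfree (q - s) s (by omega)
    have h3 := Nat.choose_succ_right_eq q s
    have h4 : (s+1) * ((kset G V (s+1)).card * q^(s+1)) ≤ (s+1) * (q.choose (s+1) * V.card^(s+1)) := by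
      calc (s+1) * ((kset G V (s+1)).card * q^(s+1))
          = ((s+1) * q * (kset G V (s+1)).card) * q^s := by ring
        _ ≤ ((q-s) * V.card * (kset G V s).card) * q^s := by gcongr
        _ = (q-s) * V.card * ((kset G V s).card * q^s) := by ring
        _ ≤ (q-s) * V.card * (q.choose s * V.card^s) := by gcongr
        _ = (q.choose s * (q-s)) * V.card^(s+1) := by ring
        _ = (q.choose (s+1) * (s+1)) * V.card^(s+1) := by rw [h3]
        _ = _ := by ring
    exact Nat.le_of_mul_le_mul_left h4 (by omega)

/-- lower bound on number of cliques when every clique has many extensions -/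
lemma kset_lower {G : ℕ → ℕ → Prop} (hG : ∀ x y, G x y → G y x) (V : Finset ℕ) (c q : ℕ)
    (h : ∀ s < c, ∀ R ∈ kset G V s, (c - s) * q ≤ (nbs G V R).card) (s : ℕ) (hs : s ≤ c) :
    c.choose s * q^s ≤ (kset G V s).card := by
  induction s with
  | zero =>
    have : (∅ : Finset ℕ) ∈ kset G V 0 := by simp [mem_kset]
    simpa using Finset.card_pos.2 ⟨_, this⟩
  | succ s ih =>
    have h1 := ih (by omega)
    have h3 := Nat.choose_succ_right_eq c s
    have h4 : (s+1) * (c.choose (s+1) * q^(s+1)) ≤ (s+1) * (kset G V (s+1)).card := by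
      rw [← kset_sum_nbs hG V s]
      calc (s+1) * (c.choose (s+1) * q^(s+1)) = (c.choose (s+1) * (s+1)) * q^(s+1) := by ring
        _ = (c.choose s * (c - s)) * q^(s+1) := by rw [h3]
        _ = (c.choose s * q^s) * ((c-s) * q) := by ring
        _ ≤ (kset G V s).card * ((c-s) * q) := by gcongr
        _ = ∑ R ∈ kset G V s, (c-s) * q := by simp
        _ ≤ _ := Finset.sum_le_sum fun R hR => h s (by omega) R hR
    exact Nat.le_of_mul_le_mul_left h4 (by omega)

/-- K_{q+1}-freeness for a coloured relation -/
lemma kset_color_free (p : ℕ → ℕ) (V : Finset ℕ) (I : Finset ℕ) (hp : ∀ v ∈ V, p v ∈ I) :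
    kset (fun x y => p x ≠ p y) V (I.card + 1) = ∅ := by
  rw [Finset.eq_empty_iff_forall_notMem]
  intro Q hQ
  obtain ⟨h1, h2, h3⟩ := mem_kset.1 hQ
  obtain ⟨x, hx, y, hy, hxy, he⟩ := Finset.exists_ne_map_eq_of_card_lt_of_maps_to
    (s := Q) (t := I) (f := p) (by omega) (fun v hv => hp v (h1 hv))
  exact h3 x hx y hy hxy he

end Cliques

section Embed
open scoped Classical

/-- the forbidden expansion -/
abbrev expF (ℓ r : ℕ) : HGraph r := (emptyOn r (Finset.Icc 1 (ℓ+1))).expansion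

/-- indices of the new vertices -/
def newv (ℓ r a b s : ℕ) : ℕ := (ℓ+2) + (a * (ℓ+2) + b) * r + s

lemma sup_Icc (ℓ : ℕ) : (Finset.Icc 1 (ℓ+1)).sup id = ℓ + 1 := by
  apply le_antisymm
  · exact Finset.sup_le fun b hb => (Finset.mem_Icc.1 hb).2
  · exact Finset.le_sup (f := id) (b := ℓ+1) (by simp)

lemma expF_mem_verts {ℓ r x : ℕ} : x ∈ (expF ℓ r).verts ↔ (x ∈ Finset.Icc 1 (ℓ+1) ∨
    ∃ a b s, a ∈ Finset.Icc 1 (ℓ+1) ∧ b ∈ Finset.Icc 1 (ℓ+1) ∧ a < b ∧ s < r - 2 ∧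
      x = newv ℓ r a b s) := by
  simp only [expF, HGraph.expansion, emptyOn, HGraph.ofEdges, sup_Icc, Finset.mem_union,
    Finset.mem_biUnion, Finset.mem_filter, Finset.mem_product, Finset.mem_image,
    Finset.mem_range, Finset.filter_empty, Finset.notMem_empty, newv]
  constructor
  · rintro (h | ⟨⟨a, b⟩, ⟨⟨h1, h2⟩, h3, _⟩, s, hs, rfl⟩)
    · exact Or.inl h
    · exact Or.inr ⟨a, b, s, h1, h2, h3, hs, rfl⟩
  · rintro (h | ⟨a, b, s, h1, h2, h3, hs, rfl⟩)
    · exact Or.inl h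
    · exact Or.inr ⟨⟨a, b⟩, ⟨⟨h1, h2⟩, h3, by simp⟩, s, hs, rfl⟩

/-- edges of the expansion -/
def fedge (ℓ r a b : ℕ) : Finset ℕ :=
  insert a (insert b ((Finset.range (r-2)).image fun s => newv ℓ r a b s))

lemma expF_mem_edges {ℓ r : ℕ} {e : Finset ℕ} (he : e ∈ (expF ℓ r).edges) :
    ∃ a b, a ∈ Finset.Icc 1 (ℓ+1) ∧ b ∈ Finset.Icc 1 (ℓ+1) ∧ a < b ∧ e = fedge ℓ r a b := by
  simp only [expF, HGraph.expansion, emptyOn, HGraph.ofEdges, sup_Icc, Finset.mem_union,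
    Finset.mem_filter, Finset.mem_product, Finset.mem_image,
    Finset.filter_empty, Finset.notMem_empty, false_or] at he
  obtain ⟨⟨⟨a, b⟩, ⟨⟨h1, h2⟩, h3, _⟩, rfl⟩, _⟩ := he
  exact ⟨a, b, h1, h2, h3, rfl⟩

lemma fedge_mem {ℓ r a b : ℕ} (hr : 2 ≤ r) (ha : a ∈ Finset.Icc 1 (ℓ+1))
    (hb : b ∈ Finset.Icc 1 (ℓ+1)) (hab : a < b) : fedge ℓ r a b ∈ (expF ℓ r).edges := by
  simp only [expF, HGraph.expansion, emptyOn, HGraph.ofEdges, sup_Icc, Finset.mem_union,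
    Finset.mem_filter, Finset.mem_product, Finset.mem_image,
    Finset.filter_empty, Finset.notMem_empty, false_or]
  refine ⟨⟨⟨a, b⟩, ⟨⟨ha, hb⟩, hab, by simp⟩, rfl⟩, ?_, ?_⟩
  · intro x hx
    have : x ∈ (expF ℓ r).verts := by
      rw [expF_mem_verts]
      simp only [fedge, Finset.mem_insert, Finset.mem_image, Finset.mem_range] at hx
      rcases hx with rfl | rfl | ⟨s, hs, rfl⟩
      · exact Or.inl ha
      · exact Or.inl hb
      · exact Or.inr ⟨a, b, s, ha, hb, hab, hs, rfl⟩
    simpa only [expF, HGraph.expansion, emptyOn, HGraph.ofEdges, sup_Icc, Finset.mem_union,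
      Finset.mem_filter, Finset.mem_product, Finset.mem_image,
      Finset.filter_empty, Finset.notMem_empty, false_or] using this
  · rw [Finset.mem_Icc] at ha hb
    rw [fedge, Finset.card_insert_of_notMem, Finset.card_insert_of_notMem,
      Finset.card_image_of_injective, Finset.card_range]
    · omega
    · intro s s' h; simpa [newv] using h
    · simp only [Finset.mem_image, Finset.mem_range, newv, not_exists, not_and]
      intro s hs; omega
    · simp only [Finset.mem_insert, Finset.mem_image, Finset.mem_range, newv, not_or,
        not_exists, not_and]
      exact ⟨by omega, fun s hs => by omega⟩

lemma newv_inj {ℓ r a b s a' b' s' : ℕ} (hb : b ≤ ℓ+1) (hb' : b' ≤ ℓ+1) (hs : s < r) (hs' : s' < r)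
    (h : newv ℓ r a b s = newv ℓ r a' b' s') : a = a' ∧ b = b' ∧ s = s' := by
  simp only [newv] at h
  have h1 : (a * (ℓ+2) + b) * r + s = (a' * (ℓ+2) + b') * r + s' := by omega
  have hrp : 0 < r := by omega
  have hss : s = s' := by
    have := congrArg (· % r) h1
    simpa [Nat.mod_eq_of_lt hs, Nat.mod_eq_of_lt hs', Nat.mul_add_mod_self_right, Nat.add_mod] using this
  subst hss
  have h2 : a * (ℓ+2) + b = a' * (ℓ+2) + b' := by
    have : (a * (ℓ+2) + b) * r = (a' * (ℓ+2) + b') * r := by omega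
    exact Nat.eq_of_mul_eq_mul_right hrp this
  have hbb : b = b' := by
    have := congrArg (· % (ℓ+2)) h2
    simpa [Nat.mod_eq_of_lt (show b < ℓ+2 by omega), Nat.mod_eq_of_lt (show b' < ℓ+2 by omega), Nat.add_mod] using this
  subst hbb
  have : a * (ℓ+2) = a' * (ℓ+2) := by omega
  exact ⟨Nat.eq_of_mul_eq_mul_right (by omega) this, rfl, rfl⟩

lemma exists_enum (A : Finset ℕ) : ∃ h : ℕ → ℕ, Set.InjOn h (Finset.range A.card) ∧
    (Finset.range A.card).image h = A := by
  have e := A.equivFin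
  refine ⟨fun i => if hi : i < A.card then (e.symm ⟨i, hi⟩ : ℕ) else 0, ?_, ?_⟩
  · intro i hi j hj hij
    simp only [Finset.coe_range, Set.mem_Iio] at hi hj
    simp only [hi, hj, dif_pos] at hij
    have := e.symm.injective (Subtype.ext hij)
    simpa using this
  · ext x
    simp only [Finset.mem_image, Finset.mem_range]
    constructor
    · rintro ⟨i, hi, rfl⟩
      simp [hi]
    · intro hx
      exact ⟨e ⟨x, hx⟩, (e ⟨x, hx⟩).2, by simp⟩

lemma embed {ℓ r : ℕ} (hr : 2 ≤ r) (H : HGraph r) (c : ℕ → ℕ)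
    (hc : Set.InjOn c (Finset.Icc 1 (ℓ+1)))
    (g : ℕ → ℕ → Finset ℕ)
    (hg : ∀ a ∈ Finset.Icc 1 (ℓ+1), ∀ b ∈ Finset.Icc 1 (ℓ+1), a < b → g a b ∈ H.edges ∧
      c a ∈ g a b ∧ c b ∈ g a b ∧ ∀ i ∈ Finset.Icc 1 (ℓ+1), c i ∈ g a b → i = a ∨ i = b)
    (hd : ∀ a ∈ Finset.Icc 1 (ℓ+1), ∀ b ∈ Finset.Icc 1 (ℓ+1), a < b →
      ∀ a' ∈ Finset.Icc 1 (ℓ+1), ∀ b' ∈ Finset.Icc 1 (ℓ+1), a' < b' → (a ≠ a' ∨ b ≠ b') →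
      ∀ x ∈ g a b, x ∈ g a' b' → ∃ i ∈ Finset.Icc 1 (ℓ+1), x = c i)
    (hv : ∀ i ∈ Finset.Icc 1 (ℓ+1), c i ∈ H.verts) :
    (expF ℓ r).IsCopyIn H := by
  choose en en1 en2 using exists_enum
  -- the extra part of each chosen edge
  let A : ℕ → ℕ → Finset ℕ := fun a b => g a b \ {c a, c b}
  have hA : ∀ a ∈ Finset.Icc 1 (ℓ+1), ∀ b ∈ Finset.Icc 1 (ℓ+1), a < b → (A a b).card = r - 2 := by
    intro a ha b hb hab
    obtain ⟨h1, h2, h3, h4⟩ := hg a ha b hb hab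
    have hne : c a ≠ c b := fun h => by
      have := hc ha hb h; omega
    have : ({c a, c b} : Finset ℕ) ⊆ g a b := by
      intro x hx; simp at hx; rcases hx with rfl | rfl <;> assumption
    rw [Finset.card_sdiff_of_subset this, H.edges_card _ h1, Finset.card_pair hne]
  let f : ℕ → ℕ := fun x => if x ∈ Finset.Icc 1 (ℓ+1) then c x else
    if h : ∃ t : ℕ × ℕ × ℕ, t.1 ≤ ℓ+1 ∧ t.2.1 ≤ ℓ+1 ∧ t.2.2 < r ∧ x = newv ℓ r t.1 t.2.1 t.2.2 then
      en (A h.choose.1 h.choose.2.1) h.choose.2.2 else 0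
  have fc : ∀ i ∈ Finset.Icc 1 (ℓ+1), f i = c i := fun i hi => by simp only [f, if_pos hi]
  have fn : ∀ a b s, a ∈ Finset.Icc 1 (ℓ+1) → b ∈ Finset.Icc 1 (ℓ+1) → s < r →
      f (newv ℓ r a b s) = en (A a b) s := by
    intro a b s ha hb hs
    rw [Finset.mem_Icc] at ha hb
    have hn : newv ℓ r a b s ∉ Finset.Icc 1 (ℓ+1) := by
      rw [Finset.mem_Icc]; simp only [newv]; omega
    have hex : ∃ t : ℕ × ℕ × ℕ, t.1 ≤ ℓ+1 ∧ t.2.1 ≤ ℓ+1 ∧ t.2.2 < r ∧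
        newv ℓ r a b s = newv ℓ r t.1 t.2.1 t.2.2 := ⟨(a, b, s), ha.2, hb.2, hs, rfl⟩
    simp only [f, if_neg hn]
    rw [dif_pos hex]
    obtain ⟨h1, h2, h3, h4⟩ := hex.choose_spec
    obtain ⟨e1, e2, e3⟩ := newv_inj hb.2 h2 hs h3 h4
    rw [← e1, ← e2, ← e3]
  have fmem : ∀ a ∈ Finset.Icc 1 (ℓ+1), ∀ b ∈ Finset.Icc 1 (ℓ+1), a < b → ∀ s < r - 2,
      f (newv ℓ r a b s) ∈ A a b := by
    intro a ha b hb hab s hs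
    rw [fn a b s ha hb (by omega)]
    have : en (A a b) s ∈ (Finset.range (A a b).card).image (en (A a b)) :=
      Finset.mem_image_of_mem _ (by rw [hA a ha b hb hab]; simpa using hs)
    rwa [en2] at this
  have hAc : ∀ a ∈ Finset.Icc 1 (ℓ+1), ∀ b ∈ Finset.Icc 1 (ℓ+1), a < b →
      ∀ i ∈ Finset.Icc 1 (ℓ+1), c i ∉ A a b := by
    intro a ha b hb hab i hi h
    simp only [A, Finset.mem_sdiff, Finset.mem_insert, Finset.mem_singleton, not_or] at h
    rcases (hg a ha b hb hab).2.2.2 i hi h.1 with rfl | rfl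
    · exact h.2.1 rfl
    · exact h.2.2 rfl
  refine ⟨f, ?_, ?_, ?_⟩
  · intro x hx y hy hxy
    rw [Finset.mem_coe, expF_mem_verts] at hx hy
    rcases hx with hx | ⟨a, b, s, ha, hb, hab, hs, rfl⟩ <;>
    rcases hy with hy | ⟨a', b', s', ha', hb', hab', hs', rfl⟩
    · rw [fc x hx, fc y hy] at hxy; exact hc hx hy hxy
    · exfalso
      have := fmem a' ha' b' hb' hab' s' hs'
      rw [← hxy, fc x hx] at this
      exact hAc a' ha' b' hb' hab' x hx this
    · exfalso
      have := fmem a ha b hb hab s hs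
      rw [hxy, fc y hy] at this
      exact hAc a ha b hb hab y hy this
    · have m1 := fmem a ha b hb hab s hs
      have m2 := fmem a' ha' b' hb' hab' s' hs'
      by_cases hne : a ≠ a' ∨ b ≠ b'
      · exfalso
        rw [← hxy] at m2
        obtain ⟨i, hi, he⟩ := hd a ha b hb hab a' ha' b' hb' hab' hne _
          (Finset.mem_sdiff.1 m1).1 (Finset.mem_sdiff.1 m2).1
        rw [he] at m1
        exact hAc a ha b hb hab i hi m1
      · push Not at hne
        obtain ⟨rfl, rfl⟩ := hne
        rw [fn a b s ha hb (by omega), fn a b s' ha hb (by omega)] at hxy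
        have hcard := hA a ha b hb hab
        rw [en1 (A a b) (by simp [hcard, hs]) (by simp [hcard, hs']) hxy]
  · intro x hx
    rw [expF_mem_verts] at hx
    rcases hx with hx | ⟨a, b, s, ha, hb, hab, hs, rfl⟩
    · rw [fc x hx]; exact hv x hx
    · exact H.edges_sub _ (hg a ha b hb hab).1
        ((Finset.mem_sdiff.1 (fmem a ha b hb hab s hs)).1)
  · intro e he
    obtain ⟨a, b, ha, hb, hab, rfl⟩ := expF_mem_edges he
    obtain ⟨h1, h2, h3, h4⟩ := hg a ha b hb hab
    have : (fedge ℓ r a b).image f = g a b := by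
      rw [fedge, Finset.image_insert, Finset.image_insert, Finset.image_image, fc a ha, fc b hb]
      have : (Finset.range (r-2)).image (f ∘ fun s => newv ℓ r a b s) = A a b := by
        rw [← en2 (A a b), hA a ha b hb hab]
        apply Finset.image_congr
        intro s hs
        simp only [Finset.coe_range, Set.mem_Iio] at hs
        simp only [Function.comp]
        exact fn a b s ha hb (by omega)
      rw [this]
      ext x
      simp only [A, Finset.mem_insert, Finset.mem_sdiff, Finset.mem_singleton]
      constructor
      · rintro (rfl | rfl | h) <;> [exact h2; exact h3; exact h.1]
      · intro hx; tauto
    rw [this]; exact h1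

/-- A pair of vertices is robustly covered. -/
def Ext {r : ℕ} (H : HGraph r) (K : ℕ) (x y : ℕ) : Prop :=
  ∀ S : Finset ℕ, S.card ≤ K → x ∉ S → y ∉ S → ∃ e ∈ H.edges, x ∈ e ∧ y ∈ e ∧ Disjoint e S

lemma Ext.symm {r : ℕ} {H : HGraph r} {K x y : ℕ} (h : Ext H K x y) : Ext H K y x := by
  intro S h1 h2 h3
  obtain ⟨e, he, h4, h5, h6⟩ := h S h1 h3 h2
  exact ⟨e, he, h5, h4, h6⟩

lemma Ext.mono {r : ℕ} {H H' : HGraph r} {K x y : ℕ} (hs : H.edges ⊆ H'.edges)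
    (h : Ext H K x y) : Ext H' K x y := by
  intro S h1 h2 h3
  obtain ⟨e, he, h4, h5, h6⟩ := h S h1 h2 h3
  exact ⟨e, hs he, h4, h5, h6⟩

/-- the constant used for robust covering -/
def KK (ℓ r : ℕ) : ℕ := (ℓ+1) + ((ℓ+2)*(ℓ+2)) * r

/-- Greedy choice of the edges covering the pairs. -/
lemma greedy {r : ℕ} (H : HGraph r) (K : ℕ) (C : Finset ℕ) (e0 : Finset ℕ)
    (he0 : e0 ∈ H.edges) (q0 : Finset ℕ) (hq0 : e0 ∩ C = q0)
    (P : Finset (Finset ℕ)) (hP : ∀ q ∈ P, ∃ x y, x ∈ C ∧ y ∈ C ∧ q = {x, y} ∧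
      Ext H K x y)
    (hK : C.card + (P.card + 1) * r ≤ K) (h0 : q0 ∉ P) :
    ∃ g : Finset ℕ → Finset ℕ, g q0 = e0 ∧ (∀ q ∈ insert q0 P, g q ∈ H.edges ∧ g q ∩ C = q) ∧
      ∀ q ∈ insert q0 P, ∀ q' ∈ insert q0 P, q ≠ q' → g q ∩ g q' ⊆ C := by
  induction P using Finset.induction_on with
  | empty =>
    refine ⟨fun _ => e0, rfl, ?_, ?_⟩
    · intro q hq; simp at hq; subst hq; exact ⟨he0, hq0⟩
    · intro q hq q' hq' h; simp at hq hq'; subst hq; exact absurd hq'.symm h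
  | insert p P hp ih =>
    rw [Finset.card_insert_of_notMem hp] at hK
    obtain ⟨g, g0, g1, g2⟩ := ih (fun q hq => hP q (Finset.mem_insert_of_mem hq))
      (by nlinarith) (fun h => h0 (Finset.mem_insert_of_mem h))
    obtain ⟨x, y, hx, hy, hpq, hext⟩ := hP p (Finset.mem_insert_self _ _)
    let S := (C ∪ (insert q0 P).biUnion g) \ {x, y}
    have hS : S.card ≤ K := by
      calc S.card ≤ (C ∪ (insert q0 P).biUnion g).card := Finset.card_le_card Finset.sdiff_subset
        _ ≤ C.card + ((insert q0 P).biUnion g).card := Finset.card_union_le _ _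
        _ ≤ C.card + (insert q0 P).card * r := by
            gcongr
            apply Finset.card_biUnion_le_card_mul
            intro q hq
            exact (H.edges_card _ (g1 q hq).1).le
        _ ≤ C.card + (P.card + 1) * r := by
            gcongr; exact Finset.card_insert_le _ _
        _ ≤ K := by nlinarith
    obtain ⟨e, he, hxe, hye, hdis⟩ := hext S hS (by simp [S]) (by simp [S])
    have heC : e ∩ C = p := by
      rw [hpq]; ext z
      simp only [Finset.mem_inter, Finset.mem_insert, Finset.mem_singleton]
      constructor
      · rintro ⟨h1, h2⟩
        by_contra h3
        refine Finset.disjoint_left.1 hdis h1 ?_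
        simp only [S, Finset.mem_sdiff, Finset.mem_union, Finset.mem_insert, Finset.mem_singleton]
        exact ⟨Or.inl h2, h3⟩
      · rintro (rfl | rfl)
        · exact ⟨hxe, hx⟩
        · exact ⟨hye, hy⟩
    have hcap : ∀ q ∈ insert q0 P, e ∩ g q ⊆ C := by
      intro q hq z hz
      rw [Finset.mem_inter] at hz
      by_contra hzC
      refine Finset.disjoint_left.1 hdis hz.1 ?_
      simp only [S, Finset.mem_sdiff, Finset.mem_union, Finset.mem_biUnion, Finset.mem_insert,
        Finset.mem_singleton]
      refine ⟨Or.inr ⟨q, by simpa using hq, hz.2⟩, ?_⟩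
      rintro (rfl | rfl) <;> contradiction
    have hp0 : p ≠ q0 := fun h => h0 (by rw [← h]; exact Finset.mem_insert_self _ _)
    have hpn : p ∉ insert q0 P := by
      rw [Finset.mem_insert]; rintro (h | h) <;> contradiction
    have hup : ∀ q ∈ insert q0 P, Function.update g p e q = g q := by
      intro q hq
      apply Function.update_of_ne
      rintro rfl; contradiction
    have hmem : ∀ q ∈ insert q0 (insert p P), q = p ∨ q ∈ insert q0 P := by
      intro q hq
      simp only [Finset.mem_insert] at hq ⊢
      tauto
    refine ⟨Function.update g p e, ?_, ?_, ?_⟩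
    · rw [hup _ (Finset.mem_insert_self _ _), g0]
    · intro q hq
      rcases hmem q hq with rfl | h
      · rw [Function.update_self]; exact ⟨he, heC⟩
      · rw [hup q h]; exact g1 q h
    · intro q hq q' hq' hne
      rcases hmem q hq with rfl | h <;> rcases hmem q' hq' with rfl | h'
      · exact absurd rfl hne
      · rw [Function.update_self, hup q' h']; exact hcap q' h'
      · rw [Function.update_self, hup q h, Finset.inter_comm]; exact hcap q h
      · rw [hup q h, hup q' h']; exact g2 q h q' h' hne

/-- A core with one covered pair and all other pairs robustly covered gives a copy. -/
lemma core_copy {ℓ r : ℕ} (hr : 2 ≤ r) (H : HGraph r) (C : Finset ℕ) (hC : C.card = ℓ+1)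
    (hCV : C ⊆ H.verts) (e0 : Finset ℕ) (he0 : e0 ∈ H.edges) (a b : ℕ)
    (h0 : e0 ∩ C = {a, b})
    (hext : ∀ x ∈ C, ∀ y ∈ C, x ≠ y → ({x, y} : Finset ℕ) ≠ {a, b} → Ext H (KK ℓ r) x y) :
    (expF ℓ r).IsCopyIn H := by
  obtain ⟨h, hinj, himg⟩ := exists_enum C
  rw [hC] at hinj himg
  let c : ℕ → ℕ := fun i => h (i - 1)
  have hcC : ∀ i ∈ Finset.Icc 1 (ℓ+1), c i ∈ C := by
    intro i hi
    rw [Finset.mem_Icc] at hi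
    rw [← himg]
    exact Finset.mem_image_of_mem _ (by simp; omega)
  have hcinj : Set.InjOn c (Finset.Icc 1 (ℓ+1)) := by
    intro i hi j hj hij
    simp only [Finset.coe_Icc, Set.mem_Icc] at hi hj
    have := hinj (by simp; omega) (by simp; omega) hij
    omega
  let P : Finset (Finset ℕ) := (Finset.powersetCard 2 C).erase {a, b}
  have hPc : P.card ≤ (ℓ+1)*(ℓ+1) := by
    calc P.card ≤ (Finset.powersetCard 2 C).card := Finset.card_le_card (Finset.erase_subset _ _)
      _ = (ℓ+1).choose 2 := by rw [Finset.card_powersetCard, hC]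
      _ ≤ (ℓ+1)^2 := Nat.choose_le_pow _ _
      _ = _ := by ring
  obtain ⟨g, g0, g1, g2⟩ := greedy H (KK ℓ r) C e0 he0 {a, b} h0 P (by
    intro q hq
    simp only [P, Finset.mem_erase, Finset.mem_powersetCard] at hq
    obtain ⟨h1, h2, h3⟩ := hq
    obtain ⟨x, y, hxy, rfl⟩ := Finset.card_eq_two.1 h3
    have hx : x ∈ C := h2 (by simp)
    have hy : y ∈ C := h2 (by simp)
    exact ⟨x, y, hx, hy, rfl, hext x hx y hy hxy h1⟩) (by
      rw [hC, KK]
      have : P.card + 1 ≤ (ℓ+2)*(ℓ+2) := by nlinarith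
      gcongr) (by simp [P])
  have hmem : ∀ i ∈ Finset.Icc 1 (ℓ+1), ∀ j ∈ Finset.Icc 1 (ℓ+1), i < j →
      ({c i, c j} : Finset ℕ) ∈ insert ({a, b} : Finset ℕ) P := by
    intro i hi j hj hij
    have hne : c i ≠ c j := fun h => by have := hcinj hi hj h; omega
    rw [Finset.mem_insert]
    by_cases hh : ({c i, c j} : Finset ℕ) = {a, b}
    · exact Or.inl hh
    · right
      simp only [P, Finset.mem_erase, Finset.mem_powersetCard]
      refine ⟨hh, ?_, Finset.card_pair hne⟩
      intro x hx; simp at hx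
      rcases hx with rfl | rfl
      · exact hcC i hi
      · exact hcC j hj
  refine embed hr H c hcinj (fun i j => g {c i, c j}) ?_ ?_ ?_
  · intro i hi j hj hij
    obtain ⟨h1, h2⟩ := g1 _ (hmem i hi j hj hij)
    have h3 : ∀ z, z ∈ ({c i, c j} : Finset ℕ) ↔ z ∈ g {c i, c j} ∧ z ∈ C := by
      intro z; conv_lhs => rw [← h2]
      exact Finset.mem_inter
    refine ⟨h1, ((h3 _).1 (by simp)).1, ((h3 _).1 (by simp)).1, ?_⟩
    intro k hk hkm
    have := (h3 (c k)).2 ⟨hkm, hcC k hk⟩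
    simp only [Finset.mem_insert, Finset.mem_singleton] at this
    rcases this with h | h
    · exact Or.inl (hcinj hk hi h)
    · exact Or.inr (hcinj hk hj h)
  · intro i hi j hj hij i' hi' j' hj' hij' hne x hx hx'
    have hdiff : ({c i, c j} : Finset ℕ) ≠ {c i', c j'} := by
      intro h
      have e1 : c i ∈ ({c i', c j'} : Finset ℕ) := by rw [← h]; simp
      have e2 : c j ∈ ({c i', c j'} : Finset ℕ) := by rw [← h]; simp
      simp only [Finset.mem_insert, Finset.mem_singleton] at e1 e2
      have e3 : i = i' ∨ i = j' := e1.imp (hcinj hi hi') (hcinj hi hj')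
      have e4 : j = i' ∨ j = j' := e2.imp (hcinj hj hi') (hcinj hj hj')
      omega
    have := g2 _ (hmem i hi j hj hij) _ (hmem i' hi' j' hj' hij') hdiff
      (Finset.mem_inter.2 ⟨hx, hx'⟩)
    rw [← himg] at this
    obtain ⟨k, hk, rfl⟩ := Finset.mem_image.1 this
    exact ⟨k+1, by simp at hk ⊢; omega, by simp [c]⟩
  · intro i hi; exact hCV (hcC i hi)

/-- all pairs robustly covered -/
lemma core_copy' {ℓ r : ℕ} (hr : 2 ≤ r) (hℓ : 1 ≤ ℓ) (H : HGraph r) (C : Finset ℕ) (hC : C.card = ℓ+1)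
    (hCV : C ⊆ H.verts)
    (hext : ∀ x ∈ C, ∀ y ∈ C, x ≠ y → Ext H (KK ℓ r) x y) :
    (expF ℓ r).IsCopyIn H := by
  obtain ⟨a, ha, b, hb, hab⟩ := Finset.one_lt_card.1 (show 1 < C.card by omega)
  obtain ⟨e, he, h1, h2, h3⟩ := hext a ha b hb hab (C \ {a, b})
    ((Finset.card_le_card Finset.sdiff_subset).trans (by rw [hC, KK]; omega)) (by simp) (by simp)
  refine core_copy hr H C hC hCV e he a b ?_ (fun x hx y hy hxy _ => hext x hx y hy hxy)
  ext z
  simp only [Finset.mem_inter, Finset.mem_insert, Finset.mem_singleton]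
  constructor
  · rintro ⟨h4, h5⟩
    by_contra h6
    exact Finset.disjoint_left.1 h3 h4 (by simpa [h5] using h6)
  · rintro (rfl | rfl) <;> simp [*]

/-- partite graphs contain no copy -/
lemma partite_free {ℓ r : ℕ} (hr : 2 ≤ r) (H : HGraph r) (p : ℕ → ℕ)
    (hp : ∀ v ∈ H.verts, p v < ℓ)
    (he : ∀ e ∈ H.edges, ∀ x ∈ e, ∀ y ∈ e, x ≠ y → p x ≠ p y) :
    ¬ (expF ℓ r).IsCopyIn H := by
  rintro ⟨f, h1, h2, h3⟩
  have hcv : ∀ i ∈ Finset.Icc 1 (ℓ+1), i ∈ (expF ℓ r).verts := fun i hi =>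
    expF_mem_verts.2 (Or.inl hi)
  have : ∀ a ∈ Finset.Icc 1 (ℓ+1), ∀ b ∈ Finset.Icc 1 (ℓ+1), a < b → p (f a) ≠ p (f b) := by
    intro a ha b hb hab
    refine he _ (h3 _ (fedge_mem hr ha hb hab)) (f a) ?_ (f b) ?_ ?_
    · exact Finset.mem_image_of_mem _ (by simp [fedge])
    · exact Finset.mem_image_of_mem _ (by simp [fedge])
    · intro h; have := h1 (hcv a ha) (hcv b hb) h; omega
  obtain ⟨x, hx, y, hy, hxy, he⟩ := Finset.exists_ne_map_eq_of_card_lt_of_maps_to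
    (s := Finset.Icc 1 (ℓ+1)) (t := Finset.range ℓ) (f := fun i => p (f i)) (by simp)
    (fun v hv => Finset.mem_coe.2 (Finset.mem_range.2 (hp _ (h2 v (hcv v hv)))))
  rcases lt_or_gt_of_ne hxy with h | h
  · exact this x hx y hy h he
  · exact this y hy x hx h he.symm

end Embed

section Count
open scoped Classical

variable {r : ℕ}

lemma mem_induce_edges {H : HGraph r} {S e : Finset ℕ} :
    e ∈ (H.induce S).edges ↔ e ∈ H.edges ∧ e ⊆ S := by
  simp only [HGraph.induce, HGraph.ofEdges, Finset.mem_filter]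
  constructor
  · tauto
  · rintro ⟨h1, h2⟩
    exact ⟨⟨h1, h2⟩, Finset.subset_inter (H.edges_sub e h1) h2, H.edges_card e h1⟩

/-- delete a set of vertices -/
def dl (H : HGraph r) (Z : Finset ℕ) : HGraph r := H.induce (H.verts \ Z)

lemma dl_verts (H : HGraph r) (Z : Finset ℕ) : (dl H Z).verts = H.verts \ Z := by
  simp only [dl, HGraph.induce, HGraph.ofEdges]
  exact Finset.inter_eq_right.2 Finset.sdiff_subset

lemma mem_dl_edges {H : HGraph r} {Z e : Finset ℕ} :
    e ∈ (dl H Z).edges ↔ e ∈ H.edges ∧ Disjoint e Z := by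
  rw [dl, mem_induce_edges, Finset.subset_sdiff]
  constructor
  · tauto
  · rintro ⟨h1, h2⟩; exact ⟨h1, H.edges_sub e h1, h2⟩

lemma dl_edges_sub (H : HGraph r) (Z : Finset ℕ) : (dl H Z).edges ⊆ H.edges := fun _ he =>
  (mem_dl_edges.1 he).1

/-- codegree -/
noncomputable def codeg (H : HGraph r) (x y : ℕ) : ℕ :=
  (H.edges.filter fun e => x ∈ e ∧ y ∈ e).card

lemma sup_count (H : HGraph r) (A : Finset ℕ) :
    (H.edges.filter fun e => A ⊆ e).card ≤ H.verts.card ^ (r - A.card) := by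
  have h1 : (H.edges.filter fun e => A ⊆ e).card ≤
      (Finset.powersetCard (r - A.card) H.verts).card := by
    apply Finset.card_le_card_of_injOn (fun e => e \ A)
    · intro e he
      simp only [Finset.coe_filter, Set.mem_ofPred_eq] at he
      simp only [Finset.mem_coe, Finset.mem_powersetCard]
      refine ⟨Finset.sdiff_subset.trans (H.edges_sub e he.1), ?_⟩
      rw [Finset.card_sdiff_of_subset he.2, H.edges_card e he.1]
    · intro e he e' he' h
      simp only [Finset.coe_filter, Set.mem_ofPred_eq] at he he'
      have : e \ A = e' \ A := h
      rw [← Finset.sdiff_union_of_subset he.2, this, Finset.sdiff_union_of_subset he'.2]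
  refine h1.trans ?_
  rw [Finset.card_powersetCard]
  exact Nat.choose_le_pow _ _

lemma deg_le (H : HGraph r) (v : ℕ) : H.deg v ≤ H.verts.card ^ (r - 1) := by
  have := sup_count H {v}
  simpa [HGraph.deg] using this

lemma codeg_le (H : HGraph r) {x y : ℕ} (hxy : x ≠ y) : codeg H x y ≤ H.verts.card ^ (r - 2) := by
  have := sup_count H {x, y}
  rw [Finset.card_pair hxy] at this
  simpa [codeg, Finset.insert_subset_iff] using this

lemma codeg_light (hr : 2 ≤ r) (H : HGraph r) {K x y : ℕ} (hxy : x ≠ y) (h : ¬ Ext H K x y) :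
    codeg H x y * H.verts.card ≤ K * H.verts.card ^ (r - 2) := by
  simp only [Ext, not_forall, not_exists, not_and] at h
  obtain ⟨S, hS, hx, hy, hh⟩ := h
  have hsub : (H.edges.filter fun e => x ∈ e ∧ y ∈ e) ⊆
      S.biUnion fun z => H.edges.filter fun e => ({x, y, z} : Finset ℕ) ⊆ e := by
    intro e he
    rw [Finset.mem_filter] at he
    obtain ⟨z, hz1, hz2⟩ := Finset.not_disjoint_iff.1 (hh e he.1 he.2.1 he.2.2)
    rw [Finset.mem_biUnion]
    refine ⟨z, hz2, Finset.mem_filter.2 ⟨he.1, ?_⟩⟩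
    intro w hw
    simp only [Finset.mem_insert, Finset.mem_singleton] at hw
    rcases hw with rfl | rfl | rfl
    exacts [he.2.1, he.2.2, hz1]
  have hc3 : ∀ z ∈ S, ({x, y, z} : Finset ℕ).card = 3 := by
    intro z hz
    rw [Finset.card_eq_three]
    exact ⟨x, y, z, hxy, fun h => hx (h ▸ hz), fun h => hy (h ▸ hz), rfl⟩
  rcases Nat.lt_or_ge r 3 with h3 | h3
  · have : codeg H x y = 0 := by
      rw [codeg, Finset.card_eq_zero, Finset.eq_empty_iff_forall_notMem]
      intro e he
      obtain ⟨z, hz, hze⟩ := Finset.mem_biUnion.1 (hsub he)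
      rw [Finset.mem_filter] at hze
      have := Finset.card_le_card hze.2
      rw [hc3 z hz, H.edges_card e hze.1] at this
      omega
    rw [this]; simp
  · have h1 : codeg H x y ≤ K * H.verts.card ^ (r-3) := by
      refine (Finset.card_le_card hsub).trans ?_
      refine (Finset.card_biUnion_le_card_mul _ _ (H.verts.card^(r-3)) ?_).trans ?_
      · intro z hz
        have := sup_count H {x, y, z}
        rwa [hc3 z hz] at this
      · gcongr
    calc codeg H x y * H.verts.card ≤ K * H.verts.card ^ (r-3) * H.verts.card := by gcongr
      _ = K * H.verts.card ^ (r-2) := by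
        rw [mul_assoc, ← pow_succ]; congr 2; omega

/-- edges containing a light pair -/
def light (H : HGraph r) (K : ℕ) (e : Finset ℕ) : Prop :=
  ∃ x ∈ e, ∃ y ∈ e, x ≠ y ∧ ¬ Ext H K x y

lemma light_count (hr : 2 ≤ r) (H : HGraph r) (K : ℕ) :
    (H.edges.filter fun e => light H K e).card ≤ K * H.verts.card ^ (r-1) := by
  set n := H.verts.card with hn
  rcases Nat.eq_zero_or_pos n with h0 | hpos
  · have : H.edges.filter (fun e => light H K e) = ∅ := by
      rw [Finset.eq_empty_iff_forall_notMem]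
      rintro e he
      obtain ⟨x, hx, _⟩ := (Finset.mem_filter.1 he).2
      have := H.edges_sub e (Finset.mem_filter.1 he).1 hx
      have h2 : H.verts = ∅ := Finset.card_eq_zero.1 h0
      rw [h2] at this; simp at this
    rw [this]; simp
  · have hsub : (H.edges.filter fun e => light H K e) ⊆
        ((H.verts ×ˢ H.verts).filter fun q => q.1 ≠ q.2 ∧ ¬ Ext H K q.1 q.2).biUnion
          fun q => H.edges.filter fun e => q.1 ∈ e ∧ q.2 ∈ e := by
      intro e he
      obtain ⟨h1, x, hx, y, hy, hxy, hl⟩ := Finset.mem_filter.1 he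
      rw [Finset.mem_biUnion]
      refine ⟨(x, y), ?_, Finset.mem_filter.2 ⟨h1, hx, hy⟩⟩
      simp only [Finset.mem_filter, Finset.mem_product]
      exact ⟨⟨H.edges_sub e h1 hx, H.edges_sub e h1 hy⟩, hxy, hl⟩
    have h1 := (Finset.card_le_card hsub).trans Finset.card_biUnion_le
    have h2 : (H.edges.filter fun e => light H K e).card * n ≤ (K * n^(r-1)) * n := by
      calc _ ≤ (∑ q ∈ (H.verts ×ˢ H.verts).filter fun q => q.1 ≠ q.2 ∧ ¬ Ext H K q.1 q.2,
              codeg H q.1 q.2) * n := Nat.mul_le_mul_right _ h1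
        _ = ∑ q ∈ (H.verts ×ˢ H.verts).filter fun q => q.1 ≠ q.2 ∧ ¬ Ext H K q.1 q.2,
              codeg H q.1 q.2 * n := by rw [Finset.sum_mul]
        _ ≤ ∑ q ∈ (H.verts ×ˢ H.verts).filter fun q => q.1 ≠ q.2 ∧ ¬ Ext H K q.1 q.2,
              K * n^(r-2) := by
            refine Finset.sum_le_sum fun q hq => ?_
            obtain ⟨_, h3, h4⟩ := Finset.mem_filter.1 hq
            exact codeg_light hr H h3 h4
        _ ≤ (n*n) * (K * n^(r-2)) := by
            rw [Finset.sum_const, smul_eq_mul]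
            gcongr
            refine (Finset.card_filter_le _ _).trans ?_
            rw [Finset.card_product]
        _ = (K * n^(r-1)) * n := by
            have : r - 1 = (r-2) + 1 := by omega
            rw [this]; ring
    exact Nat.le_of_mul_le_mul_right h2 hpos

/-- edges through `v` and through a vertex of `X` -/
lemma thru_count (H : HGraph r) (v : ℕ) (X : Finset ℕ) (hv : v ∉ X) :
    (H.edges.filter fun e => v ∈ e ∧ ∃ w ∈ X, w ∈ e).card ≤ ∑ w ∈ X, codeg H v w := by
  have hsub : (H.edges.filter fun e => v ∈ e ∧ ∃ w ∈ X, w ∈ e) ⊆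
      X.biUnion fun w => H.edges.filter fun e => v ∈ e ∧ w ∈ e := by
    intro e he
    obtain ⟨h1, h2, w, hw, hwe⟩ := Finset.mem_filter.1 he
    exact Finset.mem_biUnion.2 ⟨w, hw, Finset.mem_filter.2 ⟨h1, h2, hwe⟩⟩
  exact (Finset.card_le_card hsub).trans Finset.card_biUnion_le

lemma thru_count_all (H : HGraph r) (v : ℕ) (X : Finset ℕ) (hv : v ∉ X) :
    (H.edges.filter fun e => v ∈ e ∧ ∃ w ∈ X, w ∈ e).card ≤ X.card * H.verts.card ^ (r-2) := by
  refine (thru_count H v X hv).trans ?_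
  refine (Finset.sum_le_card_nsmul _ _ (H.verts.card ^ (r-2)) ?_).trans (by simp)
  intro w hw
  exact codeg_le H (fun h => hv (h ▸ hw))

lemma thru_count_light (hr : 2 ≤ r) (H : HGraph r) (K v : ℕ) (X : Finset ℕ) (hv : v ∉ X)
    (hX : X ⊆ H.verts) (hl : ∀ w ∈ X, ¬ Ext H K v w) :
    (H.edges.filter fun e => v ∈ e ∧ ∃ w ∈ X, w ∈ e).card ≤ K * H.verts.card ^ (r-2) := by
  set n := H.verts.card with hn
  rcases Nat.eq_zero_or_pos n with h0 | hpos
  · have h2 : H.verts = ∅ := Finset.card_eq_zero.1 h0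
    have : X = ∅ := by rw [h2] at hX; exact Finset.subset_empty.1 hX
    subst this; simp
  · have h1 := thru_count H v X hv
    have h2 : (H.edges.filter fun e => v ∈ e ∧ ∃ w ∈ X, w ∈ e).card * n ≤ (K * n^(r-2)) * n := by
      calc _ ≤ (∑ w ∈ X, codeg H v w) * n := Nat.mul_le_mul_right _ h1
        _ = ∑ w ∈ X, codeg H v w * n := by rw [Finset.sum_mul]
        _ ≤ ∑ w ∈ X, K * n^(r-2) := Finset.sum_le_sum fun w hw =>
            codeg_light hr H (fun h => hv (h ▸ hw)) (hl w hw)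
        _ = X.card * (K * n^(r-2)) := by simp
        _ ≤ n * (K * n^(r-2)) := by
            gcongr
            exact Finset.card_le_card hX
        _ = _ := by ring
    exact Nat.le_of_mul_le_mul_right h2 hpos

/-- edges through `v` whose link lies in a clique family -/
lemma link_count (H : HGraph r) (v : ℕ) (φ : Finset ℕ → Prop) (G : ℕ → ℕ → Prop) (N : Finset ℕ)
    (h : ∀ e ∈ H.edges, v ∈ e → φ e → (∀ w ∈ e, w ≠ v → w ∈ N) ∧
      ∀ x ∈ e, ∀ y ∈ e, x ≠ v → y ≠ v → x ≠ y → G x y) :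
    (H.edges.filter fun e => v ∈ e ∧ φ e).card ≤ (kset G N (r-1)).card := by
  apply Finset.card_le_card_of_injOn (fun e => e.erase v)
  · intro e he
    simp only [Finset.coe_filter, Set.mem_ofPred_eq] at he
    obtain ⟨h1, h2, h3⟩ := he
    obtain ⟨h4, h5⟩ := h e h1 h2 h3
    rw [Finset.mem_coe, mem_kset]
    refine ⟨?_, ?_, ?_⟩
    · intro w hw
      rw [Finset.mem_erase] at hw
      exact h4 w hw.2 hw.1
    · simp only [Finset.card_erase_of_mem h2, H.edges_card e h1]
    · intro x hx y hy hxy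
      simp only [Finset.mem_erase] at hx hy
      exact h5 x hx.2 y hy.2 hx.1 hy.1 hxy
  · intro e he e' he' hee
    simp only [Finset.coe_filter, Set.mem_ofPred_eq] at he he'
    have : e.erase v = e'.erase v := hee
    rw [← Finset.insert_erase he.2.1, this, Finset.insert_erase he'.2.1]

/-- edges split -/
lemma deg_split (H : HGraph r) (v : ℕ) (φ : Finset ℕ → Prop) :
    H.deg v ≤ (H.edges.filter fun e => v ∈ e ∧ φ e).card +
      (H.edges.filter fun e => v ∈ e ∧ ¬ φ e).card := by
  rw [HGraph.deg]
  refine (Finset.card_le_card ?_).trans (Finset.card_union_le _ _)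
  intro e he
  simp only [Finset.mem_union, Finset.mem_filter] at he ⊢
  tauto

lemma ext_free {ℓ : ℕ} (hr : 2 ≤ r) (hℓ : 1 ≤ ℓ) (H : HGraph r)
    (hF : ¬ (expF ℓ r).IsCopyIn H) : kset (Ext H (KK ℓ r)) H.verts (ℓ+1) = ∅ := by
  rw [Finset.eq_empty_iff_forall_notMem]
  intro Q hQ
  obtain ⟨h1, h2, h3⟩ := mem_kset.1 hQ
  exact hF (core_copy' hr hℓ H Q h2 h1 h3)

/-- density bound -/
lemma density {ℓ : ℕ} (hr : 2 ≤ r) (hℓ : r ≤ ℓ) (H : HGraph r)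
    (hF : ¬ (expF ℓ r).IsCopyIn H) :
    H.edges.card * ℓ^r ≤ ℓ.choose r * H.verts.card^r + KK ℓ r * H.verts.card^(r-1) * ℓ^r := by
  have h1 : H.edges.card ≤ (kset (Ext H (KK ℓ r)) H.verts r).card +
      (H.edges.filter fun e => light H (KK ℓ r) e).card := by
    refine (Finset.card_le_card ?_).trans (Finset.card_union_le _ _)
    intro e he
    rw [Finset.mem_union, Finset.mem_filter, mem_kset]
    by_cases hl : light H (KK ℓ r) e
    · exact Or.inr ⟨he, hl⟩
    · left
      refine ⟨H.edges_sub e he, H.edges_card e he, ?_⟩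
      intro x hx y hy hxy
      by_contra hh
      exact hl ⟨x, hx, y, hy, hxy, hh⟩
  have h2 := zykov (G := Ext H (KK ℓ r)) (fun _ _ h => h.symm) H.verts ℓ (by omega)
    (ext_free hr (by omega) H hF) r hℓ
  have h3 := light_count hr H (KK ℓ r)
  calc H.edges.card * ℓ^r ≤ ((kset (Ext H (KK ℓ r)) H.verts r).card +
      (H.edges.filter fun e => light H (KK ℓ r) e).card) * ℓ^r := Nat.mul_le_mul_right _ h1
    _ = (kset (Ext H (KK ℓ r)) H.verts r).card * ℓ^r +
      (H.edges.filter fun e => light H (KK ℓ r) e).card * ℓ^r := by ring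
    _ ≤ _ := by gcongr

lemma sum_thru (H : HGraph r) (φ : Finset ℕ → Prop) :
    ∑ v ∈ H.verts, (H.edges.filter fun e => v ∈ e ∧ φ e).card =
      r * (H.edges.filter φ).card := by
  have h1 : ∀ v ∈ H.verts, (H.edges.filter fun e => v ∈ e ∧ φ e).card =
      ∑ e ∈ H.edges.filter φ, if v ∈ e then 1 else 0 := by
    intro v _
    rw [← Finset.card_filter, Finset.filter_filter]
    congr 1; ext e; simp only [Finset.mem_filter]; tauto
  rw [Finset.sum_congr rfl h1, Finset.sum_comm]
  have h2 : ∀ e ∈ H.edges.filter φ, (∑ v ∈ H.verts, if v ∈ e then 1 else 0) = r := by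
    intro e he
    have he' := (Finset.mem_filter.1 he).1
    rw [← Finset.card_filter, Finset.filter_mem_eq_inter,
      Finset.inter_eq_right.2 (H.edges_sub e he'), H.edges_card e he']
  rw [Finset.sum_congr rfl h2]; simp [mul_comm]

/-- degree bound through heavy neighbourhood -/
lemma deg_heavy {ℓ : ℕ} (hr : 2 ≤ r) (hℓ : r ≤ ℓ) (H : HGraph r)
    (hF : ¬ (expF ℓ r).IsCopyIn H) (v : ℕ) (hv : v ∈ H.verts) :
    H.deg v * (ℓ-1)^(r-1) ≤
      (H.edges.filter fun e => v ∈ e ∧ light H (KK ℓ r) e).card * (ℓ-1)^(r-1) +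
      (ℓ-1).choose (r-1) * (H.verts.filter fun w => w ≠ v ∧ Ext H (KK ℓ r) v w).card^(r-1) := by
  set N := H.verts.filter fun w => w ≠ v ∧ Ext H (KK ℓ r) v w with hN
  have h1 : H.deg v ≤ (H.edges.filter fun e => v ∈ e ∧ light H (KK ℓ r) e).card +
      (H.edges.filter fun e => v ∈ e ∧ ¬ light H (KK ℓ r) e).card := by
    convert deg_split H v (light H (KK ℓ r))
  have h2 : (H.edges.filter fun e => v ∈ e ∧ ¬ light H (KK ℓ r) e).card ≤
      (kset (Ext H (KK ℓ r)) N (r-1)).card := by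
   convert link_count H v (fun e => ¬ light H (KK ℓ r) e) (Ext H (KK ℓ r)) N (by
    intro e he hve hnl
    have key : ∀ x ∈ e, ∀ y ∈ e, x ≠ y → Ext H (KK ℓ r) x y := by
      intro x hx y hy hxy
      by_contra hh
      exact hnl ⟨x, hx, y, hy, hxy, hh⟩
    refine ⟨?_, fun x hx y hy _ _ hxy => key x hx y hy hxy⟩
    intro w hw hwv
    rw [hN, Finset.mem_filter]
    exact ⟨H.edges_sub e he hw, hwv, key v hve w hw hwv.symm⟩)
  have hfree : kset (Ext H (KK ℓ r)) N ((ℓ-1)+1) = ∅ := by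
    rw [Finset.eq_empty_iff_forall_notMem]
    intro Q hQ
    obtain ⟨h3, h4, h5⟩ := mem_kset.1 hQ
    have hvQ : v ∉ Q := fun h => by
      have := h3 h
      rw [hN, Finset.mem_filter] at this
      exact this.2.1 rfl
    have : insert v Q ∈ kset (Ext H (KK ℓ r)) H.verts (ℓ+1) := by
      rw [mem_kset]
      refine ⟨Finset.insert_subset hv (h3.trans (Finset.filter_subset _ _)), ?_, ?_⟩
      · rw [Finset.card_insert_of_notMem hvQ, h4]; omega
      · have hvw : ∀ w ∈ Q, Ext H (KK ℓ r) v w := fun w hw =>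
          ((Finset.mem_filter.1 (h3 hw)).2).2
        intro x hx y hy hxy
        rw [Finset.mem_insert] at hx hy
        rcases hx with hx | hx <;> rcases hy with hy | hy
        · exact absurd (hx.trans hy.symm) hxy
        · rw [hx]; exact hvw y hy
        · rw [hy]; exact (hvw x hx).symm
        · exact h5 x hx y hy hxy
    rw [ext_free hr (by omega) H hF] at this
    simp at this
  have h6 := zykov (G := Ext H (KK ℓ r)) (fun _ _ h => h.symm) N (ℓ-1) (by omega) hfree (r-1)
    (by omega)
  calc H.deg v * (ℓ-1)^(r-1) ≤ ((H.edges.filter fun e => v ∈ e ∧ light H (KK ℓ r) e).card +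
        (kset (Ext H (KK ℓ r)) N (r-1)).card) * (ℓ-1)^(r-1) := by
        apply Nat.mul_le_mul_right; omega
    _ = (H.edges.filter fun e => v ∈ e ∧ light H (KK ℓ r) e).card * (ℓ-1)^(r-1) +
        (kset (Ext H (KK ℓ r)) N (r-1)).card * (ℓ-1)^(r-1) := by ring
    _ ≤ _ := by gcongr

/-- vertex deletion bookkeeping -/
lemma edges_le_dl (H : HGraph r) (Z : Finset ℕ) :
    H.edges.card ≤ (dl H Z).edges.card + ∑ z ∈ Z, H.deg z := by
  have : H.edges ⊆ (dl H Z).edges ∪ Z.biUnion fun z => H.edges.filter fun e => z ∈ e := by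
    intro e he
    rw [Finset.mem_union, mem_dl_edges, Finset.mem_biUnion]
    by_cases h : Disjoint e Z
    · exact Or.inl ⟨he, h⟩
    · obtain ⟨z, h1, h2⟩ := Finset.not_disjoint_iff.1 h
      exact Or.inr ⟨z, h2, Finset.mem_filter.2 ⟨he, h1⟩⟩
  refine (Finset.card_le_card this).trans ((Finset.card_union_le _ _).trans ?_)
  gcongr
  exact Finset.card_biUnion_le

lemma deg_le_dl (H : HGraph r) (Z : Finset ℕ) (v : ℕ) (hv : v ∉ Z) :
    H.deg v ≤ (dl H Z).deg v + Z.card * H.verts.card^(r-2) := by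
  have h1 : H.deg v ≤ (H.edges.filter fun e => v ∈ e ∧ ∃ w ∈ Z, w ∈ e).card +
      (H.edges.filter fun e => v ∈ e ∧ ¬ ∃ w ∈ Z, w ∈ e).card := by
    convert deg_split H v (fun e => ∃ w ∈ Z, w ∈ e)
  have h2 := thru_count_all H v Z hv
  have h3 : (H.edges.filter fun e => v ∈ e ∧ ¬ ∃ w ∈ Z, w ∈ e).card ≤ (dl H Z).deg v := by
    apply Finset.card_le_card
    intro e he
    rw [Finset.mem_filter] at he
    rw [Finset.mem_filter, mem_dl_edges]
    refine ⟨⟨he.1, ?_⟩, he.2.1⟩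
    rw [Finset.disjoint_left]
    intro w h4 h5
    exact he.2.2 ⟨w, h5, h4⟩
  omega

lemma dl_dl_edges (H : HGraph r) (Z Z' : Finset ℕ) :
    (dl (dl H Z) Z').edges = (dl H (Z ∪ Z')).edges := by
  ext e
  rw [mem_dl_edges, mem_dl_edges, mem_dl_edges, Finset.disjoint_union_right, and_assoc]

lemma seq_delete (H : HGraph r) (a : ℝ) (k : ℕ) (hk : k ≤ H.verts.card) :
    ∃ Z ⊆ H.verts, Z.card ≤ k ∧ (H.edges.card : ℝ) ≤ (dl H Z).edges.card + Z.card * a ∧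
      (Z.card = k ∨ ∀ v ∈ H.verts \ Z, a ≤ (dl H Z).deg v) := by
  induction k with
  | zero =>
    refine ⟨∅, by simp, by simp, ?_, by simp⟩
    have : (dl H ∅).edges = H.edges := by ext e; simp [mem_dl_edges]
    simp [this]
  | succ k ih =>
    obtain ⟨Z, h1, h2, h3, h4⟩ := ih (by omega)
    by_cases h5 : ∀ v ∈ H.verts \ Z, a ≤ (dl H Z).deg v
    · exact ⟨Z, h1, by omega, h3, Or.inr h5⟩
    · have hZ : Z.card = k := h4.resolve_right h5
      push Not at h5
      obtain ⟨v, hv, hlt⟩ := h5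
      rw [Finset.mem_sdiff] at hv
      have hc : (Z ∪ {v}).card = k + 1 := by
        rw [Finset.union_comm, ← Finset.insert_eq, Finset.card_insert_of_notMem hv.2, hZ]
      refine ⟨Z ∪ {v}, Finset.union_subset h1 (by simpa using hv.1), hc.le, ?_, Or.inl hc⟩
      have h6 := edges_le_dl (dl H Z) {v}
      rw [dl_dl_edges, Finset.sum_singleton] at h6
      have h7 : ((dl H Z).edges.card : ℝ) ≤ (dl H (Z ∪ {v})).edges.card + (dl H Z).deg v := by
        exact_mod_cast h6
      rw [hc]; rw [hZ] at h3
      push_cast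
      linarith

lemma not_copy_dl {F H : HGraph r} (Z : Finset ℕ) (h : ¬ F.IsCopyIn H) : ¬ F.IsCopyIn (dl H Z) := by
  rintro ⟨f, h1, h2, h3⟩
  refine h ⟨f, h1, fun v hv => ?_, fun e he => dl_edges_sub _ _ (h3 e he)⟩
  have := h2 v hv
  rw [dl_verts] at this
  exact (Finset.mem_sdiff.1 this).1

end Count

section Str
open scoped Classical

variable {r : ℕ}

lemma transversal (G : ℕ → ℕ → Prop) (hG : ∀ x y, G x y → G y x) (A : ℕ → Finset ℕ) (d s : ℕ)
    (J : Finset ℕ) (hJ : J.card ≤ s + 1) (hsz : ∀ j ∈ J, s * d < (A j).card)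
    (hd : ∀ i ∈ J, ∀ j ∈ J, i ≠ j → ∀ x ∈ A i, ((A j).filter fun y => ¬ G x y).card ≤ d) :
    ∃ u : ℕ → ℕ, (∀ j ∈ J, u j ∈ A j) ∧ ∀ i ∈ J, ∀ j ∈ J, i ≠ j → G (u i) (u j) := by
  induction J using Finset.induction_on with
  | empty => exact ⟨id, by simp, by simp⟩
  | insert a J ha ih =>
    rw [Finset.card_insert_of_notMem ha] at hJ
    obtain ⟨u, hu1, hu2⟩ := ih (by omega)
      (fun j hj => hsz j (Finset.mem_insert_of_mem hj))
      (fun i hi j hj => hd i (Finset.mem_insert_of_mem hi) j (Finset.mem_insert_of_mem hj))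
    have hlt : (J.biUnion fun j => (A a).filter fun y => ¬ G (u j) y).card < (A a).card := by
      refine lt_of_le_of_lt (Finset.card_biUnion_le_card_mul _ _ d ?_) ?_
      · intro j hj
        exact hd j (Finset.mem_insert_of_mem hj) a (Finset.mem_insert_self _ _)
          (fun h => ha (h ▸ hj)) (u j) (hu1 j hj)
      · refine lt_of_le_of_lt (Nat.mul_le_mul_right d (show J.card ≤ s by omega)) ?_
        exact hsz a (Finset.mem_insert_self _ _)
    obtain ⟨w, hw1, hw2⟩ := Finset.exists_mem_notMem_of_card_lt_card hlt
    have hw3 : ∀ j ∈ J, G (u j) w := by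
      intro j hj
      by_contra hh
      exact hw2 (Finset.mem_biUnion.2 ⟨j, hj, Finset.mem_filter.2 ⟨hw1, hh⟩⟩)
    have hne : ∀ j ∈ J, j ≠ a := fun j hj h => ha (h ▸ hj)
    refine ⟨Function.update u a w, ?_, ?_⟩
    · intro j hj
      rcases Finset.mem_insert.1 hj with rfl | hj
      · simpa using hw1
      · rw [Function.update_of_ne (hne j hj)]; exact hu1 j hj
    · intro i hi j hj hij
      rcases Finset.mem_insert.1 hi with hi | hi <;> rcases Finset.mem_insert.1 hj with hj | hj
      · exact absurd (hi.trans hj.symm) hij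
      · rw [Function.update_of_ne (hne j hj), hi, Function.update_self]
        exact hG _ _ (hw3 j hj)
      · rw [Function.update_of_ne (hne i hi), hj, Function.update_self]
        exact hw3 i hi
      · rw [Function.update_of_ne (hne j hj), Function.update_of_ne (hne i hi)]
        exact hu2 i hi j hj hij

/-- approximate structure -/
structure St (ℓ : ℕ) (H : HGraph r) (W : Finset ℕ) (p : ℕ → ℕ) (d : ℕ) : Prop where
  sub : W ⊆ H.verts
  col : ∀ v ∈ W, p v < ℓ
  non : ∀ x ∈ W, (W.filter fun y => p y ≠ p x ∧ ¬ Ext H (KK ℓ r) x y).card ≤ d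
  big : ∀ i < ℓ, (ℓ+1)*d + r < (W.filter fun y => p y = i).card

/-- a transversal together with extra vertices is a core -/
lemma St.v1 {ℓ : ℕ} (hr : 2 ≤ r) (H : HGraph r) (W : Finset ℕ) (p : ℕ → ℕ) (d : ℕ)
    (hS : St ℓ H W p d) (hF : ¬ (expF ℓ r).IsCopyIn H) :
    ∀ e ∈ H.edges, ∀ x ∈ e, ∀ y ∈ e, x ∈ W → y ∈ W → x ≠ y → p x ≠ p y := by
  intro e he x hx y hy hxW hyW hxy hp
  set A : ℕ → Finset ℕ := fun j => W.filter fun w => p w = j ∧ w ∉ e ∧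
    Ext H (KK ℓ r) x w ∧ Ext H (KK ℓ r) y w with hA
  have memA : ∀ j w, w ∈ A j ↔ w ∈ W ∧ p w = j ∧ w ∉ e ∧
    Ext H (KK ℓ r) x w ∧ Ext H (KK ℓ r) y w := by
    intro j w; simp [hA]
  set J := (Finset.range ℓ).erase (p x) with hJ
  have hpl : p x < ℓ := hS.col x hxW
  have hJc : J.card = ℓ - 1 := by
    rw [hJ, Finset.card_erase_of_mem (Finset.mem_range.2 hpl), Finset.card_range]
  have hsz : ∀ j ∈ J, (ℓ-1) * d < (A j).card := by
    intro j hj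
    rw [hJ, Finset.mem_erase, Finset.mem_range] at hj
    have h1 := hS.big j hj.2
    have h2 : (W.filter fun w => p w = j) ⊆ A j ∪ (e ∪
      ((W.filter fun w => p w ≠ p x ∧ ¬ Ext H (KK ℓ r) x w) ∪
      (W.filter fun w => p w ≠ p y ∧ ¬ Ext H (KK ℓ r) y w))) := by
      intro w hw
      simp only [Finset.mem_union, Finset.mem_filter, memA] at hw ⊢
      have h3 : p w ≠ p x := by rw [hw.2]; exact hj.1
      have h4 : p w ≠ p y := by rw [← hp]; exact h3
      tauto
    have h3 := Finset.card_le_card h2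
    have h4 := hS.non x hxW
    have h5 := hS.non y hyW
    have h6 := H.edges_card e he
    have h7 : ∀ a b : Finset ℕ, (a ∪ b).card ≤ a.card + b.card := Finset.card_union_le
    have h8 := h7 (A j) (e ∪
      ((W.filter fun w => p w ≠ p x ∧ ¬ Ext H (KK ℓ r) x w) ∪
      (W.filter fun w => p w ≠ p y ∧ ¬ Ext H (KK ℓ r) y w)))
    have h9 := h7 e 
      ((W.filter fun w => p w ≠ p x ∧ ¬ Ext H (KK ℓ r) x w) ∪
      (W.filter fun w => p w ≠ p y ∧ ¬ Ext H (KK ℓ r) y w))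
    have h10 := h7 
      (W.filter fun w => p w ≠ p x ∧ ¬ Ext H (KK ℓ r) x w)
      (W.filter fun w => p w ≠ p y ∧ ¬ Ext H (KK ℓ r) y w)
    have h11 : (ℓ+1)*d = (ℓ-1)*d + 2*d := by
      obtain ⟨k, rfl⟩ : ∃ k, ℓ = k+1 := ⟨ℓ-1, by omega⟩
      simp; ring
    omega
  obtain ⟨u, hu1, hu2⟩ := transversal (Ext H (KK ℓ r)) (fun _ _ h => h.symm) A d (ℓ-1) J
    (by omega) hsz (by
      intro i hi j hj hij w hw
      refine (Finset.card_le_card ?_).trans (hS.non w ((memA _ _).1 hw).1)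
      intro z hz
      simp only [Finset.mem_filter, memA] at hz hw ⊢
      exact ⟨hz.1.1, by rw [hz.1.2.1, hw.2.1]; exact hij.symm, hz.2⟩)
  have hu3 : ∀ j ∈ J, u j ∈ W ∧ p (u j) = j ∧ u j ∉ e ∧
    Ext H (KK ℓ r) x (u j) ∧ Ext H (KK ℓ r) y (u j) := fun j hj => (memA _ _).1 (hu1 j hj)
  have hinj : Set.InjOn u J := by
    intro i hi j hj hij
    rw [← (hu3 i hi).2.1, hij, (hu3 j hj).2.1]
  have hyU : y ∉ J.image u := by
    rw [Finset.mem_image]; rintro ⟨j, hj, h⟩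
    exact (hu3 j hj).2.2.1 (h ▸ hy)
  have hxU : x ∉ insert y (J.image u) := by
    rw [Finset.mem_insert, Finset.mem_image]; rintro (h | ⟨j, hj, h⟩)
    · exact hxy h
    · exact (hu3 j hj).2.2.1 (h ▸ hx)
  refine hF (core_copy hr H (insert x (insert y (J.image u))) ?_ ?_ e he x y ?_ ?_)
  · rw [Finset.card_insert_of_notMem hxU, Finset.card_insert_of_notMem hyU,
      Finset.card_image_of_injOn hinj, hJc]; omega
  · intro w hw
    rw [Finset.mem_insert, Finset.mem_insert, Finset.mem_image] at hw
    rcases hw with rfl | rfl | ⟨j, hj, rfl⟩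
    · exact hS.sub hxW
    · exact hS.sub hyW
    · exact hS.sub (hu3 j hj).1
  · ext w
    simp only [Finset.mem_inter, Finset.mem_insert, Finset.mem_image, Finset.mem_singleton]
    constructor
    · rintro ⟨h1, h | h | ⟨j, hj, rfl⟩⟩
      · exact Or.inl h
      · exact Or.inr h
      · exact absurd h1 (hu3 j hj).2.2.1
    · rintro (rfl | rfl)
      · exact ⟨hx, Or.inl rfl⟩
      · exact ⟨hy, Or.inr (Or.inl rfl)⟩
  · intro a ha b hb hab hne
    simp only [Finset.mem_insert, Finset.mem_image] at ha hb
    rcases ha with ha | ha | ⟨j, hj, ha⟩ <;> rcases hb with hb | hb | ⟨k, hk, hb⟩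
    · exact absurd (ha.trans hb.symm) hab
    · exact absurd (by rw [ha, hb]) hne
    · rw [ha, ← hb]; exact (hu3 k hk).2.2.2.1
    · exact absurd (by rw [ha, hb, Finset.pair_comm]) hne
    · exact absurd (ha.trans hb.symm) hab
    · rw [ha, ← hb]; exact (hu3 k hk).2.2.2.2
    · rw [hb, ← ha]; exact (hu3 j hj).2.2.2.1.symm
    · rw [hb, ← ha]; exact (hu3 j hj).2.2.2.2.symm
    · rw [← ha, ← hb]; exact hu2 j hj k hk (fun h => hab (by rw [← ha, ← hb, h]))

lemma St.v2a {ℓ : ℕ} (hr : 2 ≤ r) (hℓ : 1 ≤ ℓ) (H : HGraph r) (W : Finset ℕ) (p : ℕ → ℕ) (d : ℕ)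
    (hS : St ℓ H W p d) (hF : ¬ (expF ℓ r).IsCopyIn H) (v : ℕ) (hv : v ∈ H.verts) :
    ∃ i < ℓ, (W.filter fun w => p w = i ∧ w ≠ v ∧ Ext H (KK ℓ r) v w).card ≤ ℓ * d := by
  by_contra hcon
  push Not at hcon
  set A : ℕ → Finset ℕ := fun j => W.filter fun w => p w = j ∧ w ≠ v ∧ Ext H (KK ℓ r) v w with hA
  have memA : ∀ j w, w ∈ A j ↔ w ∈ W ∧ p w = j ∧ w ≠ v ∧ Ext H (KK ℓ r) v w := by
    intro j w; simp [hA]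
  obtain ⟨u, hu1, hu2⟩ := transversal (Ext H (KK ℓ r)) (fun _ _ h => h.symm) A d ℓ (Finset.range ℓ)
    (by simp) (fun j hj => hcon j (Finset.mem_range.1 hj)) (by
      intro i hi j hj hij w hw
      refine (Finset.card_le_card ?_).trans (hS.non w ((memA _ _).1 hw).1)
      intro z hz
      simp only [Finset.mem_filter, memA] at hz hw ⊢
      exact ⟨hz.1.1, by rw [hz.1.2.1, hw.2.1]; exact hij.symm, hz.2⟩)
  have hu3 : ∀ j ∈ Finset.range ℓ, u j ∈ W ∧ p (u j) = j ∧ u j ≠ v ∧ Ext H (KK ℓ r) v (u j) :=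
    fun j hj => (memA _ _).1 (hu1 j hj)
  have hinj : Set.InjOn u (Finset.range ℓ) := by
    intro i hi j hj hij
    rw [← (hu3 i hi).2.1, hij, (hu3 j hj).2.1]
  have hvU : v ∉ (Finset.range ℓ).image u := by
    rw [Finset.mem_image]; rintro ⟨j, hj, h⟩
    exact (hu3 j hj).2.2.1 h
  refine hF (core_copy' hr hℓ H (insert v ((Finset.range ℓ).image u)) ?_ ?_ ?_)
  · rw [Finset.card_insert_of_notMem hvU, Finset.card_image_of_injOn hinj, Finset.card_range]
  · intro w hw
    rw [Finset.mem_insert, Finset.mem_image] at hw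
    rcases hw with rfl | ⟨j, hj, rfl⟩
    · exact hv
    · exact hS.sub (hu3 j hj).1
  · intro a ha b hb hab
    simp only [Finset.mem_insert, Finset.mem_image] at ha hb
    rcases ha with ha | ⟨j, hj, ha⟩ <;> rcases hb with hb | ⟨k, hk, hb⟩
    · exact absurd (ha.trans hb.symm) hab
    · rw [ha, ← hb]; exact (hu3 k hk).2.2.2
    · rw [hb, ← ha]; exact (hu3 j hj).2.2.2.symm
    · rw [← ha, ← hb]; exact hu2 j hj k hk (fun h => hab (by rw [← ha, ← hb, h]))

lemma St.v2 {ℓ : ℕ} (hr : 2 ≤ r) (hℓ : r ≤ ℓ) (H : HGraph r) (W : Finset ℕ) (p : ℕ → ℕ) (d : ℕ)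
    (hS : St ℓ H W p d) (hF : ¬ (expF ℓ r).IsCopyIn H) (v : ℕ) (hv : v ∈ H.verts) :
    ∃ i < ℓ, (W.filter fun w => p w = i ∧ w ≠ v ∧ Ext H (KK ℓ r) v w).card ≤ ℓ * d ∧
      H.deg v * (ℓ-1)^(r-1) ≤
        (((H.verts \ W).card + ℓ*d + KK ℓ r) * H.verts.card^(r-2)) * (ℓ-1)^(r-1) +
        (ℓ-1).choose (r-1) *
          (W.filter fun w => p w ≠ i ∧ w ≠ v ∧ Ext H (KK ℓ r) v w).card^(r-1) := by
  obtain ⟨i, hi, hX⟩ := hS.v2a hr (by omega) H W p d hF v hv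
  refine ⟨i, hi, hX, ?_⟩
  set X1 := (H.verts \ W).erase v
  set X2 := W.filter fun w => p w = i ∧ w ≠ v ∧ Ext H (KK ℓ r) v w
  set X3 := W.filter fun w => w ≠ v ∧ ¬ Ext H (KK ℓ r) v w
  set N := W.filter fun w => p w ≠ i ∧ w ≠ v ∧ Ext H (KK ℓ r) v w
  set n := H.verts.card
  have c1 : (H.edges.filter fun e => v ∈ e ∧ ∃ w ∈ X1, w ∈ e).card ≤ (H.verts \ W).card * n^(r-2) := by
    refine (thru_count_all H v X1 (by simp [X1])).trans ?_
    exact Nat.mul_le_mul_right _ (Finset.card_le_card (Finset.erase_subset _ _))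
  have c2 : (H.edges.filter fun e => v ∈ e ∧ ∃ w ∈ X2, w ∈ e).card ≤ (ℓ * d) * n^(r-2) := by
    refine (thru_count_all H v X2 (by simp [X2])).trans ?_
    exact Nat.mul_le_mul_right _ hX
  have c3 : (H.edges.filter fun e => v ∈ e ∧ ∃ w ∈ X3, w ∈ e).card ≤ KK ℓ r * n^(r-2) := by
    refine (thru_count_light hr H (KK ℓ r) v X3 (by simp [X3])
      ((Finset.filter_subset _ _).trans hS.sub) ?_)
    intro w hw
    exact (Finset.mem_filter.1 hw).2.2
  have c4 : (H.edges.filter fun e => v ∈ e ∧ ∀ w ∈ e, w ≠ v → w ∈ N).card ≤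
      (kset (fun x y => p x ≠ p y) N (r-1)).card := by
    have hlc := link_count H v (fun e => ∀ w ∈ e, w ≠ v → w ∈ N) (fun x y => p x ≠ p y) N (by
      intro e he hve hN
      refine ⟨hN, fun x hx y hy hxv hyv hxy => ?_⟩
      exact hS.v1 hr H W p d hF e he x hx y hy (Finset.mem_filter.1 (hN x hx hxv)).1
        (Finset.mem_filter.1 (hN y hy hyv)).1 hxy)
    convert hlc
  have c5 : H.deg v ≤ (H.edges.filter fun e => v ∈ e ∧ ∃ w ∈ X1, w ∈ e).card +
      ((H.edges.filter fun e => v ∈ e ∧ ∃ w ∈ X2, w ∈ e).card +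
      ((H.edges.filter fun e => v ∈ e ∧ ∃ w ∈ X3, w ∈ e).card +
      (H.edges.filter fun e => v ∈ e ∧ ∀ w ∈ e, w ≠ v → w ∈ N).card)) := by
    rw [HGraph.deg]
    refine le_trans (Finset.card_le_card (t :=
      (H.edges.filter fun e => v ∈ e ∧ ∃ w ∈ X1, w ∈ e) ∪
      ((H.edges.filter fun e => v ∈ e ∧ ∃ w ∈ X2, w ∈ e) ∪
      ((H.edges.filter fun e => v ∈ e ∧ ∃ w ∈ X3, w ∈ e) ∪
      (H.edges.filter fun e => v ∈ e ∧ ∀ w ∈ e, w ≠ v → w ∈ N)))) ?_) ?_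
    · intro e he
      obtain ⟨he1, he2⟩ := Finset.mem_filter.1 he
      by_cases h4 : ∀ w ∈ e, w ≠ v → w ∈ N
      · simp only [Finset.mem_union, Finset.mem_filter]; tauto
      · push Not at h4
        obtain ⟨w, hw1, hw2, hw3⟩ := h4
        simp only [Finset.mem_union, Finset.mem_filter]
        by_cases hwW : w ∈ W
        · by_cases hE : Ext H (KK ℓ r) v w
          · have : p w = i := by
              by_contra hh
              exact hw3 (Finset.mem_filter.2 ⟨hwW, hh, hw2, hE⟩)
            exact Or.inr (Or.inl ⟨he1, he2, w, Finset.mem_filter.2 ⟨hwW, this, hw2, hE⟩, hw1⟩)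
          · exact Or.inr (Or.inr (Or.inl ⟨he1, he2, w, Finset.mem_filter.2 ⟨hwW, hw2, hE⟩, hw1⟩))
        · refine Or.inl ⟨he1, he2, w, ?_, hw1⟩
          exact Finset.mem_erase.2 ⟨hw2, Finset.mem_sdiff.2 ⟨H.edges_sub e he1 hw1, hwW⟩⟩
    · refine (Finset.card_union_le _ _).trans ?_
      gcongr
      refine (Finset.card_union_le _ _).trans ?_
      gcongr
      exact Finset.card_union_le _ _
  have hfree := kset_color_free p N ((Finset.range ℓ).erase i) (by
    intro w hw
    obtain ⟨h1, h2, _⟩ := Finset.mem_filter.1 hw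
    exact Finset.mem_erase.2 ⟨h2, Finset.mem_range.2 (hS.col w h1)⟩)
  rw [Finset.card_erase_of_mem (Finset.mem_range.2 hi), Finset.card_range] at hfree
  have c6 := zykov (G := fun x y => p x ≠ p y) (fun _ _ h => h.symm) N (ℓ-1) (by omega) hfree (r-1)
    (by omega)
  calc H.deg v * (ℓ-1)^(r-1) ≤ ((((H.verts \ W).card + ℓ*d + KK ℓ r) * n^(r-2)) +
        (kset (fun x y => p x ≠ p y) N (r-1)).card) * (ℓ-1)^(r-1) := by
        apply Nat.mul_le_mul_right
        rw [add_mul, add_mul]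
        omega
    _ = (((H.verts \ W).card + ℓ*d + KK ℓ r) * n^(r-2)) * (ℓ-1)^(r-1) +
        (kset (fun x y => p x ≠ p y) N (r-1)).card * (ℓ-1)^(r-1) := by ring
    _ ≤ _ := by gcongr

end Str

section MinDeg
open scoped Classical

variable {r : ℕ}

lemma aes (G : ℕ → ℕ → Prop) (hG : ∀ x y, G x y → G y x) (W : Finset ℕ) (ℓ : ℕ) (hℓ : 2 ≤ ℓ)
    (hW : W.Nonempty) (hfree : kset G W (ℓ+1) = ∅)
    (hd : ∀ v ∈ W, (3*ℓ-4) * W.card < (W.filter fun w => w ≠ v ∧ G v w).card * (3*ℓ-1)) :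
    ∃ p : ℕ → ℕ, (∀ v ∈ W, p v < ℓ) ∧ ∀ x ∈ W, ∀ y ∈ W, x ≠ y → G x y → p x ≠ p y := by
  let Γ : SimpleGraph {x // x ∈ W} :=
    { Adj := fun x y => x ≠ y ∧ G x y
      symm := ⟨fun x y h => ⟨h.1.symm, hG _ _ h.2⟩⟩
      loopless := ⟨fun x h => h.1 rfl⟩ }
  have : Nonempty {x // x ∈ W} := ⟨⟨hW.choose, hW.choose_spec⟩⟩
  have hcol : Γ.Colorable ℓ := by
    apply SimpleGraph.colorable_of_cliqueFree_lt_minDegree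
    · intro s hs
      have h1 : s.map (Function.Embedding.subtype _) ∈ kset G W (ℓ+1) := by
        rw [mem_kset]
        refine ⟨?_, ?_, ?_⟩
        · intro x hx
          obtain ⟨y, _, rfl⟩ := Finset.mem_map.1 hx
          exact y.2
        · rw [Finset.card_map]; exact hs.2
        · intro x hx y hy hxy
          obtain ⟨x', hx', rfl⟩ := Finset.mem_map.1 hx
          obtain ⟨y', hy', rfl⟩ := Finset.mem_map.1 hy
          exact (hs.1 hx' hy' (fun h => hxy (by rw [h]))).2
      rw [hfree] at h1
      simp at h1
    · obtain ⟨v, hv⟩ := Γ.exists_minimal_degree_vertex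
      rw [hv, Nat.div_lt_iff_lt_mul (by omega)]
      refine lt_of_eq_of_lt ?_ (lt_of_lt_of_eq (hd v v.2) ?_)
      · simp
      · congr 1
        rw [← SimpleGraph.card_neighborFinset_eq_degree,
          ← Finset.card_map (Function.Embedding.subtype _)]
        congr 1
        ext w
        simp only [Finset.mem_filter, Finset.mem_map, SimpleGraph.mem_neighborFinset,
          Function.Embedding.subtype_apply]
        constructor
        · rintro ⟨h1, h2, h3⟩
          exact ⟨⟨w, h1⟩, ⟨fun h => h2 (by rw [h]), h3⟩, rfl⟩
        · rintro ⟨a, ⟨h1, h2⟩, rfl⟩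
          exact ⟨a.2, fun h => h1 (Subtype.ext h.symm), h2⟩
  obtain ⟨C⟩ := hcol
  refine ⟨fun x => if h : x ∈ W then (C ⟨x, h⟩ : Fin ℓ).val else 0, ?_, ?_⟩
  · intro v hv
    simp only [hv, dif_pos]
    exact (C ⟨v, hv⟩).2
  · intro x hx y hy hxy hg he
    simp only [hx, hy, dif_pos] at he
    have : Γ.Adj ⟨x, hx⟩ ⟨y, hy⟩ := ⟨fun h => hxy (congrArg Subtype.val h), hg⟩
    exact C.valid this (Fin.ext he)

lemma sum_classes (W : Finset ℕ) (p : ℕ → ℕ) (ℓ : ℕ) (hp : ∀ v ∈ W, p v < ℓ) :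
    ∑ i ∈ Finset.range ℓ, (W.filter fun w => p w = i).card = W.card := by
  rw [← Finset.card_eq_sum_card_fiberwise (f := p) (t := Finset.range ℓ)]
  intro v hv
  simpa using hp v hv

/-- colouring structure of a dense clique-free relation -/
lemma dense_color (G : ℕ → ℕ → Prop) (hG : ∀ x y, G x y → G y x) (V W : Finset ℕ) (ℓ : ℕ)
    (hℓ : 2 ≤ ℓ) (hW : W.Nonempty) (hWV : W ⊆ V) (hfree : kset G V (ℓ+1) = ∅) (ε : ℝ) (hε : 0 < ε)
    (hε2 : 2 * ε * (ℓ * (3*ℓ-1)) < 1)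
    (hc : ((V \ W).card : ℝ) ≤ ε * V.card)
    (hd : ∀ v ∈ W, (1 - 1/ℓ - ε) * V.card ≤ ((V.filter fun w => w ≠ v ∧ G v w).card : ℝ)) :
    ∃ p : ℕ → ℕ, (∀ v ∈ W, p v < ℓ) ∧
      (∀ x ∈ W, ((W.filter fun y => p y ≠ p x ∧ ¬ G x y).card : ℝ) ≤ (ℓ+1)*ε*V.card) ∧
      ∀ i < ℓ, (1/ℓ - ℓ * ε) * V.card ≤ ((W.filter fun y => p y = i).card : ℝ) := by
  have hn : (0:ℝ) < V.card := by
    have := hW.mono hWV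
    exact_mod_cast this.card_pos
  have hℓ' : (2:ℝ) ≤ ℓ := by exact_mod_cast hℓ
  have hcW : ((V \ W).card : ℝ) + W.card = V.card := by
    have := Finset.card_sdiff_add_card_eq_card hWV
    exact_mod_cast this
  have hfreeW : kset G W (ℓ+1) = ∅ := by
    rw [Finset.eq_empty_iff_forall_notMem] at hfree ⊢
    intro Q hQ
    rw [mem_kset] at hQ
    exact hfree Q (mem_kset.2 ⟨hQ.1.trans hWV, hQ.2⟩)
  have hWn : (W.card : ℝ) ≤ V.card := by exact_mod_cast Finset.card_le_card hWV
  obtain ⟨p, hp1, hp2⟩ := aes G hG W ℓ hℓ hW hfreeW (by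
    intro v hv
    have h1 := hd v hv
    have h2 : ((V.filter fun w => w ≠ v ∧ G v w).card : ℝ) ≤
        (W.filter fun w => w ≠ v ∧ G v w).card + (V \ W).card := by
      have : (V.filter fun w => w ≠ v ∧ G v w) ⊆ (W.filter fun w => w ≠ v ∧ G v w) ∪ (V \ W) := by
        intro w hw
        simp only [Finset.mem_union, Finset.mem_filter, Finset.mem_sdiff] at hw ⊢
        tauto
      exact_mod_cast (Finset.card_le_card this).trans (Finset.card_union_le _ _)
    set x : ℝ := ((W.filter fun w => w ≠ v ∧ G v w).card : ℝ) with hx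
    have h3 : (1 - 1/ℓ - 2*ε) * V.card ≤ x := by linarith
    have h4 : (3*(ℓ:ℝ)-4) * V.card < x * (3*ℓ-1) := by
      have h5 : (3*(ℓ:ℝ)-4) < (1 - 1/ℓ - 2*ε) * (3*ℓ-1) := by
        have : (1 - 1/ℓ - 2*ε) * (3*ℓ-1) - (3*(ℓ:ℝ)-4) = (1 - 2 * ε * (ℓ * (3*ℓ-1)))/ℓ := by
          field_simp; ring
        have h6 : 0 < (1 - 2 * ε * (ℓ * (3*ℓ-1)))/ℓ := by
          apply div_pos <;> linarith
        linarith
      calc (3*(ℓ:ℝ)-4) * V.card < ((1 - 1/ℓ - 2*ε) * (3*ℓ-1)) * V.card := by gcongr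
        _ = ((1 - 1/ℓ - 2*ε) * V.card) * (3*ℓ-1) := by ring
        _ ≤ _ := by
          apply mul_le_mul_of_nonneg_right h3; linarith
    have h7 : (((3*ℓ-4 : ℕ) * W.card : ℕ) : ℝ) <
        (((W.filter fun w => w ≠ v ∧ G v w).card * (3*ℓ-1 : ℕ) : ℕ) : ℝ) := by
      push_cast [Nat.cast_sub (show 4 ≤ 3*ℓ by omega), Nat.cast_sub (show 1 ≤ 3*ℓ by omega)]
      refine lt_of_le_of_lt ?_ h4
      apply mul_le_mul_of_nonneg_left hWn; linarith
    exact_mod_cast h7)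
  have hup : ∀ i < ℓ, ((W.filter fun y => p y = i).card : ℝ) ≤ (1/ℓ + ε) * V.card := by
    intro i hi
    rcases (W.filter fun y => p y = i).eq_empty_or_nonempty with h | ⟨x, hx⟩
    · rw [h]; simp; positivity
    · rw [Finset.mem_filter] at hx
      have h1 := hd x hx.1
      have h2 : Disjoint (W.filter fun y => p y = i) (V.filter fun w => w ≠ x ∧ G x w) := by
        rw [Finset.disjoint_left]
        intro w hw1 hw2
        rw [Finset.mem_filter] at hw1 hw2
        exact hp2 x hx.1 w hw1.1 hw2.2.1.symm hw2.2.2 (hx.2.trans hw1.2.symm)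
      have h3 : ((W.filter fun y => p y = i) ∪ (V.filter fun w => w ≠ x ∧ G x w)).card ≤ V.card :=
        Finset.card_le_card (Finset.union_subset ((Finset.filter_subset _ _).trans hWV)
          (Finset.filter_subset _ _))
      rw [Finset.card_union_of_disjoint h2] at h3
      have h4 : ((W.filter fun y => p y = i).card : ℝ) +
        (V.filter fun w => w ≠ x ∧ G x w).card ≤ V.card := by exact_mod_cast h3
      linarith
  have hlo : ∀ i < ℓ, (1/ℓ - ℓ * ε) * V.card ≤ ((W.filter fun y => p y = i).card : ℝ) := by
    intro i hi
    have h1 := sum_classes W p ℓ hp1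
    rw [← Finset.add_sum_erase _ _ (Finset.mem_range.2 hi)] at h1
    have h2 : (∑ j ∈ (Finset.range ℓ).erase i, ((W.filter fun w => p w = j).card : ℝ)) ≤
        (ℓ - 1) * ((1/ℓ + ε) * V.card) := by
      refine (Finset.sum_le_card_nsmul _ _ ((1/ℓ + ε) * V.card) ?_).trans ?_
      · intro j hj
        exact hup j (Finset.mem_range.1 (Finset.mem_of_mem_erase hj))
      · rw [Finset.card_erase_of_mem (Finset.mem_range.2 hi), Finset.card_range, nsmul_eq_mul,
          Nat.cast_sub (by omega)]
        simp
    have h3 : ((W.filter fun w => p w = i).card : ℝ) +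
      ∑ j ∈ (Finset.range ℓ).erase i, ((W.filter fun w => p w = j).card : ℝ) = W.card := by
      exact_mod_cast h1
    have h4 : (ℓ - 1) * ((1/ℓ + ε) * V.card) = (1 - 1/ℓ + (ℓ-1)*ε) * (V.card : ℝ) := by
      field_simp
    have h5 : (W.card : ℝ) ≥ (1 - ε) * V.card := by linarith
    nlinarith
  refine ⟨p, hp1, ?_, hlo⟩
  intro x hx
  have h1 := hd x hx
  have h2 := hlo (p x) (hp1 x hx)
  have hdis : Disjoint ((W.filter fun y => p y ≠ p x ∧ ¬ G x y) ∪ (W.filter fun y => p y = p x))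
      (V.filter fun w => w ≠ x ∧ G x w) := by
    rw [Finset.disjoint_left]
    intro w hw1 hw2
    simp only [Finset.mem_filter, Finset.mem_union] at hw1 hw2
    rcases hw1 with hw1 | hw1
    · exact hw1.2.2 hw2.2.2
    · exact hp2 x hx w hw1.1 hw2.2.1.symm hw2.2.2 hw1.2.symm
  have hdis2 : Disjoint (W.filter fun y => p y ≠ p x ∧ ¬ G x y) (W.filter fun y => p y = p x) := by
    rw [Finset.disjoint_left]
    intro w hw1 hw2
    simp only [Finset.mem_filter] at hw1 hw2
    exact hw1.2.1 hw2.2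
  have h3 : (((W.filter fun y => p y ≠ p x ∧ ¬ G x y) ∪ (W.filter fun y => p y = p x)) ∪
      (V.filter fun w => w ≠ x ∧ G x w)).card ≤ V.card :=
    Finset.card_le_card (Finset.union_subset (Finset.union_subset
      ((Finset.filter_subset _ _).trans hWV) ((Finset.filter_subset _ _).trans hWV))
      (Finset.filter_subset _ _))
  rw [Finset.card_union_of_disjoint hdis, Finset.card_union_of_disjoint hdis2] at h3
  have h4 : ((W.filter fun y => p y ≠ p x ∧ ¬ G x y).card : ℝ) + (W.filter fun y => p y = p x).card +
      (V.filter fun w => w ≠ x ∧ G x w).card ≤ V.card := by exact_mod_cast h3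
  nlinarith

/-- the limit degree constant -/
noncomputable def DD (ℓ r : ℕ) : ℝ := ((ℓ-1).choose (r-1) : ℝ) / (ℓ:ℝ)^(r-1)

lemma DD_pos {ℓ r : ℕ} (hr : 2 ≤ r) (hℓ : r ≤ ℓ) : 0 < DD ℓ r := by
  have h1 : 0 < (ℓ-1).choose (r-1) := Nat.choose_pos (by omega)
  have h2 : (0:ℝ) < ℓ := by exact_mod_cast (by omega : 0 < ℓ)
  rw [DD]; positivity

/-- from degree to neighbourhood size -/
lemma root_lemma {ℓ r : ℕ} (hr : 2 ≤ r) (hℓ : r ≤ ℓ) (n N : ℕ) (hn : 0 < n) (σ : ℝ) (hσ : 0 ≤ σ)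
    (h : (DD ℓ r - σ) * n^(r-1) * ((ℓ-1 : ℕ):ℝ)^(r-1) ≤ (ℓ-1).choose (r-1) * (N:ℝ)^(r-1)) :
    (1 - 1/ℓ - σ / DD ℓ r) * n ≤ (N : ℝ) := by
  have hD := DD_pos hr hℓ
  have hℓ1 : (0:ℝ) < ((ℓ-1 : ℕ):ℝ) := by exact_mod_cast (by omega : 0 < ℓ-1)
  have hℓ0 : (0:ℝ) < ℓ := by exact_mod_cast (by omega : 0 < ℓ)
  have hcast : ((ℓ-1 : ℕ):ℝ) = ℓ - 1 := by rw [Nat.cast_sub (by omega)]; simp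
  have hn' : (0:ℝ) < n := by exact_mod_cast hn
  set x : ℝ := (N:ℝ) * ℓ / (((ℓ-1 : ℕ):ℝ) * n) with hx
  have hx0 : 0 ≤ x := by positivity
  have hN : (N:ℝ) = x * ((1 - 1/ℓ) * n) := by
    rw [hx, hcast]
    have : (ℓ:ℝ) - 1 ≠ 0 := by rw [← hcast]; exact hℓ1.ne'
    field_simp
  have hC : ((ℓ-1).choose (r-1) : ℝ) = DD ℓ r * (ℓ:ℝ)^(r-1) := by rw [DD]; field_simp
  have hx1 : 1 - σ / DD ℓ r ≤ x^(r-1) := by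
    have h1 : (ℓ-1).choose (r-1) * (N:ℝ)^(r-1) = (DD ℓ r * x^(r-1)) *
        (n^(r-1) * ((ℓ-1 : ℕ):ℝ)^(r-1)) := by
      rw [hC, hx, div_pow, mul_pow, mul_pow]; field_simp
    rw [h1, mul_assoc] at h
    have h2 := le_of_mul_le_mul_right h (by positivity)
    rw [sub_le_iff_le_add, ← sub_le_iff_le_add', le_div_iff₀ hD]
    nlinarith
  have hx2 : 1 - σ / DD ℓ r ≤ x := by
    rcases le_total x 1 with h1 | h1
    · refine hx1.trans ?_
      calc x^(r-1) ≤ x^1 := pow_le_pow_of_le_one hx0 h1 (by omega)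
        _ = x := pow_one x
    · have : 0 ≤ σ / DD ℓ r := by positivity
      linarith
  rw [hN, ← mul_assoc]
  have h3 : 0 ≤ 1/(ℓ:ℝ) := by positivity
  have h4 : 0 ≤ σ / DD ℓ r := by positivity
  have h5 : 1/(ℓ:ℝ) ≤ 1 := by rw [div_le_one hℓ0]; exact_mod_cast (by omega : 1 ≤ ℓ)
  apply mul_le_mul_of_nonneg_right _ hn'.le
  nlinarith

end MinDeg

section MinDeg2
open scoped Classical

variable {r : ℕ}

lemma bad_count {ℓ : ℕ} (hr : 2 ≤ r) (H : HGraph r) (β : ℝ) (hβ : 0 < β) (hn : 0 < H.verts.card) :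
    ((H.verts.filter fun v => ¬ (((H.edges.filter fun e => v ∈ e ∧ light H (KK ℓ r) e).card : ℝ) ≤
      β * (H.verts.card:ℝ)^(r-1))).card : ℝ) * β ≤ r * KK ℓ r := by
  set B := H.verts.filter fun v => ¬ (((H.edges.filter fun e => v ∈ e ∧ light H (KK ℓ r) e).card : ℝ) ≤
      β * (H.verts.card:ℝ)^(r-1)) with hB
  have h1 : (B.card : ℝ) * (β * (H.verts.card:ℝ)^(r-1)) ≤
      ∑ v ∈ H.verts, ((H.edges.filter fun e => v ∈ e ∧ light H (KK ℓ r) e).card : ℝ) := by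
    calc (B.card : ℝ) * (β * (H.verts.card:ℝ)^(r-1)) = ∑ v ∈ B, (β * (H.verts.card:ℝ)^(r-1)) := by
          simp
      _ ≤ ∑ v ∈ B, ((H.edges.filter fun e => v ∈ e ∧ light H (KK ℓ r) e).card : ℝ) := by
          refine Finset.sum_le_sum fun v hv => ?_
          rw [hB, Finset.mem_filter] at hv
          exact (not_le.1 hv.2).le
      _ ≤ _ := Finset.sum_le_sum_of_subset_of_nonneg (Finset.filter_subset _ _) (by intros; positivity)
  have h2 : ∑ v ∈ H.verts, ((H.edges.filter fun e => v ∈ e ∧ light H (KK ℓ r) e).card : ℝ) ≤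
      r * (KK ℓ r * (H.verts.card:ℝ)^(r-1)) := by
    have h3 := sum_thru H (light H (KK ℓ r))
    have h4 := light_count hr H (KK ℓ r)
    have h5 : ∑ v ∈ H.verts, (H.edges.filter fun e => v ∈ e ∧ light H (KK ℓ r) e).card ≤
        r * (KK ℓ r * H.verts.card^(r-1)) := by
      refine le_trans (le_of_eq ?_) (Nat.mul_le_mul_left r h4)
      convert h3
    exact_mod_cast h5
  have hp : (0:ℝ) < (H.verts.card:ℝ)^(r-1) := by positivity
  refine le_of_mul_le_mul_right (a := (H.verts.card:ℝ)^(r-1)) ?_ hp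
  linarith

set_option maxHeartbeats 2000000 in
lemma min_deg {ℓ : ℕ} (hr : 2 ≤ r) (hℓ : r ≤ ℓ) (κ : ℝ) (hκ : 0 < κ)
    (hκ2 : κ * (4*(ℓ+1)*ℓ) ≤ 1) :
    ∃ θ : ℝ, 0 < θ ∧ ∃ N : ℕ, ∀ H : HGraph r, ¬ (expF ℓ r).IsCopyIn H → N ≤ H.verts.card →
      (∀ v ∈ H.verts, (DD ℓ r - θ) * (H.verts.card:ℝ)^(r-1) ≤ H.deg v) →
      ∃ p : ℕ → ℕ, ∃ d : ℕ, St ℓ H H.verts p d ∧ (d:ℝ) ≤ κ * H.verts.card ∧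
        ∀ i < ℓ, (1/ℓ - κ) * (H.verts.card:ℝ) ≤ ((H.verts.filter fun y => p y = i).card : ℝ) := by
  have hD := DD_pos hr hℓ
  have hℓ2 : (2:ℝ) ≤ ℓ := by exact_mod_cast (by omega : 2 ≤ ℓ)
  set D := DD ℓ r with hDdef
  set T : ℝ := ((ℓ:ℝ)^2+ℓ+2)/D with hT
  have hTpos : 0 < T := by positivity
  set A : ℝ := (ℓ:ℝ)^2+2*ℓ+10+T with hA
  have hApos : 0 < A := by positivity
  set ε : ℝ := κ / A with hε
  have hεpos : 0 < ε := by positivity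
  have hAε : A * ε = κ := by rw [hε]; field_simp
  have hle : ∀ X : ℝ, X ≤ A → X * ε ≤ κ := by
    intro X hX
    rw [← hAε]; exact mul_le_mul_of_nonneg_right hX hεpos.le
  have hk7 : κ ≤ 1/24 := by nlinarith
  have hκ3 : κ * ℓ ≤ 1/12 := by nlinarith
  have hκ4 : κ * (ℓ+2) * ℓ ≤ 1/2 := by nlinarith
  set β : ℝ := ε * D / 2 with hβ
  have hβpos : 0 < β := by positivity
  refine ⟨β, hβpos, ⌈(r * KK ℓ r) / (β*ε)⌉₊ + ⌈(KK ℓ r : ℝ)/ε⌉₊ + 2*ℓ*r + 1, ?_⟩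
  clear_value β ε A T D
  intro H hF hN hdeg
  set n := H.verts.card with hn
  have hnpos : 0 < n := by omega
  have hnR : (0:ℝ) < n := by exact_mod_cast hnpos
  have hN1 : (r * KK ℓ r) / (β*ε) ≤ (n:ℝ) := by
    refine (Nat.le_ceil _).trans ?_
    exact_mod_cast (by omega : ⌈(r * KK ℓ r : ℝ) / (β*ε)⌉₊ ≤ n)
  have hN2 : (KK ℓ r:ℝ) ≤ ε * n := by
    rw [mul_comm, ← div_le_iff₀ hεpos]
    refine (Nat.le_ceil _).trans ?_
    exact_mod_cast (by omega : ⌈(KK ℓ r : ℝ)/ε⌉₊ ≤ n)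
  have hN3 : (r:ℝ) < 1/(2*ℓ) * n := by
    have : ((2*ℓ*r : ℕ):ℝ) < n := by exact_mod_cast (by omega : 2*ℓ*r < n)
    push_cast at this
    rw [one_div, ← div_eq_inv_mul, lt_div_iff₀ (by positivity)]
    linarith
  set W := H.verts.filter fun v => ((H.edges.filter fun e => v ∈ e ∧ light H (KK ℓ r) e).card : ℝ) ≤
      β * (n:ℝ)^(r-1) with hW
  have hWV : W ⊆ H.verts := Finset.filter_subset _ _
  have hc : ((H.verts \ W).card : ℝ) ≤ ε * n := by
    have h1 := bad_count (ℓ := ℓ) hr H β hβpos hnpos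
    have h2 : ((H.verts \ W).card : ℝ) ≤ (r * KK ℓ r) / β := by
      rw [le_div_iff₀ hβpos]
      rw [hW, ← Finset.filter_not]
      exact h1
    have h3 : (r * KK ℓ r) / β ≤ ε * n := by
      rw [mul_comm ε, ← div_le_iff₀ hεpos, div_div]; exact hN1
    linarith
  have hcW : ((H.verts \ W).card : ℝ) + W.card = n := by
    have := Finset.card_sdiff_add_card_eq_card hWV
    exact_mod_cast this
  have hε1 : 10 * ε ≤ κ := hle 10 (by rw [hA]; linarith [sq_nonneg (ℓ:ℝ)])
  have hε3 : ε * n ≤ (1/10) * n := by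
    apply mul_le_mul_of_nonneg_right _ hnR.le
    linarith
  have hWne : W.Nonempty := by
    rw [← Finset.card_pos]
    have : (0:ℝ) < W.card := by linarith
    exact_mod_cast this
  have hnd : ∀ v ∈ W, (1 - 1/ℓ - ε) * n ≤
      ((H.verts.filter fun w => w ≠ v ∧ Ext H (KK ℓ r) v w).card : ℝ) := by
    intro v hv
    have hv' := Finset.mem_filter.1 hv
    have h1 := deg_heavy hr hℓ H hF v hv'.1
    have h2 := hdeg v hv'.1
    have h3 := root_lemma hr hℓ n (H.verts.filter fun w => w ≠ v ∧ Ext H (KK ℓ r) v w).card hnpos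
      (β + β) (by positivity) (by
        have h1' : (H.deg v : ℝ) * ((ℓ-1:ℕ):ℝ)^(r-1) ≤
          ((H.edges.filter fun e => v ∈ e ∧ light H (KK ℓ r) e).card : ℝ) * ((ℓ-1:ℕ):ℝ)^(r-1) +
          (ℓ-1).choose (r-1) *
          ((H.verts.filter fun w => w ≠ v ∧ Ext H (KK ℓ r) v w).card:ℝ)^(r-1) := by
          exact_mod_cast h1
        have h4 : ((D - β) * (n:ℝ)^(r-1)) * ((ℓ-1:ℕ):ℝ)^(r-1) ≤
            (H.deg v : ℝ) * ((ℓ-1:ℕ):ℝ)^(r-1) := by gcongr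
        have h5 : ((H.edges.filter fun e => v ∈ e ∧ light H (KK ℓ r) e).card : ℝ) *
            ((ℓ-1:ℕ):ℝ)^(r-1) ≤ (β * (n:ℝ)^(r-1)) * ((ℓ-1:ℕ):ℝ)^(r-1) := by
          have := hv'.2
          gcongr
        rw [← hDdef]; linarith)
    have h6 : (β + β) / DD ℓ r = ε := by rw [hβ, ← hDdef]; field_simp; ring
    rwa [h6] at h3
  have hl2 : (ℓ:ℝ)^2 * ε ≤ κ := hle _ (by rw [hA]; linarith)
  have hεcond : 2 * ε * (ℓ * (3*ℓ-1)) < 1 := by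
    have h1 : 2 * ε * (ℓ * (3*ℓ-1)) = 6 * ((ℓ:ℝ)^2 * ε) - 2 * (ε * ℓ) := by ring
    have h2 : 0 < ε * ℓ := by positivity
    linarith
  obtain ⟨p, hp1, hp2, hp3⟩ := dense_color (Ext H (KK ℓ r)) (fun _ _ h => h.symm) H.verts W ℓ
    (by omega) hWne hWV (ext_free hr (by omega) H hF) ε hεpos hεcond hc hnd
  set d0 := ⌊(ℓ+1)*ε*n⌋₊ with hd0
  have hd0' : (d0:ℝ) ≤ (ℓ+1)*ε*n := Nat.floor_le (by positivity)
  have hℓε : (ℓ:ℝ) * ε ≤ κ := hle _ (by rw [hA]; linarith [sq_nonneg (ℓ:ℝ)])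
  have hℓε2 : ((ℓ:ℝ)+1)^2 * ε ≤ κ := hle _ (by rw [hA]; linarith)
  have hinv : 1/(2*(ℓ:ℝ)) * ℓ = 1/2 := by field_simp
  have hinv2 : 1/(ℓ:ℝ) = 1/(2*(ℓ:ℝ)) + 1/(2*(ℓ:ℝ)) := by field_simp; ring
  have hk5 : 2 * κ ≤ 1/(2*ℓ) := by
    rw [le_div_iff₀ (by positivity)]; linarith
  have hk6 : (ℓ+2) * κ ≤ 1/(2*ℓ) := by
    rw [le_div_iff₀ (by positivity)]; linarith
  have hS0 : St ℓ H W p d0 := by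
    refine ⟨hWV, hp1, ?_, ?_⟩
    · intro x hx
      exact Nat.le_floor (hp2 x hx)
    · intro i hi
      have h1 := hp3 i hi
      have h2 : (((ℓ+1)*d0 + r : ℕ) : ℝ) < ((W.filter fun y => p y = i).card : ℝ) := by
        refine lt_of_lt_of_le ?_ h1
        push_cast
        have h3 : ((ℓ:ℝ)+1) * d0 ≤ κ * n := by
          calc ((ℓ:ℝ)+1) * d0 ≤ ((ℓ:ℝ)+1) * ((ℓ+1)*ε*n) := by gcongr
            _ = (((ℓ:ℝ)+1)^2 * ε) * n := by ring
            _ ≤ κ * n := by gcongr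
        have h4 : (1/ℓ - ℓ * ε) * (n:ℝ) ≥ (1/(2*(ℓ:ℝ)) + 1/(2*(ℓ:ℝ)) - κ) * n := by
          rw [hinv2]; gcongr
        have h5 : 2 * κ * n ≤ 1/(2*ℓ) * n := by gcongr
        linarith
      exact_mod_cast h2
  have hout : ∀ v ∈ H.verts, ∃ i < ℓ, (v ∈ W → i = p v) ∧
      ((W.filter fun y => p y ≠ i ∧ ¬ Ext H (KK ℓ r) v y).card : ℝ) + ε * n ≤ κ * n := by
    intro v hv
    by_cases hvW : v ∈ W
    · refine ⟨p v, hp1 v hvW, fun _ => rfl, ?_⟩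
      have := hp2 v hvW
      have h2 : ((ℓ:ℝ)+2)*ε ≤ κ := hle _ (by rw [hA]; linarith [sq_nonneg (ℓ:ℝ)])
      have h3 : (((ℓ:ℝ)+2)*ε)*n ≤ κ*n := mul_le_mul_of_nonneg_right h2 hnR.le
      linarith
    · obtain ⟨i, hi, _, h1⟩ := hS0.v2 hr hℓ H W p d0 hF v hv
      refine ⟨i, hi, fun h => absurd h hvW, ?_⟩
      set Nc := (W.filter fun w => p w ≠ i ∧ w ≠ v ∧ Ext H (KK ℓ r) v w) with hNc
      have h2 := hdeg v hv
      set τ : ℝ := ((ℓ:ℝ)^2+ℓ+2)*ε with hτ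
      have h3 := root_lemma hr hℓ n Nc.card hnpos (β + τ) (by positivity) (by
        have h1' : (H.deg v : ℝ) * ((ℓ-1:ℕ):ℝ)^(r-1) ≤
          (((H.verts \ W).card + ℓ*d0 + KK ℓ r : ℝ) * (n:ℝ)^(r-2)) * ((ℓ-1:ℕ):ℝ)^(r-1) +
          (ℓ-1).choose (r-1) * (Nc.card:ℝ)^(r-1) := by
          exact_mod_cast h1
        have h4 : ((D - β) * (n:ℝ)^(r-1)) * ((ℓ-1:ℕ):ℝ)^(r-1) ≤
            (H.deg v : ℝ) * ((ℓ-1:ℕ):ℝ)^(r-1) := by gcongr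
        have h5 : (((H.verts \ W).card + ℓ*d0 + KK ℓ r : ℝ) * (n:ℝ)^(r-2)) ≤ τ * (n:ℝ)^(r-1) := by
          have h6 : ((H.verts \ W).card + ℓ*d0 + KK ℓ r : ℝ) ≤ τ * n := by
            have : (ℓ:ℝ) * d0 ≤ ℓ * ((ℓ+1)*ε*n) := by gcongr
            rw [hτ]; linarith
          calc _ ≤ (τ * n) * (n:ℝ)^(r-2) := by gcongr
            _ = τ * (n:ℝ)^(r-2+1) := by ring
            _ = _ := by congr 2; omega
        have h6 : (((H.verts \ W).card + ℓ*d0 + KK ℓ r : ℝ) * (n:ℝ)^(r-2)) * ((ℓ-1:ℕ):ℝ)^(r-1) ≤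
          (τ * (n:ℝ)^(r-1)) * ((ℓ-1:ℕ):ℝ)^(r-1) := by gcongr
        rw [← hDdef]; linarith)
      have h4 : (β + τ) / DD ℓ r = ε/2 + T*ε := by
        rw [hβ, ← hDdef, hτ, hT]; field_simp
      rw [h4] at h3
      have hdis : Disjoint (W.filter fun y => p y ≠ i ∧ ¬ Ext H (KK ℓ r) v y)
          (W.filter fun y => p y = i) := by
        rw [Finset.disjoint_left]
        intro w hw1 hw2
        simp only [Finset.mem_filter] at hw1 hw2
        exact hw1.2.1 hw2.2
      have hdis2 : Disjoint ((W.filter fun y => p y ≠ i ∧ ¬ Ext H (KK ℓ r) v y) ∪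
          (W.filter fun y => p y = i)) Nc := by
        rw [Finset.disjoint_left]
        intro w hw1 hw2
        simp only [Finset.mem_filter, Finset.mem_union, hNc] at hw1 hw2
        tauto
      have h5 : (((W.filter fun y => p y ≠ i ∧ ¬ Ext H (KK ℓ r) v y) ∪
          (W.filter fun y => p y = i)) ∪ Nc).card ≤ n :=
        (Finset.card_le_card (Finset.union_subset (Finset.union_subset
          (Finset.filter_subset _ _) (Finset.filter_subset _ _)) (Finset.filter_subset _ _))).trans
          (Finset.card_le_card hWV)
      rw [Finset.card_union_of_disjoint hdis2, Finset.card_union_of_disjoint hdis] at h5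
      have h6 : ((W.filter fun y => p y ≠ i ∧ ¬ Ext H (KK ℓ r) v y).card : ℝ) +
          (W.filter fun y => p y = i).card + Nc.card ≤ n := by exact_mod_cast h5
      have h7 := hp3 i hi
      have h8 : ((ℓ:ℝ)*ε + (ε/2 + T*ε) + ε) * n ≤ κ * n := by
        have h9 : ((ℓ:ℝ)+3/2+T)*ε ≤ κ := hle _ (by rw [hA]; linarith [sq_nonneg (ℓ:ℝ)])
        apply mul_le_mul_of_nonneg_right _ hnR.le
        linarith
      linarith
  choose! q hq1 hq2 hq3 using hout
  have hqp : ∀ y ∈ W, q y = p y := fun y hy => hq2 y (hWV hy) hy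
  have hclass : ∀ i < ℓ, (1/ℓ - κ) * (n:ℝ) ≤ ((H.verts.filter fun y => q y = i).card : ℝ) := by
    intro i hi
    have h1 := hp3 i hi
    have h2 : (W.filter fun y => p y = i).card ≤ (H.verts.filter fun y => q y = i).card := by
      apply Finset.card_le_card
      intro y hy
      rw [Finset.mem_filter] at hy ⊢
      exact ⟨hWV hy.1, by rw [hqp y hy.1]; exact hy.2⟩
    have h3 : ((W.filter fun y => p y = i).card : ℝ) ≤ (H.verts.filter fun y => q y = i).card := by
      exact_mod_cast h2
    have h4 : (1/ℓ - κ) * (n:ℝ) ≤ (1/ℓ - ℓ*ε) * n := by gcongr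
    linarith
  have hfl : ((⌊κ*n⌋₊ : ℕ):ℝ) ≤ κ * n := Nat.floor_le (by positivity)
  refine ⟨q, ⌊κ*n⌋₊, ⟨Finset.Subset.refl _, hq1, ?_, ?_⟩, hfl, hclass⟩
  · intro x hx
    apply Nat.le_floor
    have h1 := hq3 x hx
    have h2 : (H.verts.filter fun y => q y ≠ q x ∧ ¬ Ext H (KK ℓ r) x y) ⊆
        (W.filter fun y => p y ≠ q x ∧ ¬ Ext H (KK ℓ r) x y) ∪ (H.verts \ W) := by
      intro y hy
      simp only [Finset.mem_filter, Finset.mem_union, Finset.mem_sdiff] at hy ⊢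
      by_cases hyW : y ∈ W
      · left; rw [← hqp y hyW]; exact ⟨hyW, hy.2⟩
      · right; exact ⟨hy.1, hyW⟩
    have h3 : ((H.verts.filter fun y => q y ≠ q x ∧ ¬ Ext H (KK ℓ r) x y).card : ℝ) ≤
        (W.filter fun y => p y ≠ q x ∧ ¬ Ext H (KK ℓ r) x y).card + (H.verts \ W).card := by
      exact_mod_cast (Finset.card_le_card h2).trans (Finset.card_union_le _ _)
    linarith
  · intro i hi
    have h1 := hclass i hi
    have h2 : (((ℓ+1)*⌊κ*n⌋₊ + r : ℕ) : ℝ) < ((H.verts.filter fun y => q y = i).card : ℝ) := by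
      refine lt_of_lt_of_le ?_ h1
      push_cast
      have h3 : ((ℓ:ℝ)+1) * (⌊κ*n⌋₊ : ℝ) ≤ ((ℓ:ℝ)+1) * (κ * n) := by gcongr
      have h5 : (ℓ+2) * κ * n ≤ 1/(2*ℓ) * n := by gcongr
      rw [hinv2]
      linarith
    exact_mod_cast h2

end MinDeg2

section P7
open scoped Classical
variable {r : ℕ}

noncomputable def LL (ℓ r : ℕ) : ℝ := (ℓ.choose r : ℝ) / (ℓ:ℝ)^r

lemma LL_pos {ℓ r : ℕ} (hr : 2 ≤ r) (hℓ : r ≤ ℓ) : 0 < LL ℓ r := by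
  have h1 : 0 < ℓ.choose r := Nat.choose_pos hℓ
  have h2 : 0 < ℓ := by omega
  rw [LL]; positivity

lemma r_LL {ℓ r : ℕ} (hr : 2 ≤ r) (hℓ : r ≤ ℓ) : (r:ℝ) * LL ℓ r = DD ℓ r := by
  obtain ⟨r', rfl⟩ : ∃ r', r = r' + 1 := ⟨r-1, by omega⟩
  obtain ⟨l', rfl⟩ : ∃ l', ℓ = l' + 1 := ⟨ℓ-1, by omega⟩
  have h := Nat.add_one_mul_choose_eq l' r'
  have h' : ((l':ℝ)+1) * (l'.choose r' : ℝ) = ((l'+1).choose (r'+1) : ℝ) * ((r':ℝ)+1) := by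
    exact_mod_cast h
  rw [LL, DD]
  simp only [Nat.add_sub_cancel]
  have : (0:ℝ) < ((l'+1:ℕ):ℝ) := by positivity
  rw [pow_succ]
  field_simp
  push_cast at *
  linarith

lemma one_sub_pow_le (y : ℝ) (h0 : 0 ≤ y) (h1 : y ≤ 1) (r : ℕ) :
    (1-y)^r ≤ 1 - r*y + (r:ℝ)^2*y^2 := by
  induction r with
  | zero => simp
  | succ r ih =>
    rw [pow_succ]
    have h2 : (1-y)^r * (1-y) ≤ (1 - r*y + (r:ℝ)^2*y^2) * (1-y) := by
      apply mul_le_mul_of_nonneg_right ih; linarith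
    push_cast
    have h3 : 0 ≤ (r:ℝ)^2*y^3 := by positivity
    have h4 : 0 ≤ (r:ℝ)*y^2 := by positivity
    have h5 : 0 ≤ y^2 := by positivity
    nlinarith

lemma density_real {ℓ : ℕ} (hr : 2 ≤ r) (hℓ : r ≤ ℓ) (H : HGraph r)
    (hF : ¬ (expF ℓ r).IsCopyIn H) :
    (H.edges.card : ℝ) ≤ LL ℓ r * (H.verts.card:ℝ)^r + KK ℓ r * (H.verts.card:ℝ)^(r-1) := by
  have h := density hr hℓ H hF
  have h' : (H.edges.card : ℝ) * (ℓ:ℝ)^r ≤ ℓ.choose r * (H.verts.card:ℝ)^r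
    + KK ℓ r * (H.verts.card:ℝ)^(r-1) * (ℓ:ℝ)^r := by exact_mod_cast h
  have hl : (0:ℝ) < (ℓ:ℝ)^r := by
    have : 0 < ℓ := by omega
    positivity
  rw [← mul_le_mul_iff_left₀ hl]
  refine h'.trans (le_of_eq ?_)
  rw [LL]; field_simp

lemma deletion {ℓ : ℕ} (hr : 2 ≤ r) (hℓ : r ≤ ℓ) (θ : ℝ) (hθ : 0 < θ) (hθD : θ ≤ DD ℓ r)
    (η0 : ℝ) (hη0 : 0 < η0) :
    ∃ δ : ℝ, 0 < δ ∧ ∃ N : ℕ, ∀ H : HGraph r, ¬ (expF ℓ r).IsCopyIn H → N ≤ H.verts.card →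
      (LL ℓ r - δ) * (H.verts.card:ℝ)^r ≤ H.edges.card →
      ∃ Z ⊆ H.verts, (Z.card:ℝ) ≤ η0 * H.verts.card ∧
        (H.edges.card : ℝ) ≤ (dl H Z).edges.card + Z.card * ((DD ℓ r - θ) * (H.verts.card:ℝ)^(r-1)) ∧
        ∀ v ∈ H.verts \ Z, (DD ℓ r - θ) * (H.verts.card:ℝ)^(r-1) ≤ (dl H Z).deg v := by
  have hL := LL_pos hr hℓ
  have hrL := r_LL hr hℓ
  generalize hD0 : DD ℓ r = D at *
  generalize hLd0 : LL ℓ r = L at *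
  have hLd := hLd0.symm
  have hr0 : (0:ℝ) < r := by exact_mod_cast (by omega : 0 < r)
  obtain ⟨η, hη, hη1, hη2, hη3⟩ : ∃ η : ℝ, 0 < η ∧ η ≤ η0 ∧ η ≤ 1 ∧ L * (r:ℝ)^2 * η ≤ θ/4 := by
    refine ⟨min η0 (min 1 (θ/4/(L*(r:ℝ)^2))), ?_, min_le_left _ _,
      (min_le_right _ _).trans (min_le_left _ _), ?_⟩
    · positivity
    · have : min η0 (min 1 (θ/4/(L*(r:ℝ)^2))) ≤ θ/4/(L*(r:ℝ)^2) :=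
        (min_le_right _ _).trans (min_le_right _ _)
      rw [le_div_iff₀ (by positivity)] at this
      linarith
  refine ⟨η*θ/8, by positivity, ⌈2/η⌉₊ + ⌈KK ℓ r / (η*θ/8)⌉₊ + 1, ?_⟩
  intro H hF hN he
  generalize hn0 : H.verts.card = n at *
  have hn := hn0.symm
  clear hn0
  have hn0 : (0:ℝ) < n := by exact_mod_cast (by omega : 0 < n)
  have hn1 : 2 ≤ η * n := by
    have : (2/η:ℝ) ≤ n := (Nat.le_ceil _).trans (by exact_mod_cast (by omega : ⌈2/η⌉₊ ≤ n))
    rw [div_le_iff₀ hη] at this; linarith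
  have hn2 : (KK ℓ r:ℝ) ≤ η*θ/8 * n := by
    have : (KK ℓ r / (η*θ/8):ℝ) ≤ n :=
      (Nat.le_ceil _).trans (by exact_mod_cast (by omega : ⌈KK ℓ r / (η*θ/8)⌉₊ ≤ n))
    rw [div_le_iff₀ (by positivity)] at this; linarith
  obtain ⟨k, hk⟩ : ∃ k, k = ⌊η*n⌋₊ := ⟨_, rfl⟩
  have hk1 : (k:ℝ) ≤ η*n := by rw [hk]; exact Nat.floor_le (by positivity)
  have hk2 : η*n/2 ≤ k := by
    have := Nat.sub_one_lt_floor (η*n)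
    rw [← hk] at this
    linarith
  have hkn : k ≤ n := by
    have : (k:ℝ) ≤ n := by nlinarith
    exact_mod_cast this
  obtain ⟨Z, hZ, hZk, hZe, hZd⟩ := seq_delete H ((D - θ) * (n:ℝ)^(r-1)) k (hn ▸ hkn)
  refine ⟨Z, hZ, ?_, hZe, ?_⟩
  · have : (Z.card:ℝ) ≤ k := by exact_mod_cast hZk
    nlinarith
  rcases hZd with hZd | hZd
  swap
  · exact hZd
  exfalso
  have h1 := density_real hr hℓ (dl H Z) (not_copy_dl Z hF)
  rw [dl_verts, Finset.card_sdiff_of_subset hZ, hZd, ← hn, ← hLd, Nat.cast_sub hkn] at h1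
  obtain ⟨y, hy⟩ : ∃ y : ℝ, y = k / n := ⟨_, rfl⟩
  have hky : (k:ℝ) = y * n := by rw [hy]; field_simp
  have hy1 : y ≤ η := by
    rw [hky] at hk1; exact le_of_mul_le_mul_right hk1 hn0
  have hy2 : η/2 ≤ y := by
    rw [hky] at hk2; refine le_of_mul_le_mul_right ?_ hn0; linarith
  have hy0 : 0 < y := by linarith
  have hpw : ((n:ℝ) - k)^r ≤ (1 - r*y + (r:ℝ)^2*y^2) * (n:ℝ)^r := by
    have : (n:ℝ) - k = (1-y)*n := by rw [hky]; ring
    rw [this, mul_pow]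
    apply mul_le_mul_of_nonneg_right (one_sub_pow_le y hy0.le (by linarith) r) (by positivity)
  have hpw2 : ((n:ℝ) - k)^(r-1) ≤ (n:ℝ)^(r-1) := by
    apply pow_le_pow_left₀
    · have : (k:ℝ) ≤ n := by exact_mod_cast hkn
      linarith
    · have : (0:ℝ) ≤ k := by positivity
      linarith
  obtain ⟨P, hP⟩ : ∃ P : ℝ, P = (n:ℝ)^(r-1) := ⟨_, rfl⟩
  have hPr : (n:ℝ)^r = P * n := by rw [hP, ← pow_succ]; congr 1; omega
  have hP0 : 0 < P := by rw [hP]; positivity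
  rw [hPr] at he hpw
  rw [← hP] at hpw2
  rw [← hP, hZd, hky] at hZe
  have h2 : L * ((n:ℝ) - k)^r ≤ L * ((1 - r*y + (r:ℝ)^2*y^2) * (P*n)) :=
    mul_le_mul_of_nonneg_left hpw hL.le
  have h3 : (KK ℓ r:ℝ) * ((n:ℝ) - k)^(r-1) ≤ (η*θ/8*n) * P := by
    refine (mul_le_mul_of_nonneg_left hpw2 (by positivity)).trans ?_
    exact mul_le_mul_of_nonneg_right hn2 hP0.le
  have h4 : (L - η*θ/8) * (P*n) ≤ (L * (1 - r*y + (r:ℝ)^2*y^2) + η*θ/8 + y*(D-θ)) * (P*n) := by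
    linarith
  have h5 := le_of_mul_le_mul_right h4 (by positivity)
  have h6 : L * r^2 * y * y ≤ θ/4*y := by
    apply mul_le_mul_of_nonneg_right _ hy0.le
    refine le_trans ?_ hη3
    apply mul_le_mul_of_nonneg_left hy1; positivity
  have h7 : L * (1 - r*y + (r:ℝ)^2*y^2) = L - D*y + L*r^2*y*y := by rw [← hrL]; ring
  have h8 : η/2*θ ≤ y*θ := mul_le_mul_of_nonneg_right hy2 hθ.le
  have h9 : 0 < η*θ := by positivity
  nlinarith

lemma dl_edges_sub' (H : HGraph r) (Z : Finset ℕ) : (dl H Z).edges ⊆ H.edges := by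
  intro e he
  exact ((mem_dl_edges ..).1 he).1

set_option maxHeartbeats 1000000 in
lemma bounded {ℓ : ℕ} (hr : 2 ≤ r) (hℓ : r ≤ ℓ) (γ : ℝ) (hγ : 0 < γ) :
    ∃ δ : ℝ, 0 < δ ∧ ∃ N : ℕ, ∀ H : HGraph r, ¬ (expF ℓ r).IsCopyIn H → N ≤ H.verts.card →
      (LL ℓ r - δ) * (H.verts.card:ℝ)^r ≤ H.edges.card →
      ∀ v ∈ H.verts, (H.deg v : ℝ) ≤ (DD ℓ r + γ) * (H.verts.card:ℝ)^(r-1) := by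
  have hD := DD_pos hr hℓ
  have hℓ2 : (2:ℝ) ≤ ℓ := by exact_mod_cast (by omega : 2 ≤ ℓ)
  obtain ⟨κ, hκ, hκ1, hκ2⟩ : ∃ κ : ℝ, 0 < κ ∧ κ*(4*(ℓ+1)*ℓ) ≤ 1 ∧
      (ℓ+2)*κ + DD ℓ r * (1+4*κ)^(r-1) ≤ DD ℓ r + γ := by
    have h1 : Filter.Tendsto (fun κ : ℝ => κ*(4*(ℓ+1)*ℓ)) (nhdsWithin 0 (Set.Ioi 0)) (nhds 0) := by
      have : Continuous (fun κ : ℝ => κ*(4*((ℓ:ℝ)+1)*ℓ)) := by fun_prop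
      have := (this.tendsto 0).mono_left (nhdsWithin_le_nhds (s := Set.Ioi 0))
      simpa using this
    have h2 : Filter.Tendsto (fun κ : ℝ => (ℓ+2)*κ + DD ℓ r * (1+4*κ)^(r-1))
        (nhdsWithin 0 (Set.Ioi 0)) (nhds (DD ℓ r)) := by
      have : Continuous (fun κ : ℝ => ((ℓ:ℝ)+2)*κ + DD ℓ r * (1+4*κ)^(r-1)) := by fun_prop
      have := (this.tendsto 0).mono_left (nhdsWithin_le_nhds (s := Set.Ioi 0))
      simpa using this
    have h3 := h1.eventually (gt_mem_nhds (show (0:ℝ) < 1 by norm_num))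
    have h4 := h2.eventually (gt_mem_nhds (show DD ℓ r < DD ℓ r + γ by linarith))
    obtain ⟨κ, ⟨a, b⟩, c⟩ := ((h3.and h4).and self_mem_nhdsWithin).exists
    exact ⟨κ, c, a.le, b.le⟩
  obtain ⟨θ0, hθ0, N1, hmin⟩ := min_deg hr hℓ κ hκ hκ1
  obtain ⟨θ, hθ, hθ1, hθD⟩ : ∃ θ : ℝ, 0 < θ ∧ θ ≤ θ0 ∧ θ ≤ DD ℓ r :=
    ⟨min θ0 (DD ℓ r), lt_min hθ0 hD, min_le_left _ _, min_le_right _ _⟩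
  obtain ⟨δ, hδ, N2, hdel⟩ := deletion hr hℓ θ hθ hθD κ hκ
  refine ⟨δ, hδ, 2*N1 + N2 + ⌈KK ℓ r / κ⌉₊ + 1, ?_⟩
  intro H hF hN he v hv
  obtain ⟨Z, hZ, hZc, _, hZd⟩ := hdel H hF (by omega) he
  generalize hn0 : H.verts.card = n at *
  have hn := hn0.symm
  clear hn0
  have hn0 : (0:ℝ) < n := by exact_mod_cast (by omega : 0 < n)
  have hKn : (KK ℓ r:ℝ) ≤ κ * n := by
    have : (KK ℓ r / κ:ℝ) ≤ n :=
      (Nat.le_ceil _).trans (by exact_mod_cast (by omega : ⌈KK ℓ r / κ⌉₊ ≤ n))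
    rw [div_le_iff₀ (by positivity)] at this; linarith
  have hk7 : κ ≤ 1/24 := by
    have h24 : (24:ℝ) ≤ 4*(ℓ+1)*ℓ := by nlinarith
    have := mul_le_mul_of_nonneg_left h24 hκ.le
    linarith
  have hcard : (dl H Z).verts.card = n - Z.card := by
    rw [dl_verts, Finset.card_sdiff_of_subset hZ, ← hn]
  have hZn : Z.card ≤ n := by rw [hn]; exact Finset.card_le_card hZ
  have hcardR : ((dl H Z).verts.card : ℝ) = n - Z.card := by
    rw [hcard, Nat.cast_sub hZn]
  have hW1 : (1-κ)*n ≤ ((dl H Z).verts.card : ℝ) := by rw [hcardR]; linarith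
  have hW2 : ((dl H Z).verts.card : ℝ) ≤ n := by
    rw [hcardR]; linarith [(Nat.cast_nonneg Z.card : (0:ℝ) ≤ Z.card)]
  have hWN : N1 ≤ (dl H Z).verts.card := by
    have : (N1:ℝ) ≤ (dl H Z).verts.card := by
      refine le_trans ?_ hW1
      have : (2*N1:ℝ) ≤ n := by exact_mod_cast (by omega : 2*N1 ≤ n)
      nlinarith
    exact_mod_cast this
  obtain ⟨p, d, hS, hd, hbig⟩ := hmin (dl H Z) (not_copy_dl Z hF) hWN (by
    intro w hw
    have hw' : w ∈ H.verts \ Z := by rwa [dl_verts] at hw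
    refine le_trans ?_ (hZd w hw')
    refine mul_le_mul (by linarith) (pow_le_pow_left₀ (by positivity) hW2 _) (by positivity)
      (by linarith))
  generalize hW0 : (dl H Z).verts = W at *
  have hW := hW0.symm
  have hWs : W ⊆ H.verts := by rw [hW, dl_verts]; exact Finset.sdiff_subset
  have hS' : St ℓ H W p d := by
    refine ⟨hWs, hS.col, ?_, hS.big⟩
    intro x hx
    refine (Finset.card_le_card ?_).trans (hS.non x hx)
    intro y hy
    rw [Finset.mem_filter] at hy ⊢
    exact ⟨hy.1, hy.2.1, fun h => hy.2.2 (h.mono (dl_edges_sub' H Z))⟩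
  obtain ⟨i, hi, _, hdeg⟩ := hS'.v2 hr hℓ H W p d hF v hv
  have hVW : (H.verts \ W).card = Z.card := by
    rw [hW, dl_verts, Finset.sdiff_sdiff_eq_self hZ]
  rw [hVW, ← hn] at hdeg
  obtain ⟨X, hX⟩ : ∃ X, X = (W.filter fun w => p w ≠ i ∧ w ≠ v ∧ Ext H (KK ℓ r) v w).card :=
    ⟨_, rfl⟩
  rw [← hX] at hdeg
  have hXW : (X:ℝ) + (W.filter fun y => p y = i).card ≤ W.card := by
    have : X + (W.filter fun y => p y = i).card ≤ W.card := by
      rw [hX, ← Finset.card_union_of_disjoint]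
      · apply Finset.card_le_card
        intro y hy
        simp only [Finset.mem_union, Finset.mem_filter] at hy
        tauto
      · rw [Finset.disjoint_left]
        intro w hw1 hw2
        simp only [Finset.mem_filter] at hw1 hw2
        exact hw1.2.1 hw2.2
    exact_mod_cast this
  have hX1 : (X:ℝ) ≤ (1-1/ℓ+2*κ)*n := by
    have h1 := hbig i hi
    have h2 : (1/ℓ - κ) * ((1-κ)*n) ≤ (1/ℓ - κ) * (W.card:ℝ) := by
      apply mul_le_mul_of_nonneg_left hW1
      rw [sub_nonneg, le_div_iff₀ (by positivity)]
      have h1' : 1 ≤ 4*((ℓ:ℝ)+1) := by linarith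
      have h2' : (κ*ℓ)*1 ≤ (κ*ℓ)*(4*((ℓ:ℝ)+1)) := by gcongr
      linarith
    have h3 : (1/ℓ:ℝ) ≤ 1 := by rw [div_le_one (by positivity)]; linarith
    have h4 : (1/ℓ:ℝ) * κ * n ≤ 1 * κ * n := by gcongr
    have h5 : 0 ≤ κ*κ*n := by positivity
    linarith
  have hℓ1 : ((ℓ-1:ℕ):ℝ) = ℓ - 1 := by rw [Nat.cast_sub (by omega)]; simp
  have hdeg' : (H.deg v : ℝ) * ((ℓ:ℝ)-1)^(r-1) ≤
      ((Z.card + ℓ*d + KK ℓ r : ℝ) * (n:ℝ)^(r-2)) * ((ℓ:ℝ)-1)^(r-1) +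
      (ℓ-1).choose (r-1) * (X:ℝ)^(r-1) := by
    rw [← hℓ1]; exact_mod_cast hdeg
  have hC : ((ℓ-1).choose (r-1) : ℝ) = DD ℓ r * (ℓ:ℝ)^(r-1) := by rw [DD]; field_simp
  have hq : (0:ℝ) < ((ℓ:ℝ)-1)^(r-1) := by apply pow_pos; linarith
  have hXp : (ℓ:ℝ)^(r-1) * (X:ℝ)^(r-1) ≤ (1+4*κ)^(r-1) * (n:ℝ)^(r-1) * ((ℓ:ℝ)-1)^(r-1) := by
    rw [← mul_pow, ← mul_pow, ← mul_pow]
    apply pow_le_pow_left₀ (by positivity)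
    calc (ℓ:ℝ) * X ≤ ℓ * ((1-1/ℓ+2*κ)*n) := by gcongr
      _ = (ℓ - 1 + 2*κ*ℓ)*n := by field_simp
      _ ≤ ((1+4*κ)*(ℓ-1)) * n := by
        apply mul_le_mul_of_nonneg_right _ hn0.le
        have := mul_nonneg hκ.le (sub_nonneg.2 hℓ2)
        linarith
      _ = _ := by ring
  have hZp : (Z.card + ℓ*d + KK ℓ r : ℝ) * (n:ℝ)^(r-2) ≤ ((ℓ+2)*κ) * (n:ℝ)^(r-1) := by
    have h1 : (d:ℝ) ≤ κ*n := hd.trans (mul_le_mul_of_nonneg_left hW2 hκ.le)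
    have h2 : (ℓ:ℝ)*d ≤ ℓ*(κ*n) := by gcongr
    calc _ ≤ ((ℓ+2)*κ*n) * (n:ℝ)^(r-2) := by
          apply mul_le_mul_of_nonneg_right _ (by positivity); linarith
      _ = ((ℓ+2)*κ) * (n:ℝ)^(r-2+1) := by ring
      _ = _ := by congr 2; omega
  have h1 := mul_le_mul_of_nonneg_right hZp hq.le
  have h2 := mul_le_mul_of_nonneg_left hXp hD.le
  have h3 : (H.deg v : ℝ) * ((ℓ:ℝ)-1)^(r-1) ≤
      (((ℓ+2)*κ + DD ℓ r * (1+4*κ)^(r-1)) * (n:ℝ)^(r-1)) * ((ℓ:ℝ)-1)^(r-1) := by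
    rw [hC] at hdeg'; linarith
  have h4 := le_of_mul_le_mul_right h3 hq
  exact h4.trans (mul_le_mul_of_nonneg_right hκ2 (by positivity))

end P7

section P8
open scoped Classical

/-- `s`-subsets of `V` on which `p` is injective -/
noncomputable def ks (p : ℕ → ℕ) (V : Finset ℕ) (s : ℕ) : Finset (Finset ℕ) :=
  kset (fun x y => p x ≠ p y) V s

lemma mem_ks {p : ℕ → ℕ} {V : Finset ℕ} {s : ℕ} {Q : Finset ℕ} :
    Q ∈ ks p V s ↔ Q ⊆ V ∧ Q.card = s ∧ ∀ x ∈ Q, ∀ y ∈ Q, x ≠ y → p x ≠ p y := mem_kset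

lemma ks_congr {p p' : ℕ → ℕ} {V : Finset ℕ} (h : ∀ x ∈ V, p x = p' x) (s : ℕ) :
    ks p V s = ks p' V s := by
  ext Q
  rw [mem_ks, mem_ks]
  constructor
  · rintro ⟨h1, h2, h3⟩
    refine ⟨h1, h2, fun x hx y hy hxy => ?_⟩
    rw [← h x (h1 hx), ← h y (h1 hy)]; exact h3 x hx y hy hxy
  · rintro ⟨h1, h2, h3⟩
    refine ⟨h1, h2, fun x hx y hy hxy => ?_⟩
    rw [h x (h1 hx), h y (h1 hy)]; exact h3 x hx y hy hxy

lemma ks_add_class (p : ℕ → ℕ) (V C : Finset ℕ) (c : ℕ) (hC : ∀ x ∈ C, p x = c)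
    (hV : ∀ x ∈ V, p x ≠ c) (s : ℕ) :
    (ks p (V ∪ C) (s+1)).card = (ks p V (s+1)).card + C.card * (ks p V s).card := by
  have hdis : ∀ x ∈ C, x ∉ V := fun x hx h => hV x h (hC x hx)
  have heq : ks p (V ∪ C) (s+1) = ks p V (s+1) ∪
      (C ×ˢ ks p V s).image (fun z => insert z.1 z.2) := by
    ext Q
    rw [Finset.mem_union, Finset.mem_image]
    constructor
    · intro hQ
      obtain ⟨h1, h2, h3⟩ := mem_ks.1 hQ
      by_cases hx : ∃ x ∈ Q, x ∈ C
      · right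
        obtain ⟨x, hxQ, hxC⟩ := hx
        refine ⟨(x, Q.erase x), ?_, by simp [Finset.insert_erase hxQ]⟩
        rw [Finset.mem_product]
        refine ⟨hxC, mem_ks.2 ⟨?_, ?_, ?_⟩⟩
        · intro y hy
          have hy' := Finset.mem_erase.1 hy
          rcases Finset.mem_union.1 (h1 hy'.2) with h | h
          · exact h
          · exact absurd ((hC y h).trans (hC x hxC).symm) (h3 y hy'.2 x hxQ hy'.1)
        · rw [Finset.card_erase_of_mem hxQ, h2]; rfl
        · intro y hy z hz
          exact h3 y (Finset.mem_of_mem_erase hy) z (Finset.mem_of_mem_erase hz)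
      · left
        push Not at hx
        refine mem_ks.2 ⟨?_, h2, h3⟩
        intro y hy
        rcases Finset.mem_union.1 (h1 hy) with h | h
        · exact h
        · exact absurd h (hx y hy)
    · rintro (hQ | ⟨⟨x, R⟩, hxR, rfl⟩)
      · obtain ⟨h1, h2, h3⟩ := mem_ks.1 hQ
        exact mem_ks.2 ⟨h1.trans Finset.subset_union_left, h2, h3⟩
      · rw [Finset.mem_product] at hxR
        obtain ⟨hx, hR⟩ := hxR
        obtain ⟨h1, h2, h3⟩ := mem_ks.1 hR
        simp only at *
        refine mem_ks.2 ⟨?_, ?_, ?_⟩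
        · intro y hy
          rcases Finset.mem_insert.1 hy with rfl | hy
          · exact Finset.mem_union_right _ hx
          · exact Finset.mem_union_left _ (h1 hy)
        · rw [Finset.card_insert_of_notMem (fun h => hdis x hx (h1 h)), h2]
        · intro y hy z hz hyz
          rcases Finset.mem_insert.1 hy with h5 | h5 <;> rcases Finset.mem_insert.1 hz with h6 | h6
          · exact absurd (h5.trans h6.symm) hyz
          · rw [h5, hC _ hx]; exact (hV z (h1 h6)).symm
          · rw [h6, hC _ hx]; exact hV y (h1 h5)
          · exact h3 y h5 z h6 hyz
  rw [heq, Finset.card_union_of_disjoint, Finset.card_image_of_injOn, Finset.card_product]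
  · rintro ⟨x, R⟩ h ⟨y, S⟩ h' hxy
    simp only [Finset.coe_product, Set.mem_prod, Finset.mem_coe] at h h' hxy
    have hR := (mem_ks.1 h.2).1
    have hS := (mem_ks.1 h'.2).1
    have hxR : x ∉ R := fun hh => hdis x h.1 (hR hh)
    have hxS : x ∉ S := fun hh => hdis x h.1 (hS hh)
    have hx : x ∈ insert y S := by rw [← hxy]; exact Finset.mem_insert_self _ _
    have hxy' : x = y := by
      rcases Finset.mem_insert.1 hx with h | h
      · exact h
      · exact absurd h hxS
    subst hxy'
    have : R = S := by rw [← Finset.erase_insert hxR, hxy, Finset.erase_insert hxS]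
    rw [this]
  · rw [Finset.disjoint_left]
    intro Q hQ hQ'
    obtain ⟨⟨x, R⟩, hxR, rfl⟩ := Finset.mem_image.1 hQ'
    rw [Finset.mem_product] at hxR
    exact hdis x hxR.1 ((mem_ks.1 hQ).1 (Finset.mem_insert_self _ _))

lemma ks_two (p : ℕ → ℕ) (V A B : Finset ℕ) (a b : ℕ) (hab : a ≠ b) (hA : ∀ x ∈ A, p x = a)
    (hB : ∀ x ∈ B, p x = b) (hV : ∀ x ∈ V, p x ≠ a ∧ p x ≠ b) (s : ℕ) :
    (ks p (V ∪ A ∪ B) (s+2)).card = (ks p V (s+2)).card + (A.card + B.card) * (ks p V (s+1)).card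
      + A.card * B.card * (ks p V s).card := by
  rw [ks_add_class p (V ∪ A) B b hB ?_ (s+1), ks_add_class p V A a hA (fun x hx => (hV x hx).1),
    ks_add_class p V A a hA (fun x hx => (hV x hx).1)]
  · ring
  · intro x hx
    rcases Finset.mem_union.1 hx with h | h
    · exact (hV x h).2
    · rw [hA x h]; exact hab

/-- moving a vertex from a large to a small class increases the count -/
lemma ks_move {r : ℕ} (hr : 2 ≤ r) (ℓ : ℕ) (p : ℕ → ℕ) (V : Finset ℕ) (hp : ∀ v ∈ V, p v < ℓ)
    (hpos : 0 < (ks p V r).card) (i j : ℕ) (hj : j < ℓ)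
    (hij : (V.filter fun y => p y = j).card + 2 ≤ (V.filter fun y => p y = i).card) :
    ∃ p' : ℕ → ℕ, (∀ v ∈ V, p' v < ℓ) ∧ (ks p V r).card < (ks p' V r).card := by
  obtain ⟨s, rfl⟩ : ∃ s, r = s + 2 := ⟨r-2, by omega⟩
  have hne : i ≠ j := by rintro rfl; omega
  obtain ⟨x, hx⟩ : (V.filter fun y => p y = i).Nonempty := by
    rw [← Finset.card_pos]; omega
  obtain ⟨hxV, hxi⟩ := Finset.mem_filter.1 hx
  obtain ⟨A, hA⟩ : ∃ A, A = V.filter fun y => p y = i := ⟨_, rfl⟩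
  obtain ⟨B, hB⟩ : ∃ B, B = V.filter fun y => p y = j := ⟨_, rfl⟩
  obtain ⟨U, hU⟩ : ∃ U, U = V.filter fun y => p y ≠ i ∧ p y ≠ j := ⟨_, rfl⟩
  rw [← hA, ← hB] at hij
  rw [← hA] at hx
  have hxB : x ∉ B := by
    rw [hB, Finset.mem_filter]; rintro ⟨_, h⟩; exact hne (hxi.symm.trans h)
  have hVeq : V = U ∪ A ∪ B := by
    ext y
    simp only [hU, hA, hB, Finset.mem_union, Finset.mem_filter]
    tauto
  have hVeq' : V = U ∪ A.erase x ∪ insert x B := by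
    rw [hVeq]
    ext y
    simp only [Finset.mem_union, Finset.mem_erase, Finset.mem_insert]
    by_cases hyx : y = x
    · subst hyx; simp [hx]
    · simp [hyx]
  have hUx : x ∉ U := by
    rw [hU, Finset.mem_filter]; rintro ⟨_, h, _⟩; exact h hxi
  have hup : ∀ y, y ≠ x → Function.update p x j y = p y := fun y hy => Function.update_of_ne hy _ _
  have hux : Function.update p x j x = j := Function.update_self _ _ _
  refine ⟨Function.update p x j, ?_, ?_⟩
  · intro v hv
    by_cases hvx : v = x
    · subst hvx; rw [hux]; exact hj
    · rw [hup v hvx]; exact hp v hv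
  have h1 := ks_two p U A B i j hne (by rw [hA]; intro y hy; exact (Finset.mem_filter.1 hy).2)
    (by rw [hB]; intro y hy; exact (Finset.mem_filter.1 hy).2)
    (by rw [hU]; intro y hy; exact (Finset.mem_filter.1 hy).2) s
  have h2 := ks_two (Function.update p x j) U (A.erase x) (insert x B) i j hne
    (by
      intro y hy
      obtain ⟨h1, h2⟩ := Finset.mem_erase.1 hy
      rw [hup y h1]; rw [hA] at h2; exact (Finset.mem_filter.1 h2).2)
    (by
      intro y hy
      by_cases hyx : y = x
      · rw [hyx]; exact hux
      · have h2 := (Finset.mem_insert.1 hy).resolve_left hyx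
        rw [hup y hyx]; rw [hB] at h2; exact (Finset.mem_filter.1 h2).2)
    (by
      intro y hy
      rw [hup y (by rintro rfl; exact hUx hy)]
      rw [hU] at hy; exact (Finset.mem_filter.1 hy).2) s
  rw [← hVeq] at h1
  rw [← hVeq'] at h2
  have hcg : ∀ s', ks (Function.update p x j) U s' = ks p U s' := fun s' =>
    ks_congr (fun y hy => hup y (by rintro rfl; exact hUx hy)) s'
  rw [hcg, hcg, hcg, Finset.card_erase_of_mem hx, Finset.card_insert_of_notMem hxB] at h2
  have hk0 : 0 < (ks p U s).card := by
    rw [Finset.card_pos]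
    obtain ⟨Q, hQ⟩ := Finset.card_pos.1 hpos
    obtain ⟨q1, q2, q3⟩ := mem_ks.1 hQ
    have hc : s ≤ (Q ∩ U).card := by
      have hA1 : (Q ∩ A).card ≤ 1 := by
        rw [Finset.card_le_one]
        intro y hy z hz
        by_contra hyz
        rw [Finset.mem_inter, hA, Finset.mem_filter] at hy hz
        exact q3 y hy.1 z hz.1 hyz (hy.2.2.trans hz.2.2.symm)
      have hB1 : (Q ∩ B).card ≤ 1 := by
        rw [Finset.card_le_one]
        intro y hy z hz
        by_contra hyz
        rw [Finset.mem_inter, hB, Finset.mem_filter] at hy hz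
        exact q3 y hy.1 z hz.1 hyz (hy.2.2.trans hz.2.2.symm)
      have : Q = Q ∩ U ∪ Q ∩ A ∪ Q ∩ B := by
        rw [← Finset.inter_union_distrib_left, ← Finset.inter_union_distrib_left, ← hVeq,
          Finset.inter_eq_left.2 q1]
      have h3 : Q.card ≤ (Q ∩ U).card + (Q ∩ A).card + (Q ∩ B).card := by
        conv_lhs => rw [this]
        exact (Finset.card_union_le _ _).trans (Nat.add_le_add_right (Finset.card_union_le _ _) _)
      omega
    obtain ⟨R, hR, hRc⟩ := Finset.exists_subset_card_eq hc
    refine ⟨R, mem_ks.2 ⟨hR.trans Finset.inter_subset_right, hRc, ?_⟩⟩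
    intro y hy z hz
    exact q3 y (Finset.inter_subset_left (hR hy)) z (Finset.inter_subset_left (hR hz))
  rw [h1, h2]
  obtain ⟨a, ha⟩ : ∃ a, A.card = B.card + 2 + a := ⟨A.card - (B.card+2), by omega⟩
  rw [ha]
  have e1 : B.card + 2 + a - 1 = B.card + 1 + a := by omega
  rw [e1]
  nlinarith

def Bal (ℓ : ℕ) (p : ℕ → ℕ) (V : Finset ℕ) : Prop :=
  (∀ v ∈ V, p v < ℓ) ∧ ∀ i < ℓ, ∀ j < ℓ,
    (V.filter fun y => p y = i).card ≤ (V.filter fun y => p y = j).card + 1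

noncomputable def tn (ℓ r n : ℕ) : ℕ := (ks (fun x => x % ℓ) (Finset.range n) r).card

lemma bal_enum {ℓ : ℕ} (hℓ : 0 < ℓ) (p : ℕ → ℕ) (V : Finset ℕ) (hV : ℓ ≤ V.card) (hB : Bal ℓ p V) :
    ∃ f : ℕ → ℕ, Set.BijOn f ↑V ↑(Finset.range V.card) ∧
      ∀ x ∈ V, ∀ y ∈ V, p x = p y ↔ f x % ℓ = f y % ℓ := by
  have hne : ∀ i < ℓ, (V.filter fun y => p y = i).Nonempty := by
    intro i hi
    rw [← Finset.card_pos]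
    by_contra h0
    have h0' : (V.filter fun y => p y = i).card = 0 := by omega
    have h1 := sum_classes V p ℓ hB.1
    have h2 : ∑ j ∈ Finset.range ℓ, (V.filter fun y => p y = j).card <
        ∑ j ∈ Finset.range ℓ, 1 := by
      apply Finset.sum_lt_sum
      · intro j hj
        have := hB.2 j (Finset.mem_range.1 hj) i hi
        omega
      · exact ⟨i, Finset.mem_range.2 hi, by omega⟩
    simp only [Finset.sum_const, Finset.card_range, smul_eq_mul, mul_one] at h2
    omega
  let P : Finpartition V := Finpartition.ofExistsUnique
    ((Finset.range ℓ).image fun i => V.filter fun y => p y = i)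
    (by
      intro q hq
      obtain ⟨i, _, rfl⟩ := Finset.mem_image.1 hq
      exact Finset.filter_subset _ _)
    (by
      intro a ha
      refine ⟨V.filter fun y => p y = p a, ⟨Finset.mem_image.2 ⟨p a, Finset.mem_range.2 (hB.1 a ha), rfl⟩,
        Finset.mem_filter.2 ⟨ha, rfl⟩⟩, ?_⟩
      rintro q ⟨hq, haq⟩
      obtain ⟨i, _, rfl⟩ := Finset.mem_image.1 hq
      rw [(Finset.mem_filter.1 haq).2])
    (by
      intro h
      obtain ⟨i, hi, h⟩ := Finset.mem_image.1 h
      obtain ⟨x, hx⟩ := hne i (Finset.mem_range.1 hi)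
      rw [h] at hx
      simp at hx)
  have hPp : P.parts = ((Finset.range ℓ).image fun i => V.filter fun y => p y = i) := rfl
  have hPc : P.parts.card = ℓ := by
    rw [hPp, Finset.card_image_of_injOn, Finset.card_range]
    intro i hi j hj hij
    obtain ⟨x, hx⟩ := hne i (Finset.mem_range.1 hi)
    have hx' := hx
    simp only at hij
    rw [hij] at hx'
    exact (Finset.mem_filter.1 hx).2.symm.trans (Finset.mem_filter.1 hx').2
  have hE : P.IsEquipartition := by
    intro A B hA hB'
    rw [Finset.mem_coe, hPp] at hA hB'
    obtain ⟨i, hi, rfl⟩ := Finset.mem_image.1 hA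
    obtain ⟨j, hj, rfl⟩ := Finset.mem_image.1 hB'
    exact hB.2 i (Finset.mem_range.1 hi) j (Finset.mem_range.1 hj)
  have hpart : ∀ x ∈ V, P.part x = V.filter fun y => p y = p x := by
    intro x hx
    apply P.part_eq_of_mem
    · rw [hPp]; exact Finset.mem_image.2 ⟨p x, Finset.mem_range.2 (hB.1 x hx), rfl⟩
    · exact Finset.mem_filter.2 ⟨hx, rfl⟩
  obtain ⟨f, hf⟩ := hE.exists_partPreservingEquiv
  rw [hPc] at hf
  refine ⟨fun x => if h : x ∈ V then f ⟨x, h⟩ else 0, ⟨?_, ?_, ?_⟩, ?_⟩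
  · intro x hx
    have hx' : x ∈ V := hx
    simp [hx']
  · intro x hx y hy hxy
    have hx' : x ∈ V := hx
    have hy' : y ∈ V := hy
    simp only [hx', hy', dite_true] at hxy
    have := f.injective (Fin.ext hxy)
    exact congrArg Subtype.val this
  · intro k hk
    have hk' : k < V.card := by simpa using hk
    refine ⟨f.symm ⟨k, hk'⟩, (f.symm ⟨k, hk'⟩).2, ?_⟩
    simp
  · intro x hx y hy
    simp only [hx, hy, dite_true]
    rw [← hf ⟨x, hx⟩ ⟨y, hy⟩, hpart x hx, hpart y hy]
    constructor
    · intro h; rw [h]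
    · intro h
      have : x ∈ V.filter fun z => p z = p x := Finset.mem_filter.2 ⟨hx, rfl⟩
      rw [h] at this
      exact (Finset.mem_filter.1 this).2

lemma ks_bij (p q : ℕ → ℕ) (V U : Finset ℕ) (f : ℕ → ℕ) (hf : Set.BijOn f ↑V ↑U)
    (h : ∀ x ∈ V, ∀ y ∈ V, p x = p y ↔ q (f x) = q (f y)) (s : ℕ) :
    (ks p V s).card = (ks q U s).card := by
  refine Finset.card_bij (fun Q _ => Q.image f) ?_ ?_ ?_
  · intro Q hQ
    obtain ⟨h1, h2, h3⟩ := mem_ks.1 hQ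
    refine mem_ks.2 ⟨?_, ?_, ?_⟩
    · intro y hy
      obtain ⟨x, hx, rfl⟩ := Finset.mem_image.1 hy
      exact hf.mapsTo (h1 hx)
    · rw [Finset.card_image_of_injOn (hf.injOn.mono (Finset.coe_subset.2 h1)), h2]
    · intro y hy z hz hyz
      obtain ⟨x, hx, rfl⟩ := Finset.mem_image.1 hy
      obtain ⟨w, hw, rfl⟩ := Finset.mem_image.1 hz
      intro hh
      exact h3 x hx w hw (by rintro rfl; exact hyz rfl) ((h x (h1 hx) w (h1 hw)).2 hh)
  · intro Q hQ R hR hQR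
    have h1 := (mem_ks.1 hQ).1
    have h2 := (mem_ks.1 hR).1
    have key : ∀ Q R : Finset ℕ, Q ⊆ V → R ⊆ V → Q.image f = R.image f → Q ⊆ R := by
      intro Q R h1 h2 hQR x hx
      have : f x ∈ R.image f := by rw [← hQR]; exact Finset.mem_image_of_mem f hx
      obtain ⟨y, hy, hyx⟩ := Finset.mem_image.1 this
      rw [← hf.injOn (h2 hy) (h1 hx) hyx]; exact hy
    exact Finset.Subset.antisymm (key Q R h1 h2 hQR) (key R Q h2 h1 hQR.symm)
  · intro Q hQ
    obtain ⟨h1, h2, h3⟩ := mem_ks.1 hQ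
    have himg : (V.filter fun x => f x ∈ Q).image f = Q := by
      ext y
      rw [Finset.mem_image]
      constructor
      · rintro ⟨x, hx, rfl⟩; exact (Finset.mem_filter.1 hx).2
      · intro hy
        obtain ⟨x, hx, rfl⟩ := hf.surjOn (h1 hy)
        exact ⟨x, Finset.mem_filter.2 ⟨hx, hy⟩, rfl⟩
    refine ⟨V.filter fun x => f x ∈ Q, mem_ks.2 ⟨Finset.filter_subset _ _, ?_, ?_⟩, himg⟩
    · rw [← h2]
      conv_rhs => rw [← himg]
      rw [Finset.card_image_of_injOn]
      exact hf.injOn.mono (Finset.coe_subset.2 (Finset.filter_subset _ _))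
    · intro x hx y hy hxy hh
      obtain ⟨hx1, hx2⟩ := Finset.mem_filter.1 hx
      obtain ⟨hy1, hy2⟩ := Finset.mem_filter.1 hy
      exact h3 _ hx2 _ hy2 (fun hff => hxy (hf.injOn hx1 hy1 hff)) ((h x hx1 y hy1).1 hh)

lemma ks_le (p : ℕ → ℕ) (V : Finset ℕ) (s : ℕ) : (ks p V s).card ≤ V.card.choose s := by
  rw [← Finset.card_powersetCard]
  apply Finset.card_le_card
  intro Q hQ
  obtain ⟨h1, h2, _⟩ := mem_ks.1 hQ
  exact Finset.mem_powersetCard.2 ⟨h1, h2⟩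

/-- enumeration of a finite set of naturals -/
lemma enum_exists (V : Finset ℕ) : ∃ f : ℕ → ℕ, Set.BijOn f ↑V ↑(Finset.range V.card) := by
  let e := V.equivFin
  refine ⟨fun x => if h : x ∈ V then e ⟨x, h⟩ else 0, ?_, ?_, ?_⟩
  · intro x hx
    have hx' : x ∈ V := hx
    simp [hx']
  · intro x hx y hy hxy
    have hx' : x ∈ V := hx
    have hy' : y ∈ V := hy
    simp only [hx', hy', dite_true] at hxy
    exact congrArg Subtype.val (e.injective (Fin.ext hxy))
  · intro k hk
    have hk' : k < V.card := by simpa using hk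
    refine ⟨e.symm ⟨k, hk'⟩, (e.symm ⟨k, hk'⟩).2, ?_⟩
    simp

lemma tn_pos {ℓ r n : ℕ} (hℓ : r ≤ ℓ) (hn : r ≤ n) : 0 < tn ℓ r n := by
  rw [tn, Finset.card_pos]
  refine ⟨Finset.range r, mem_ks.2 ⟨?_, Finset.card_range r, ?_⟩⟩
  · intro x hx; simp only [Finset.mem_range] at *; omega
  · intro x hx y hy hxy
    simp only [Finset.mem_range] at *
    rw [Nat.mod_eq_of_lt (by omega), Nat.mod_eq_of_lt (by omega)]
    exact hxy

/-- The Turán colouring is the best one. -/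
lemma turan_max {ℓ r : ℕ} (hr : 2 ≤ r) (hℓ : r ≤ ℓ) (V : Finset ℕ) (hV : ℓ ≤ V.card) :
    ∀ p : ℕ → ℕ, (∀ v ∈ V, p v < ℓ) →
      (ks p V r).card ≤ tn ℓ r V.card ∧ ((ks p V r).card = tn ℓ r V.card → Bal ℓ p V) := by
  obtain ⟨S, hS⟩ : ∃ S : Set ℕ, S = {m | ∃ p : ℕ → ℕ, (∀ v ∈ V, p v < ℓ) ∧ (ks p V r).card = m} :=
    ⟨_, rfl⟩
  have hSm : ∀ m, m ∈ S ↔ ∃ p : ℕ → ℕ, (∀ v ∈ V, p v < ℓ) ∧ (ks p V r).card = m := by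
    intro m; rw [hS]; rfl
  have hSb : BddAbove S := ⟨V.card.choose r, by
    intro m hm
    obtain ⟨p, _, rfl⟩ := (hSm m).1 hm
    exact ks_le _ _ _⟩
  obtain ⟨f, hf⟩ := enum_exists V
  have hT : tn ℓ r V.card ∈ S := by
    rw [hSm]
    refine ⟨fun x => f x % ℓ, fun v _ => Nat.mod_lt _ (by omega), ?_⟩
    exact ks_bij _ (fun x => x % ℓ) V _ f hf (fun x _ y _ => Iff.rfl) r
  have hbal : ∀ p : ℕ → ℕ, (∀ v ∈ V, p v < ℓ) → 0 < (ks p V r).card →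
      (∀ m ∈ S, m ≤ (ks p V r).card) → Bal ℓ p V := by
    intro p hp hpos hmax
    refine ⟨hp, ?_⟩
    intro i hi j hj
    by_contra hlt
    obtain ⟨p', hp', hlt'⟩ := ks_move hr ℓ p V hp hpos i j hj (by omega)
    have := hmax _ ((hSm _).2 ⟨p', hp', rfl⟩)
    omega
  have hM := Nat.sSup_mem ⟨_, hT⟩ hSb
  have hMle : ∀ m ∈ S, m ≤ sSup S := fun m hm => le_csSup hSb hm
  have hMeq : sSup S = tn ℓ r V.card := by
    obtain ⟨p, hp, hpM⟩ := (hSm _).1 hM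
    have hb := hbal p hp (by rw [hpM]; exact (tn_pos hℓ (by omega)).trans_le (hMle _ hT))
      (by rw [hpM]; exact hMle)
    obtain ⟨g, hg, hg2⟩ := bal_enum (by omega) p V hV hb
    rw [← hpM]
    exact ks_bij p (fun x => x % ℓ) V _ g hg hg2 r
  intro p hp
  have hle : (ks p V r).card ≤ tn ℓ r V.card := by
    rw [← hMeq]; exact hMle _ ((hSm _).2 ⟨p, hp, rfl⟩)
  refine ⟨hle, fun heq => hbal p hp ?_ ?_⟩
  · rw [heq]; exact tn_pos hℓ (by omega)
  · rw [heq, ← hMeq]; exact hMle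

end P8

section P9
open scoped Classical

lemma ks_classes (p : ℕ → ℕ) (V I : Finset ℕ) (q : ℕ)
    (h : ∀ i ∈ I, q ≤ (V.filter fun y => p y = i).card) (s : ℕ) (hs : s ≤ I.card) :
    I.card.choose s * q^s ≤ (ks p V s).card := by
  apply kset_lower (fun x y h => h.symm) V I.card q _ s hs
  intro s hs R hR
  obtain ⟨h1, h2, h3⟩ := mem_kset.1 hR
  have hsub : ((I \ R.image p).biUnion fun i => V.filter fun y => p y = i) ⊆
      nbs (fun x y => p x ≠ p y) V R := by
    intro y hy
    obtain ⟨i, hi, hy⟩ := Finset.mem_biUnion.1 hy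
    obtain ⟨hi1, hi2⟩ := Finset.mem_sdiff.1 hi
    obtain ⟨hy1, rfl⟩ := Finset.mem_filter.1 hy
    refine mem_nbs.2 ⟨hy1, fun hh => hi2 (Finset.mem_image_of_mem p hh), ?_⟩
    intro z hz hpz
    apply hi2
    rw [hpz]; exact Finset.mem_image_of_mem p hz
  refine le_trans ?_ (Finset.card_le_card hsub)
  rw [Finset.card_biUnion]
  · have hc : I.card - s ≤ (I \ R.image p).card := by
      have := Finset.le_card_sdiff (R.image p) I
      have h4 : (R.image p).card ≤ R.card := Finset.card_image_le
      omega
    calc (I.card - s) * q ≤ (I \ R.image p).card * q := Nat.mul_le_mul_right _ hc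
      _ = ∑ i ∈ I \ R.image p, q := by simp
      _ ≤ _ := Finset.sum_le_sum fun i hi => h i (Finset.mem_sdiff.1 hi).1
  · intro i _ j _ hij
    rw [Function.onFun, Finset.disjoint_left]
    intro y hy hy'
    exact hij ((Finset.mem_filter.1 hy).2.symm.trans (Finset.mem_filter.1 hy').2)

lemma mod_class {ℓ : ℕ} (n i : ℕ) (hi : i < ℓ) :
    n / ℓ ≤ ((Finset.range n).filter fun y => y % ℓ = i).card := by
  have hsub : (Finset.range (n/ℓ)).image (fun k => i + ℓ * k) ⊆
      (Finset.range n).filter fun y => y % ℓ = i := by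
    intro y hy
    obtain ⟨k, hk, rfl⟩ := Finset.mem_image.1 hy
    rw [Finset.mem_range] at hk
    rw [Finset.mem_filter, Finset.mem_range]
    refine ⟨?_, ?_⟩
    · have h1 : ℓ * (k+1) ≤ ℓ * (n/ℓ) := Nat.mul_le_mul_left _ hk
      have h2 := Nat.mul_div_le n ℓ
      rw [mul_add] at h1
      omega
    · rw [Nat.add_mul_mod_self_left, Nat.mod_eq_of_lt hi]
  refine le_trans ?_ (Finset.card_le_card hsub)
  rw [Finset.card_image_of_injective, Finset.card_range]
  intro a b hab
  have : ℓ * a = ℓ * b := by simpa using hab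
  exact Nat.eq_of_mul_eq_mul_left (by omega) this

lemma tn_lower {ℓ r : ℕ} (hℓ : r ≤ ℓ) (n : ℕ) : ℓ.choose r * (n/ℓ)^r ≤ tn ℓ r n := by
  have := ks_classes (fun x => x % ℓ) (Finset.range n) (Finset.range ℓ) (n/ℓ)
    (fun i hi => mod_class n i (Finset.mem_range.1 hi)) r (by simpa using hℓ)
  rwa [Finset.card_range] at this

lemma tn_succ {ℓ r : ℕ} (hr : 2 ≤ r) (hℓ : r ≤ ℓ) (n : ℕ) :
    tn ℓ r n + (ℓ-1).choose (r-1) * (n/ℓ)^(r-1) ≤ tn ℓ r (n+1) := by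
  obtain ⟨V, hV⟩ : ∃ V, V = (Finset.range n).filter fun x => x % ℓ ≠ n % ℓ := ⟨_, rfl⟩
  have hVn : n ∉ V := by rw [hV]; simp
  have h1 : (ℓ-1).choose (r-1) * (n/ℓ)^(r-1) ≤ (ks (fun x => x % ℓ) V (r-1)).card := by
    have hI : ((Finset.range ℓ).erase (n % ℓ)).card = ℓ - 1 := by
      rw [Finset.card_erase_of_mem, Finset.card_range]
      exact Finset.mem_range.2 (Nat.mod_lt _ (by omega))
    have := ks_classes (fun x => x % ℓ) V ((Finset.range ℓ).erase (n % ℓ)) (n/ℓ) (by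
      intro i hi
      obtain ⟨hi1, hi2⟩ := Finset.mem_erase.1 hi
      refine (mod_class n i (Finset.mem_range.1 hi2)).trans (Finset.card_le_card ?_)
      intro y hy
      obtain ⟨hy1, hy2⟩ := Finset.mem_filter.1 hy
      rw [Finset.mem_filter, hV, Finset.mem_filter]
      exact ⟨⟨hy1, by rw [hy2]; exact hi1⟩, hy2⟩) (r-1) (by omega)
    rwa [hI] at this
  refine (Nat.add_le_add_left h1 _).trans ?_
  have h2 : (ks (fun x => x % ℓ) V (r-1)).card =
      ((ks (fun x => x % ℓ) V (r-1)).image fun Q => insert n Q).card := by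
    rw [Finset.card_image_of_injOn]
    intro Q hQ R hR hQR
    have hQ' : n ∉ Q := fun h => hVn ((mem_ks.1 (Finset.mem_coe.1 hQ)).1 h)
    have hR' : n ∉ R := fun h => hVn ((mem_ks.1 (Finset.mem_coe.1 hR)).1 h)
    simp only at hQR
    rw [← Finset.erase_insert hQ', hQR, Finset.erase_insert hR']
  rw [h2, tn, ← Finset.card_union_of_disjoint]
  · apply Finset.card_le_card
    intro Q hQ
    rcases Finset.mem_union.1 hQ with hQ | hQ
    · obtain ⟨a, b, c⟩ := mem_ks.1 hQ
      exact mem_ks.2 ⟨a.trans (Finset.range_mono (by omega)), b, c⟩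
    · obtain ⟨R, hR, rfl⟩ := Finset.mem_image.1 hQ
      obtain ⟨a, b, c⟩ := mem_ks.1 hR
      refine mem_ks.2 ⟨?_, ?_, ?_⟩
      · intro y hy
        rcases Finset.mem_insert.1 hy with h | h
        · rw [h]; simp
        · have := a h
          rw [hV, Finset.mem_filter, Finset.mem_range] at this
          rw [Finset.mem_range]; omega
      · rw [Finset.card_insert_of_notMem (fun h => hVn (a h)), b]; omega
      · have hcol : ∀ y ∈ R, y % ℓ ≠ n % ℓ := by
          intro y hy
          have := a hy
          rw [hV, Finset.mem_filter] at this
          exact this.2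
        intro y hy z hz hyz
        rcases Finset.mem_insert.1 hy with h5 | h5 <;> rcases Finset.mem_insert.1 hz with h6 | h6
        · exact absurd (h5.trans h6.symm) hyz
        · rw [h5]; exact (hcol z h6).symm
        · rw [h6]; exact hcol y h5
        · exact c y h5 z h6 hyz
  · rw [Finset.disjoint_left]
    intro Q hQ hQ'
    obtain ⟨R, hR, rfl⟩ := Finset.mem_image.1 hQ'
    have := (mem_ks.1 hQ).1 (Finset.mem_insert_self n R)
    simp at this

lemma tn_incr {ℓ r : ℕ} (hr : 2 ≤ r) (hℓ : r ≤ ℓ) (m z : ℕ) :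
    tn ℓ r m + z * ((ℓ-1).choose (r-1) * (m/ℓ)^(r-1)) ≤ tn ℓ r (m+z) := by
  induction z with
  | zero => simp
  | succ z ih =>
    have h1 := tn_succ hr hℓ (m+z)
    have h2 : (ℓ-1).choose (r-1) * (m/ℓ)^(r-1) ≤ (ℓ-1).choose (r-1) * ((m+z)/ℓ)^(r-1) := by
      apply Nat.mul_le_mul_left
      apply Nat.pow_le_pow_left
      exact Nat.div_le_div_right (by omega)
    rw [add_mul, one_mul, ← add_assoc m z 1]
    omega

lemma tn_mono {ℓ r : ℕ} {a b : ℕ} (h : a ≤ b) : tn ℓ r a ≤ tn ℓ r b := by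
  apply Finset.card_le_card
  intro Q hQ
  obtain ⟨a, b, c⟩ := mem_ks.1 hQ
  exact mem_ks.2 ⟨a.trans (Finset.range_mono h), b, c⟩

lemma floor_pow (ℓ : ℕ) (hℓ : 0 < ℓ) (C x : ℝ) (hC : 0 ≤ C) (hx0 : 0 ≤ x) (hx1 : x ≤ 1) (n m k : ℕ)
    (hm : (1-x) * n ≤ (m:ℝ) - ℓ) :
    C / (ℓ:ℝ)^k * (1 - k*x) * (n:ℝ)^k ≤ C * ((m/ℓ : ℕ):ℝ)^k := by
  have h1 : (m:ℝ) - ℓ ≤ ℓ * ((m/ℓ:ℕ):ℝ) := by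
    have := Nat.lt_mul_div_succ m hℓ
    have h2 : (m:ℝ) < ℓ * (((m/ℓ:ℕ):ℝ)+1) := by exact_mod_cast this
    linarith
  have hl : (0:ℝ) < ℓ := by exact_mod_cast hℓ
  have h2 : ((1-x) * n)^k ≤ (ℓ * ((m/ℓ:ℕ):ℝ))^k := by
    apply pow_le_pow_left₀
    · apply mul_nonneg (by linarith) (by positivity)
    · linarith
  have h3 : 1 - k*x ≤ (1-x)^k := by
    have := one_add_mul_le_pow (show (-2:ℝ) ≤ -x by linarith) k
    rw [← sub_eq_add_neg] at this
    linarith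
  rw [mul_pow, mul_pow] at h2
  have h4 : (1 - k*x) * (n:ℝ)^k ≤ (ℓ:ℝ)^k * ((m/ℓ:ℕ):ℝ)^k :=
    (mul_le_mul_of_nonneg_right h3 (by positivity)).trans h2
  calc C / (ℓ:ℝ)^k * (1 - k*x) * (n:ℝ)^k = C / (ℓ:ℝ)^k * ((1 - k*x) * (n:ℝ)^k) := by ring
    _ ≤ C / (ℓ:ℝ)^k * ((ℓ:ℝ)^k * ((m/ℓ:ℕ):ℝ)^k) := by
      apply mul_le_mul_of_nonneg_left h4; positivity
    _ = _ := by field_simp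

lemma tn_lower_real {ℓ r : ℕ} (hr : 2 ≤ r) (hℓ : r ≤ ℓ) (δ : ℝ) (hδ : 0 < δ) :
    ∃ N : ℕ, ∀ n : ℕ, N ≤ n → (LL ℓ r - δ) * (n:ℝ)^r ≤ tn ℓ r n := by
  have hL := LL_pos hr hℓ
  have hr0 : (0:ℝ) < r := by exact_mod_cast (by omega : 0 < r)
  obtain ⟨x, hx0, hx1, hx2⟩ : ∃ x : ℝ, 0 < x ∧ x ≤ 1 ∧ LL ℓ r * r * x ≤ δ := by
    refine ⟨min 1 (δ/(LL ℓ r * r)), by positivity, min_le_left _ _, ?_⟩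
    have := min_le_right 1 (δ/(LL ℓ r * r))
    rw [le_div_iff₀ (by positivity)] at this
    linarith
  refine ⟨⌈ℓ/x⌉₊, fun n hn => ?_⟩
  have hn1 : (ℓ:ℝ) ≤ x * n := by
    have : (ℓ/x:ℝ) ≤ n := (Nat.le_ceil _).trans (by exact_mod_cast hn)
    rw [div_le_iff₀ hx0] at this; linarith
  have h1 := floor_pow ℓ (by omega) (ℓ.choose r) x (by positivity) hx0.le hx1 n n r (by linarith)
  have h2 : ((ℓ.choose r : ℝ)) * ((n/ℓ:ℕ):ℝ)^r ≤ tn ℓ r n := by exact_mod_cast tn_lower hℓ n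
  refine le_trans ?_ (h1.trans h2)
  apply mul_le_mul_of_nonneg_right _ (by positivity)
  have : (ℓ.choose r : ℝ) / (ℓ:ℝ)^r = LL ℓ r := rfl
  rw [this]; linarith

lemma tn_incr_real {ℓ r : ℕ} (hr : 2 ≤ r) (hℓ : r ≤ ℓ) (γ : ℝ) (hγ : 0 < γ) :
    ∃ η : ℝ, 0 < η ∧ ∃ N : ℕ, ∀ n z : ℕ, N ≤ n → (z:ℝ) ≤ η * n → z ≤ n →
      (tn ℓ r (n-z) : ℝ) + z * ((DD ℓ r - γ) * (n:ℝ)^(r-1)) ≤ tn ℓ r n := by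
  have hD := DD_pos hr hℓ
  have hr0 : (0:ℝ) < r := by exact_mod_cast (by omega : 0 < r)
  obtain ⟨x, hx0, hx1, hx2⟩ : ∃ x : ℝ, 0 < x ∧ x ≤ 1 ∧ DD ℓ r * r * x ≤ γ := by
    refine ⟨min 1 (γ/(DD ℓ r * r)), by positivity, min_le_left _ _, ?_⟩
    have := min_le_right 1 (γ/(DD ℓ r * r))
    rw [le_div_iff₀ (by positivity)] at this
    linarith
  refine ⟨x/2, by positivity, ⌈ℓ/(x/2)⌉₊, fun n z hn hz hzn => ?_⟩
  have hn1 : (ℓ:ℝ) ≤ x/2 * n := by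
    have : (ℓ/(x/2):ℝ) ≤ n := (Nat.le_ceil _).trans (by exact_mod_cast hn)
    rw [div_le_iff₀ (by positivity)] at this; linarith
  have h1 := floor_pow ℓ (by omega) ((ℓ-1).choose (r-1)) x (by positivity) hx0.le hx1 n (n-z) (r-1)
    (by rw [Nat.cast_sub hzn]; linarith)
  have h2 := tn_incr hr hℓ (n-z) z
  rw [Nat.sub_add_cancel hzn] at h2
  have h3 : (tn ℓ r (n-z) : ℝ) + z * (((ℓ-1).choose (r-1) : ℝ) * (((n-z)/ℓ:ℕ):ℝ)^(r-1)) ≤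
      tn ℓ r n := by exact_mod_cast h2
  refine le_trans ?_ h3
  have h4 : (DD ℓ r - γ) * (n:ℝ)^(r-1) ≤
      ((ℓ-1).choose (r-1) : ℝ) * (((n-z)/ℓ:ℕ):ℝ)^(r-1) := by
    refine le_trans ?_ h1
    apply mul_le_mul_of_nonneg_right _ (by positivity)
    have : ((ℓ-1).choose (r-1) : ℝ) / (ℓ:ℝ)^(r-1) = DD ℓ r := rfl
    rw [this]
    have h5 : ((r-1:ℕ):ℝ) ≤ r := by exact_mod_cast Nat.sub_le r 1
    have h6 : DD ℓ r * ((r-1:ℕ):ℝ) * x ≤ DD ℓ r * r * x := by gcongr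
    linarith
  have := mul_le_mul_of_nonneg_left h4 (Nat.cast_nonneg z : (0:ℝ) ≤ z)
  linarith

end P9

section P10
open scoped Classical
variable {r : ℕ}

lemma exact0 {ℓ : ℕ} (hr : 2 ≤ r) (hℓ : r ≤ ℓ) :
    ∃ N : ℕ, ∀ H : HGraph r, ¬ (expF ℓ r).IsCopyIn H → N ≤ H.verts.card →
      tn ℓ r H.verts.card ≤ H.edges.card →
      ∃ p : ℕ → ℕ, Bal ℓ p H.verts ∧ H.edges = ks p H.verts r := by
  have hD := DD_pos hr hℓ
  have hℓ0 : (0:ℝ) < ℓ := by exact_mod_cast (by omega : 0 < ℓ)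
  obtain ⟨κ, hκ, hκ1⟩ : ∃ κ : ℝ, 0 < κ ∧ κ*(4*(ℓ+1)*ℓ) ≤ 1 :=
    ⟨1/(4*(ℓ+1)*ℓ), by positivity, le_of_eq (by field_simp)⟩
  obtain ⟨θ0, hθ0, N1, hmin⟩ := min_deg hr hℓ κ hκ hκ1
  obtain ⟨θ, hθ, hθ1, hθD⟩ : ∃ θ : ℝ, 0 < θ ∧ θ ≤ θ0 ∧ θ ≤ DD ℓ r :=
    ⟨min θ0 (DD ℓ r), lt_min hθ0 hD, min_le_left _ _, min_le_right _ _⟩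
  obtain ⟨η0, hη0, N3, hinc⟩ := tn_incr_real hr hℓ (θ/2) (by positivity)
  obtain ⟨η, hη, hη1, hη2⟩ : ∃ η : ℝ, 0 < η ∧ η ≤ η0 ∧ η ≤ 1/2 :=
    ⟨min η0 (1/2), lt_min hη0 (by norm_num), min_le_left _ _, min_le_right _ _⟩
  obtain ⟨δ, hδ, N2, hdel⟩ := deletion hr hℓ θ hθ hθD η hη
  obtain ⟨N4, hlow⟩ := tn_lower_real hr hℓ δ hδ
  refine ⟨2*N1 + N2 + N3 + N4 + 2*ℓ + 1, ?_⟩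
  intro H hF hN he
  obtain ⟨Z, hZ, hZc, hZe, hZd⟩ := hdel H hF (by omega)
    ((hlow _ (by omega)).trans (by exact_mod_cast he))
  generalize hn : H.verts.card = n at *
  have hn0 : (0:ℝ) < n := by exact_mod_cast (by omega : 0 < n)
  have hZn : Z.card ≤ n := by rw [← hn]; exact Finset.card_le_card hZ
  have hcard : (dl H Z).verts.card = n - Z.card := by
    rw [dl_verts, Finset.card_sdiff_of_subset hZ, hn]
  have hZ2 : 2 * Z.card ≤ n := by
    have h1 : η * n ≤ 1/2 * n := mul_le_mul_of_nonneg_right hη2 hn0.le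
    have : 2 * (Z.card:ℝ) ≤ n := by linarith
    exact_mod_cast this
  obtain ⟨p, d, hS, hd, hbig⟩ := hmin (dl H Z) (not_copy_dl Z hF) (by omega) (by
    intro w hw
    have hw' : w ∈ H.verts \ Z := by rwa [dl_verts] at hw
    refine le_trans ?_ (hZd w hw')
    refine mul_le_mul (by linarith) (pow_le_pow_left₀ (by positivity) ?_ _) (by positivity)
      (by linarith)
    rw [hcard]; exact_mod_cast Nat.sub_le _ _)
  have hsub : (dl H Z).edges ⊆ ks p (dl H Z).verts r := by
    intro e hee
    refine mem_ks.2 ⟨(dl H Z).edges_sub e hee, (dl H Z).edges_card e hee, ?_⟩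
    intro x hx y hy hxy
    exact hS.v1 hr _ _ _ _ (not_copy_dl Z hF) e hee x hx y hy ((dl H Z).edges_sub e hee hx)
      ((dl H Z).edges_sub e hee hy) hxy
  have hmax := turan_max hr hℓ (dl H Z).verts (by omega) p hS.col
  have hle : (dl H Z).edges.card ≤ tn ℓ r (n - Z.card) := by
    rw [← hcard]; exact (Finset.card_le_card hsub).trans hmax.1
  rcases Finset.eq_empty_or_nonempty Z with hZ0 | hZ0
  · subst hZ0
    have hv : (dl H ∅).verts = H.verts := by rw [dl_verts]; simp
    have hE : (dl H ∅).edges = H.edges := by ext e; simp [mem_dl_edges]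
    rw [hv, hE] at hsub
    rw [hv, hn] at hmax
    have heq : H.edges = ks p H.verts r :=
      Finset.eq_of_subset_of_card_le hsub (hmax.1.trans he)
    refine ⟨p, hmax.2 (le_antisymm hmax.1 ?_), heq⟩
    rw [← heq]; exact he
  · exfalso
    have h1 := hinc n Z.card (by omega)
      (hZc.trans (mul_le_mul_of_nonneg_right hη1 hn0.le)) hZn
    have h2 : ((dl H Z).edges.card : ℝ) ≤ tn ℓ r (n - Z.card) := by exact_mod_cast hle
    have h3 : (tn ℓ r n : ℝ) ≤ H.edges.card := by exact_mod_cast he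
    have h4 : 0 < (Z.card : ℝ) * (θ/2 * (n:ℝ)^(r-1)) := by
      have : 0 < (Z.card:ℝ) := by exact_mod_cast hZ0.card_pos
      positivity
    nlinarith

end P10

section P11
open scoped Classical
variable {r : ℕ}

lemma copy_mono {F H H' : HGraph r} (hv : H.verts ⊆ H'.verts) (he : H.edges ⊆ H'.edges)
    (h : F.IsCopyIn H) : F.IsCopyIn H' := by
  obtain ⟨f, h1, h2, h3⟩ := h
  exact ⟨f, h1, fun v hv' => hv (h2 v hv'), fun e he' => he (h3 e he')⟩

lemma induce_verts (H : HGraph r) (S : Finset ℕ) : (H.induce S).verts = H.verts ∩ S := rfl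

lemma copy_set {F H : HGraph r} (h : F.IsCopyIn H) :
    ∃ S ⊆ H.verts, S.card = F.verts.card ∧ F.IsCopyIn (H.induce S) := by
  obtain ⟨f, h1, h2, h3⟩ := h
  have hS : F.verts.image f ⊆ H.verts := by
    intro y hy
    obtain ⟨x, hx, rfl⟩ := Finset.mem_image.1 hy
    exact h2 x hx
  refine ⟨F.verts.image f, hS, Finset.card_image_of_injOn h1, f, h1, ?_, ?_⟩
  · intro v hv
    rw [induce_verts, Finset.mem_inter]
    exact ⟨h2 v hv, Finset.mem_image_of_mem f hv⟩
  · intro e he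
    rw [mem_induce_edges]
    exact ⟨h3 e he, Finset.image_subset_image (F.edges_sub e he)⟩

lemma induce_dl_mono {F H : HGraph r} (Z S : Finset ℕ) (h : F.IsCopyIn ((dl H Z).induce S)) :
    F.IsCopyIn (H.induce S) := by
  refine copy_mono ?_ ?_ h
  · rw [induce_verts, induce_verts, dl_verts]
    exact Finset.inter_subset_inter_right Finset.sdiff_subset
  · intro e he
    rw [mem_induce_edges] at he ⊢
    exact ⟨dl_edges_sub' H Z he.1, he.2⟩

lemma copy_of_induce {F H : HGraph r} (S : Finset ℕ) (h : F.IsCopyIn (H.induce S)) :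
    F.IsCopyIn H := by
  refine copy_mono ?_ ?_ h
  · rw [induce_verts]; exact Finset.inter_subset_left
  · intro e he
    rw [mem_induce_edges] at he
    exact he.1

lemma no_match_one {F H : HGraph r} (h : ¬ F.HasMatching H (0+1)) : ¬ F.IsCopyIn H := by
  intro hc
  apply h
  obtain ⟨S, hS, hSc, hSi⟩ := copy_set hc
  refine ⟨fun _ => S, fun _ => ⟨hS, hSc⟩, ?_, fun _ => hSi⟩
  intro i j hij
  exact absurd (Fin.ext (by omega)) hij

lemma match_snoc {F H : HGraph r} (Z : Finset ℕ) (T : ℕ) (hm : F.HasMatching (dl H Z) T)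
    (hn : ¬ F.HasMatching H (T+1)) :
    ∃ U ⊆ H.verts \ Z, U.card = T * F.verts.card ∧ ¬ F.IsCopyIn (dl H U) := by
  obtain ⟨S, hS1, hS2, hS3⟩ := hm
  refine ⟨Finset.univ.biUnion S, ?_, ?_, ?_⟩
  · intro x hx
    obtain ⟨i, _, hi⟩ := Finset.mem_biUnion.1 hx
    have := (hS1 i).1 hi
    rwa [dl_verts] at this
  · rw [Finset.card_biUnion (fun i _ j _ hij => hS2 i j hij)]
    simp [fun i => (hS1 i).2]
  · intro hc
    apply hn
    obtain ⟨R, hR1, hR2, hR3⟩ := copy_set hc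
    rw [dl_verts] at hR1
    have hdis : ∀ i, Disjoint R (S i) := by
      intro i
      rw [Finset.disjoint_left]
      intro x hx hxS
      exact (Finset.mem_sdiff.1 (hR1 hx)).2 (Finset.mem_biUnion.2 ⟨i, Finset.mem_univ i, hxS⟩)
    refine ⟨Fin.cons R S, ?_, ?_, ?_⟩
    · intro i
      refine Fin.cases ?_ (fun i => ?_) i
      · exact ⟨hR1.trans Finset.sdiff_subset, hR2⟩
      · simp only [Fin.cons_succ]
        refine ⟨?_, (hS1 i).2⟩
        have := (hS1 i).1
        rw [dl_verts] at this
        exact this.trans Finset.sdiff_subset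
    · intro i j
      refine Fin.cases ?_ (fun i => ?_) i <;> refine Fin.cases ?_ (fun j => ?_) j
      · intro h; exact absurd rfl h
      · intro _; simpa using hdis j
      · intro _; simpa using (hdis i).symm
      · intro h
        simp only [Fin.cons_succ]
        exact hS2 i j (fun hh => h (by rw [hh]))
    · intro i
      refine Fin.cases ?_ (fun i => ?_) i
      · exact induce_dl_mono _ _ hR3
      · simp only [Fin.cons_succ]
        exact induce_dl_mono _ _ (hS3 i)

/-- the extremal structure -/
def Str (ℓ t : ℕ) (H : HGraph r) : Prop :=
  ∃ L ⊆ H.verts, L.card = t ∧ ∃ p : ℕ → ℕ, Bal ℓ p (H.verts \ L) ∧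
    ∀ e, e ∈ H.edges ↔ e ⊆ H.verts ∧ e.card = r ∧
      ((e ∩ L).Nonempty ∨ ∀ x ∈ e, ∀ y ∈ e, x ≠ y → p x ≠ p y)

lemma bal_count {ℓ : ℕ} (hℓ : 0 < ℓ) (p : ℕ → ℕ) (V : Finset ℕ) (hV : ℓ ≤ V.card)
    (hB : Bal ℓ p V) (s : ℕ) : (ks p V s).card = tn ℓ s V.card := by
  obtain ⟨g, hg, hg2⟩ := bal_enum hℓ p V hV hB
  exact ks_bij p (fun x => x % ℓ) V _ g hg hg2 s

lemma str_count {ℓ t m : ℕ} (hℓ : 0 < ℓ) (H : HGraph r) (hm : ℓ ≤ m) (hV : H.verts.card = m + t)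
    (hS : Str ℓ t H) : H.edges.card + m.choose r = (m+t).choose r + tn ℓ r m := by
  obtain ⟨L, hL, hLt, p, hB, he⟩ := hS
  have hc : (H.verts \ L).card = m := by rw [Finset.card_sdiff_of_subset hL]; omega
  have heq : H.edges = (Finset.powersetCard r H.verts \ Finset.powersetCard r (H.verts \ L)) ∪
      ks p (H.verts \ L) r := by
    ext e
    rw [he, Finset.mem_union, Finset.mem_sdiff, Finset.mem_powersetCard, Finset.mem_powersetCard,
      mem_ks]
    have hsd : e ⊆ H.verts → (e ⊆ H.verts \ L ↔ ¬ (e ∩ L).Nonempty) := by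
      intro hev
      rw [Finset.subset_sdiff, Finset.not_nonempty_iff_eq_empty, ← Finset.disjoint_iff_inter_eq_empty]
      exact ⟨fun h => h.2, fun h => ⟨hev, h⟩⟩
    have hsd2 : e ⊆ H.verts \ L → e ⊆ H.verts := fun h => h.trans Finset.sdiff_subset
    constructor
    · rintro ⟨a, b, c⟩
      by_cases hh : (e ∩ L).Nonempty
      · left; exact ⟨⟨a, b⟩, fun h => (hsd a).1 h.1 hh⟩
      · right; exact ⟨(hsd a).2 hh, b, c.resolve_left hh⟩
    · rintro (⟨⟨a, b⟩, c⟩ | ⟨a, b, c⟩)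
      · refine ⟨a, b, Or.inl ?_⟩
        by_contra hh
        exact c ⟨(hsd a).2 hh, b⟩
      · exact ⟨hsd2 a, b, Or.inr c⟩
  have hdis : Disjoint (Finset.powersetCard r H.verts \ Finset.powersetCard r (H.verts \ L))
      (ks p (H.verts \ L) r) := by
    rw [Finset.disjoint_left]
    intro e h1 h2
    obtain ⟨a, b, _⟩ := mem_ks.1 h2
    exact (Finset.mem_sdiff.1 h1).2 (Finset.mem_powersetCard.2 ⟨a, b⟩)
  rw [heq, Finset.card_union_of_disjoint hdis, bal_count hℓ p _ (by omega) hB,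
    Finset.card_sdiff_of_subset (Finset.powersetCard_mono Finset.sdiff_subset),
    Finset.card_powersetCard, Finset.card_powersetCard, hc, hV]
  have : m.choose r ≤ (m+t).choose r := Nat.choose_le_choose r (by omega)
  omega

lemma thru_image (H : HGraph r) (hr : 2 ≤ r) (v : ℕ) :
    (H.edges.filter fun e => v ∈ e) ⊆
      (Finset.powersetCard (r-1) (H.verts.erase v)).image (fun Q => insert v Q) := by
  intro e he
  obtain ⟨h1, h2⟩ := Finset.mem_filter.1 he
  refine Finset.mem_image.2 ⟨e.erase v, ?_, Finset.insert_erase h2⟩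
  rw [Finset.mem_powersetCard]
  exact ⟨Finset.erase_subset_erase v (H.edges_sub e h1), by
    rw [Finset.card_erase_of_mem h2, H.edges_card e h1]⟩

lemma deg_choose (H : HGraph r) (hr : 2 ≤ r) (v : ℕ) (hv : v ∈ H.verts) :
    H.deg v ≤ (H.verts.card - 1).choose (r-1) := by
  rw [HGraph.deg]
  refine le_trans (Finset.card_le_card ?_) ((Finset.card_image_le
    (s := Finset.powersetCard (r-1) (H.verts.erase v)) (f := fun Q => insert v Q)).trans ?_)
  · convert thru_image H hr v
  · rw [Finset.card_powersetCard, Finset.card_erase_of_mem hv]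

lemma deg_full (H : HGraph r) (hr : 2 ≤ r) (v : ℕ) (hv : v ∈ H.verts)
    (h : (H.verts.card - 1).choose (r-1) ≤ H.deg v) (e : Finset ℕ) (he : e ⊆ H.verts)
    (hec : e.card = r) (hve : v ∈ e) : e ∈ H.edges := by
  have h1 := thru_image H hr v
  have h2 : (H.edges.filter fun e => v ∈ e) =
      (Finset.powersetCard (r-1) (H.verts.erase v)).image (fun Q => insert v Q) := by
    apply Finset.eq_of_subset_of_card_le h1
    refine Finset.card_image_le.trans ?_
    rw [Finset.card_powersetCard, Finset.card_erase_of_mem hv]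
    refine h.trans (le_of_eq ?_)
    rw [HGraph.deg]
  have h3 : e ∈ (Finset.powersetCard (r-1) (H.verts.erase v)).image (fun Q => insert v Q) := by
    refine Finset.mem_image.2 ⟨e.erase v, ?_, Finset.insert_erase hve⟩
    rw [Finset.mem_powersetCard]
    exact ⟨Finset.erase_subset_erase v he, by rw [Finset.card_erase_of_mem hve, hec]⟩
  rw [← h2] at h3
  exact (Finset.mem_filter.1 h3).1

/-- induction step when some vertex removal destroys the matching -/
lemma str_step {ℓ t m : ℕ} (hr : 2 ≤ r) (hℓ : 0 < ℓ) (H : HGraph r) (hm : ℓ ≤ m)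
    (hV : H.verts.card = m + (t+1)) (v : ℕ) (hv : v ∈ H.verts)
    (he : (m+(t+1)).choose r + tn ℓ r m ≤ H.edges.card + m.choose r)
    (ih : (m+t).choose r + tn ℓ r m ≤ (dl H {v}).edges.card + m.choose r → Str ℓ t (dl H {v})) :
    Str ℓ (t+1) H := by
  have hdv : (dl H {v}).verts.card = m + t := by
    rw [dl_verts, Finset.card_sdiff_of_subset (by simpa using hv), hV]; simp
  have h1 := edges_le_dl H {v}
  rw [Finset.sum_singleton] at h1
  have h2 := deg_choose H hr v hv
  have hp : (m+(t+1)).choose r = (m+t).choose (r-1) + (m+t).choose r := by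
    obtain ⟨s, rfl⟩ : ∃ s, r = s + 1 := ⟨r-1, by omega⟩
    rw [← add_assoc, Nat.choose_succ_succ]; rfl
  have hV1 : H.verts.card - 1 = m + t := by omega
  rw [hV1] at h2
  have hS := ih (by omega)
  have hcnt := str_count hℓ (dl H {v}) hm hdv hS
  have hfull := deg_full H hr v hv (by rw [hV1]; omega)
  obtain ⟨L, hL, hLt, p, hB, hE⟩ := hS
  rw [dl_verts] at hL hB
  have hvL : v ∉ L := fun h => by simpa using (Finset.mem_sdiff.1 (hL h)).2
  refine ⟨insert v L, ?_, ?_, p, ?_, ?_⟩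
  · intro x hx
    rcases Finset.mem_insert.1 hx with h | h
    · rw [h]; exact hv
    · exact (Finset.mem_sdiff.1 (hL h)).1
  · rw [Finset.card_insert_of_notMem hvL, hLt]
  · have : H.verts \ insert v L = (H.verts \ {v}) \ L := by
      ext x; simp only [Finset.mem_sdiff, Finset.mem_insert, Finset.mem_singleton]; tauto
    rw [this]; exact hB
  · intro e
    by_cases hve : v ∈ e
    · constructor
      · intro h
        exact ⟨H.edges_sub e h, H.edges_card e h, Or.inl ⟨v, Finset.mem_inter.2
          ⟨hve, Finset.mem_insert_self v L⟩⟩⟩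
      · rintro ⟨a, b, _⟩
        exact hfull e a b hve
    · have h3 : e ∈ H.edges ↔ e ∈ (dl H {v}).edges := by
        rw [mem_dl_edges]; simp [hve]
      have h4 : e ∩ insert v L = e ∩ L := by
        ext x; simp only [Finset.mem_inter, Finset.mem_insert]
        constructor
        · rintro ⟨a, rfl | b⟩
          · exact absurd a hve
          · exact ⟨a, b⟩
        · rintro ⟨a, b⟩; exact ⟨a, Or.inr b⟩
      have h5 : e ⊆ H.verts \ {v} ↔ e ⊆ H.verts := by
        rw [Finset.subset_sdiff]; simp [hve]
      rw [h3, hE, h4, dl_verts, h5]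

/-- a structured graph has no large matching -/
lemma str_no_match {ℓ t : ℕ} (hr : 2 ≤ r) (H : HGraph r) (hS : Str ℓ t H) :
    ¬ (expF ℓ r).HasMatching H (t+1) := by
  obtain ⟨L, hL, hLt, p, hB, hE⟩ := hS
  rintro ⟨S, hS1, hS2, hS3⟩
  have hmeet : ∀ i, (S i ∩ L).Nonempty := by
    intro i
    by_contra hne
    rw [Finset.not_nonempty_iff_eq_empty, ← Finset.disjoint_iff_inter_eq_empty] at hne
    refine partite_free hr (H.induce (S i)) p ?_ ?_ (hS3 i)
    · intro v hv
      rw [induce_verts, Finset.mem_inter] at hv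
      exact hB.1 v (Finset.mem_sdiff.2 ⟨hv.1, Finset.disjoint_left.1 hne hv.2⟩)
    · intro e he x hx y hy hxy
      rw [mem_induce_edges] at he
      have := ((hE e).1 he.1).2.2
      rcases this with ⟨z, hz⟩ | h
      · rw [Finset.mem_inter] at hz
        exact absurd hz.2 (Finset.disjoint_left.1 hne (he.2 hz.1))
      · exact h x hx y hy hxy
  choose g hg using hmeet
  have hinj : Function.Injective g := by
    intro i j hij
    by_contra hne
    have h1 := (Finset.mem_inter.1 (hg i)).1
    have h2 := (Finset.mem_inter.1 (hg j)).1
    rw [hij] at h1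
    exact Finset.disjoint_left.1 (hS2 i j hne) h1 h2
  have : (Finset.univ.image g).card ≤ L.card := by
    apply Finset.card_le_card
    intro x hx
    obtain ⟨i, _, rfl⟩ := Finset.mem_image.1 hx
    exact (Finset.mem_inter.1 (hg i)).2
  rw [Finset.card_image_of_injective _ hinj, Finset.card_univ, Fintype.card_fin] at this
  omega

end P11

section P12

open scoped Classical

variable {r : ℕ}

lemma choose_real (k : ℕ) (ε : ℝ) (hε : 0 < ε) :
    ∃ N : ℕ, ∀ m : ℕ, N ≤ m → (1 / (k.factorial : ℝ) - ε) * (m:ℝ)^k < m.choose k := by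
  obtain ⟨N, hN⟩ := exists_nat_gt ((k:ℝ)^2/ε)
  refine ⟨N + k + 1, fun m hm => ?_⟩
  have hm0 : (0:ℝ) < m := by exact_mod_cast (by omega : 0 < m)
  have hmN : (N:ℝ) ≤ m := by exact_mod_cast (by omega : N ≤ m)
  have hkm : (k:ℝ) ≤ m := by exact_mod_cast (by omega : k ≤ m)
  have hf : (1:ℝ) ≤ k.factorial := by exact_mod_cast Nat.factorial_pos k
  have h1 : (((m + 1 - k : ℕ) : ℝ)^k) / (k.factorial : ℝ) ≤ m.choose k := by
    have := Nat.pow_le_choose (α := ℝ) k m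
    exact_mod_cast this
  have h2 : (m:ℝ) - k ≤ ((m+1-k : ℕ):ℝ) := by
    rw [Nat.cast_sub (by omega)]; push_cast; linarith
  have h3 : 1 + (k:ℝ) * (-(k/m)) ≤ (1 + (-(k/m:ℝ)))^k := by
    apply one_add_mul_le_pow
    have : (k:ℝ)/m ≤ 1 := by rw [div_le_one hm0]; exact hkm
    linarith
  have h4 : (m:ℝ) * (1 + (-(k/m:ℝ))) = m - k := by field_simp; ring
  have h5 : (m:ℝ)^k * (1 + (k:ℝ) * (-(k/m))) ≤ ((m+1-k : ℕ):ℝ)^k := by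
    calc (m:ℝ)^k * (1 + (k:ℝ) * (-(k/m))) ≤ (m:ℝ)^k * (1 + (-(k/m:ℝ)))^k := by gcongr
      _ = ((m:ℝ) - k)^k := by rw [← mul_pow, h4]
      _ ≤ _ := by
        apply pow_le_pow_left₀ _ h2
        linarith
  have h6 : (k:ℝ) * (k/m) < ε := by
    rw [div_lt_iff₀ hε] at hN
    rw [← mul_div_assoc, div_lt_iff₀ hm0]
    nlinarith
  have hmk : (0:ℝ) < (m:ℝ)^k := by positivity
  refine lt_of_lt_of_le ?_ h1
  rw [lt_div_iff₀ (by linarith)]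
  refine lt_of_lt_of_le ?_ h5
  have h7 : (1 / (k.factorial : ℝ) - ε) * (m:ℝ)^k * k.factorial =
      (m:ℝ)^k * (1 - ε * k.factorial) := by field_simp
  rw [h7]
  apply mul_lt_mul_of_pos_left _ hmk
  nlinarith

lemma DD_lt {ℓ : ℕ} (hr : 2 ≤ r) (hℓ : r ≤ ℓ) : DD ℓ r < 1 / ((r-1).factorial : ℝ) := by
  have hf : (0:ℝ) < (r-1).factorial := by exact_mod_cast Nat.factorial_pos _
  have hl : (0:ℝ) < (ℓ:ℝ)^(r-1) := by
    have : (0:ℝ) < ℓ := by exact_mod_cast (by omega : 0 < ℓ)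
    positivity
  rw [DD, div_lt_div_iff₀ hl hf, one_mul]
  have h1 : (ℓ-1).choose (r-1) * (r-1).factorial ≤ (ℓ-1)^(r-1) := by
    rw [mul_comm, ← Nat.descFactorial_eq_factorial_mul_choose]
    exact Nat.descFactorial_le_pow _ _
  have h2 : (ℓ-1)^(r-1) < ℓ^(r-1) := Nat.pow_lt_pow_left (by omega) (by omega)
  exact_mod_cast lt_of_le_of_lt h1 h2

lemma choose_add_ge (m T k : ℕ) : m.choose (k+1) + T * m.choose k ≤ (m+T).choose (k+1) := by
  induction T with
  | zero => simp
  | succ T ih =>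
    have h1 : (m+(T+1)).choose (k+1) = (m+T).choose k + (m+T).choose (k+1) := by
      rw [← add_assoc, Nat.choose_succ_succ']
    have h2 : m.choose k ≤ (m+T).choose k := Nat.choose_le_choose k (by omega)
    rw [h1, add_mul]
    omega

lemma expF_pos (ℓ : ℕ) : 0 < (expF ℓ r).verts.card := by
  rw [Finset.card_pos]
  refine ⟨1, ?_⟩
  simp [expF, HGraph.expansion, HGraph.ofEdges, emptyOn]

/-- the F-free graph has at most `tn` edges -/
lemma free_le {ℓ : ℕ} (hr : 2 ≤ r) (hℓ : r ≤ ℓ) :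
    ∃ N : ℕ, ∀ H : HGraph r, ¬ (expF ℓ r).IsCopyIn H → N ≤ H.verts.card →
      H.edges.card ≤ tn ℓ r H.verts.card := by
  obtain ⟨N, hN⟩ := exact0 (r := r) hr hℓ
  refine ⟨N + ℓ, fun H hc hn => ?_⟩
  by_contra hlt
  push Not at hlt
  obtain ⟨p, hB, he⟩ := hN H hc (by omega) hlt.le
  have := bal_count (by omega : 0 < ℓ) p H.verts (by omega) hB r
  rw [← he] at this
  omega

set_option maxHeartbeats 1000000 in
lemma no_case {ℓ : ℕ} (hr : 2 ≤ r) (hℓ : r ≤ ℓ) :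
    ∃ N : ℕ, ∃ c : ℝ, 0 < c ∧ ∀ T m : ℕ, 0 < T → N ≤ m → (T:ℝ) ≤ c * m →
      ∀ H : HGraph r, H.verts.card = m + T → ¬ (expF ℓ r).HasMatching H (T+1) →
      (m+T).choose r + tn ℓ r m ≤ H.edges.card + m.choose r →
      ∃ v ∈ H.verts, ¬ (expF ℓ r).HasMatching (dl H {v}) T := by
  obtain ⟨f, hf⟩ : ∃ f, f = (expF ℓ r).verts.card := ⟨_, rfl⟩
  have hf1 : 1 ≤ f := by rw [hf]; exact expF_pos ℓ
  have hfR : (1:ℝ) ≤ f := by exact_mod_cast hf1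
  have hDA := DD_lt hr hℓ
  have hD := DD_pos hr hℓ
  have hL := LL_pos hr hℓ
  obtain ⟨γ, hγ, hγ2⟩ : ∃ γ : ℝ, 0 < γ ∧
      DD ℓ r + 3 * f * γ ≤ 1 / ((r-1).factorial : ℝ) - γ := by
    refine ⟨(1 / ((r-1).factorial : ℝ) - DD ℓ r) / (3*f+1), div_pos (by linarith) (by linarith), ?_⟩
    have h0 : (0:ℝ) < 3*f+1 := by linarith
    have : (3*f+1) * ((1 / ((r-1).factorial : ℝ) - DD ℓ r) / (3*f+1)) =
      1 / ((r-1).factorial : ℝ) - DD ℓ r := by rw [mul_div_cancel₀ _ h0.ne']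
    linarith
  obtain ⟨δ, hδ, N1, hN1⟩ := bounded (r := r) hr hℓ γ hγ
  obtain ⟨N2, hN2⟩ := tn_lower_real hr hℓ (δ/2) (by linarith)
  obtain ⟨η, hη, N3, hN3⟩ := tn_incr_real hr hℓ γ hγ
  obtain ⟨N4, hN4⟩ := choose_real (r-1) γ hγ
  obtain ⟨N5, hN5⟩ := free_le (r := r) hr hℓ
  obtain ⟨K, hK⟩ : ∃ K : ℝ, K = 2^(r-1) := ⟨_, rfl⟩
  have hK1 : 1 ≤ K := by rw [hK]; exact one_le_pow₀ (by norm_num)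
  obtain ⟨c, hc0, hc1, hc2, hc3, hc4⟩ : ∃ c : ℝ, 0 < c ∧ c * f ≤ 1/2 ∧ c * f * K ≤ δ/2 ∧
      c * f * K ≤ γ ∧ c * f ≤ η := by
    have hfK : (0:ℝ) < f*K := by nlinarith
    obtain ⟨μ, hμ⟩ : ∃ μ : ℝ, μ = min (1/2) (min (δ/2) (min γ η)) := ⟨_, rfl⟩
    have hμ0 : 0 < μ := by rw [hμ]; positivity
    have a1 : μ ≤ 1/2 := by rw [hμ]; exact min_le_left _ _
    have a2 : μ ≤ δ/2 := by rw [hμ]; exact (min_le_right _ _).trans (min_le_left _ _)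
    have a3 : μ ≤ γ := by
      rw [hμ]; exact (min_le_right _ _).trans ((min_le_right _ _).trans (min_le_left _ _))
    have a4 : μ ≤ η := by
      rw [hμ]; exact (min_le_right _ _).trans ((min_le_right _ _).trans (min_le_right _ _))
    have e1 : μ/(f*K) * f * K = μ := by field_simp
    have e2 : μ/(f*K) * f ≤ μ := by
      have : 0 ≤ μ/(f*K) * f := by positivity
      nlinarith
    exact ⟨μ/(f*K), by positivity, by linarith, by linarith, by linarith, by linarith⟩
  refine ⟨N2 + N3 + N4 + 2*(N1 + N5 + 1), c, hc0, ?_⟩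
  intro T m hT hm hTc H hV hnm he
  by_contra hcon
  push Not at hcon
  have hm0 : (0:ℝ) < m := by exact_mod_cast (by omega : 0 < m)
  have hne : H.verts.Nonempty := by rw [← Finset.card_pos]; omega
  obtain ⟨v, hv, hmax⟩ := Finset.exists_max_image H.verts H.deg hne
  obtain ⟨U, hU, hUc, hUf⟩ := match_snoc {v} T (hcon v hv) hnm
  rw [← hf] at hUc
  have hvU : v ∉ U := fun h => by simpa using hU h
  have hUs : U ⊆ H.verts := hU.trans Finset.sdiff_subset
  have hTf : (T:ℝ) * f ≤ c * f * m := by nlinarith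
  have hTf2 : 2 * (T * f) ≤ m := by
    have : (2:ℝ) * (T * f) ≤ m := by nlinarith
    exact_mod_cast this
  have hTT : T ≤ T * f := Nat.le_mul_of_pos_right T hf1
  have hsub : T * (f-1) = T * f - T := by rw [Nat.mul_sub, mul_one]
  have hn' : (dl H U).verts.card = m - T * (f-1) := by
    rw [dl_verts, Finset.card_sdiff_of_subset hUs, hV, hUc, hsub]
    omega
  have hB1 := edges_le_dl H U
  have hB2 : ∑ z ∈ U, H.deg z ≤ U.card * H.deg v := by
    rw [← smul_eq_mul]
    exact Finset.sum_le_card_nsmul _ _ _ (fun z hz => hmax z (hUs hz))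
  rw [hUc] at hB2
  obtain ⟨P, hP⟩ : ∃ P : ℝ, P = (m:ℝ)^(r-1) := ⟨_, rfl⟩
  have hP0 : 0 < P := by rw [hP]; positivity
  have hPr : (m:ℝ)^r = m * P := by
    rw [hP, ← pow_succ', Nat.sub_add_cancel (by omega)]
  have hnm2 : ((m + T : ℕ):ℝ) ≤ 2 * m := by exact_mod_cast (by omega : m + T ≤ 2 * m)
  have hnP : ((m+T:ℕ):ℝ)^(r-1) ≤ K * P := by
    rw [hK, hP, ← mul_pow]
    exact pow_le_pow_left₀ (by positivity) hnm2 _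
  -- real versions
  have hBr : (H.edges.card:ℝ) ≤ (dl H U).edges.card + T * f * H.deg v := by
    exact_mod_cast hB1.trans (Nat.add_le_add_left hB2 _)
  have hA : (T:ℝ) * (m.choose (r-1)) + tn ℓ r m ≤ H.edges.card := by
    have h1 := choose_add_ge m T (r-1)
    rw [Nat.sub_add_cancel (by omega : 1 ≤ r)] at h1
    exact_mod_cast (by omega : T * m.choose (r-1) + tn ℓ r m ≤ H.edges.card)
  have hdeg1 : (H.deg v : ℝ) ≤ K * P := by
    have h1 := deg_le H v
    rw [hV] at h1
    exact le_trans (by exact_mod_cast h1) hnP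
  have hTf0 : (0:ℝ) ≤ T * f := by positivity
  have htn := hN2 m (by omega)
  have hn'm : ((dl H U).verts.card : ℝ) ≤ m := by
    rw [hn']; exact_mod_cast Nat.sub_le _ _
  have hC : (LL ℓ r - δ) * ((dl H U).verts.card:ℝ)^r ≤ (dl H U).edges.card := by
    by_cases hLd : LL ℓ r ≤ δ
    · have : (LL ℓ r - δ) * ((dl H U).verts.card:ℝ)^r ≤ 0 :=
        mul_nonpos_of_nonpos_of_nonneg (by linarith) (by positivity)
      exact this.trans (by positivity)
    · push Not at hLd
      have h1 : (LL ℓ r - δ) * ((dl H U).verts.card:ℝ)^r ≤ (LL ℓ r - δ) * (m:ℝ)^r := by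
        apply mul_le_mul_of_nonneg_left _ (by linarith)
        exact pow_le_pow_left₀ (by positivity) hn'm _
      have h2 : (T:ℝ) * f * H.deg v ≤ (c * f * m) * (K * P) :=
        mul_le_mul hTf hdeg1 (by positivity) (by positivity)
      have h3 : (c * f * m) * (K * P) ≤ δ/2 * (m:ℝ)^r := by
        rw [hPr]
        have : (c * f * m) * (K * P) = (c*f*K) * (m*P) := by ring
        rw [this]
        exact mul_le_mul_of_nonneg_right hc2 (by positivity)
      have h4 : (0:ℝ) ≤ (T:ℝ) * (m.choose (r-1)) := by positivity
      have h5 : (LL ℓ r - δ/2) * (m:ℝ)^r - δ/2 * (m:ℝ)^r = (LL ℓ r - δ) * (m:ℝ)^r := by ring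
      linarith
  have hE1 := hN1 (dl H U) hUf (by rw [hn']; omega) hC v (by
    rw [dl_verts, Finset.mem_sdiff]; exact ⟨hv, hvU⟩)
  have hE2 : ((dl H U).deg v : ℝ) ≤ (DD ℓ r + γ) * P := by
    refine hE1.trans (mul_le_mul_of_nonneg_left ?_ (by linarith))
    rw [hP]
    exact pow_le_pow_left₀ (by positivity) hn'm _
  have hE3 : (H.deg v : ℝ) ≤ (dl H U).deg v + T * f * ((m+T:ℕ):ℝ)^(r-2) := by
    have := deg_le_dl H U v hvU
    rw [hUc, hV] at this
    exact_mod_cast this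
  have hE4 : (T:ℝ) * f * ((m+T:ℕ):ℝ)^(r-2) ≤ γ * P := by
    have h1 : (m:ℝ) * ((m+T:ℕ):ℝ)^(r-2) ≤ K * P := by
      refine le_trans ?_ hnP
      have : r - 1 = (r-2) + 1 := by omega
      rw [this, pow_succ']
      apply mul_le_mul_of_nonneg_right _ (by positivity)
      exact_mod_cast Nat.le_add_right m T
    calc (T:ℝ) * f * ((m+T:ℕ):ℝ)^(r-2) ≤ (c * f * m) * ((m+T:ℕ):ℝ)^(r-2) := by gcongr
      _ = c * f * (m * ((m+T:ℕ):ℝ)^(r-2)) := by ring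
      _ ≤ c * f * (K * P) := by gcongr
      _ = c * f * K * P := by ring
      _ ≤ γ * P := by gcongr
  have hE5 : (H.deg v : ℝ) ≤ (DD ℓ r + 2 * γ) * P := by
    have : (DD ℓ r + 2 * γ) * P = (DD ℓ r + γ) * P + γ * P := by ring
    linarith
  have hF : ((dl H U).edges.card : ℝ) ≤ tn ℓ r (m - T*(f-1)) := by
    have := hN5 (dl H U) hUf (by rw [hn']; omega)
    rw [hn'] at this
    exact_mod_cast this
  have hcast : ((T*(f-1) : ℕ):ℝ) = T * ((f:ℝ)-1) := by
    rw [Nat.cast_mul, Nat.cast_sub hf1, Nat.cast_one]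
  have hT0 : (0:ℝ) < T := by exact_mod_cast hT
  have hG := hN3 m (T*(f-1)) (by omega) (by
    rw [hcast]
    have h1 : (c * f) * m ≤ η * m := by gcongr
    have h2 : (T:ℝ) * ((f:ℝ) - 1) = T * f - T := by ring
    linarith) (by omega)
  rw [hcast, ← hP] at hG
  have hI := hN4 m (by omega)
  rw [← hP] at hI
  have hfin : (T:ℝ) * (m.choose (r-1)) + T * (f-1) * ((DD ℓ r - γ)*P) ≤
      T * f * ((DD ℓ r + 2*γ) * P) := by
    have : (T:ℝ) * f * H.deg v ≤ T * f * ((DD ℓ r + 2*γ) * P) := by gcongr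
    linarith
  have hfin2 : (m.choose (r-1) : ℝ) ≤ (DD ℓ r + 3*f*γ) * P := by
    have h1 : T * ((m.choose (r-1) : ℝ)) ≤ T * ((DD ℓ r + 3*f*γ) * P) := by
      have h2 : T * f * ((DD ℓ r + 2*γ) * P) - T * (f-1) * ((DD ℓ r - γ)*P) =
          T * ((DD ℓ r + 3*f*γ) * P) - T * (γ * P) := by ring
      have h3 : 0 ≤ (T:ℝ) * (γ * P) := by positivity
      linarith
    exact le_of_mul_le_mul_left h1 hT0
  have : (DD ℓ r + 3*f*γ) * P ≤ (1 / ((r-1).factorial : ℝ) - γ) * P := by gcongr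
  linarith

lemma main_ind {ℓ : ℕ} (hr : 2 ≤ r) (hℓ : r ≤ ℓ) :
    ∃ N : ℕ, ∃ c : ℝ, 0 < c ∧ ∀ t m : ℕ, N ≤ m → (t:ℝ) ≤ c * m →
      ∀ H : HGraph r, H.verts.card = m + t → ¬ (expF ℓ r).HasMatching H (t+1) →
      (m+t).choose r + tn ℓ r m ≤ H.edges.card + m.choose r → Str ℓ t H := by
  obtain ⟨N1, c, hc, h1⟩ := no_case (r := r) hr hℓ
  obtain ⟨N0, h0⟩ := exact0 (r := r) hr hℓ
  refine ⟨N1 + N0 + ℓ, c, hc, ?_⟩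
  intro t
  induction t with
  | zero =>
    intro m hm _ H hV hn he
    rw [add_zero] at hV he
    obtain ⟨p, hB, hE⟩ := h0 H (no_match_one hn) (by omega) (by rw [hV]; omega)
    refine ⟨∅, Finset.empty_subset _, rfl, p, by simpa using hB, fun e => ?_⟩
    rw [hE, mem_ks]
    simp
  | succ t ih =>
    intro m hm ht H hV hn he
    obtain ⟨v, hv, hvn⟩ := h1 (t+1) m (by omega) (by omega) ht H hV hn he
    refine str_step hr (by omega) H (by omega) hV v hv he (fun hh => ?_)
    refine ih m hm ?_ _ ?_ hvn hh
    · push_cast at ht; linarith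
    · rw [dl_verts, Finset.card_sdiff_of_subset (by simpa using hv), hV]; simp

end P12

section P13

open scoped Classical

variable {r : ℕ}

/-- the extremal graph -/
abbrev JJ (r ℓ t n : ℕ) : HGraph r :=
  (completeOn r (Finset.range t)).join (turanOn r ℓ (Finset.Ico t n))

lemma JJ_verts {ℓ t n : ℕ} (ht : t ≤ n) : (JJ r ℓ t n).verts = Finset.range n := by
  ext x
  simp [JJ, HGraph.join, HGraph.ofEdges, completeOn, turanOn]
  omega

lemma mem_JJ {ℓ t n : ℕ} (hr : 2 ≤ r) (ht : t ≤ n) (e : Finset ℕ) :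
    e ∈ (JJ r ℓ t n).edges ↔ e ⊆ Finset.range n ∧ e.card = r ∧
      ((e ∩ Finset.range t).Nonempty ∨ ∀ x ∈ e, ∀ y ∈ e, x ≠ y → x % ℓ ≠ y % ℓ) := by
  have hun : Finset.range t ∪ Finset.Ico t n = Finset.range n := by
    ext x; simp; omega
  simp only [JJ, HGraph.join, HGraph.ofEdges, completeOn, turanOn, hun, Finset.mem_filter,
    Finset.mem_union, Finset.mem_powersetCard]
  constructor
  · rintro ⟨h, h1, h2⟩
    refine ⟨h1, h2, ?_⟩
    rcases h with (h | h) | h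
    · left
      rw [Finset.inter_eq_left.2 h.2.1, ← Finset.card_pos]; omega
    · right
      intro x hx y hy hxy heq
      exact hxy (h.1.2 x hx y hy heq)
    · exact Or.inl h.2.1
  · rintro ⟨h1, h2, h3⟩
    refine ⟨?_, h1, h2⟩
    by_cases ha : (e ∩ Finset.range t).Nonempty
    · by_cases hb : (e ∩ Finset.Ico t n).Nonempty
      · exact Or.inr ⟨⟨h1, h2⟩, ha, hb⟩
      · left; left
        have : e ⊆ Finset.range t := by
          intro x hx
          by_contra hxt
          apply hb
          refine ⟨x, Finset.mem_inter.2 ⟨hx, ?_⟩⟩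
          have := h1 hx
          simp at this hxt ⊢
          omega
        exact ⟨⟨this, h2⟩, this, h2⟩
    · left; right
      have hs : e ⊆ Finset.Ico t n := by
        intro x hx
        have h4 := h1 hx
        have h5 : x ∉ Finset.range t := fun h => ha ⟨x, Finset.mem_inter.2 ⟨hx, h⟩⟩
        simp at h4 h5 ⊢
        omega
      refine ⟨⟨⟨hs, h2⟩, ?_⟩, hs, h2⟩
      intro u hu v hv huv
      by_contra hne
      exact (h3.resolve_left ha) u hu v hv hne huv

lemma mod_shift {ℓ t x y : ℕ} : (x + t) % ℓ = (y + t) % ℓ ↔ x % ℓ = y % ℓ :=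
  ⟨fun h => Nat.ModEq.add_right_cancel' t h, fun h => Nat.ModEq.add_right t h⟩

lemma bal_Ico {ℓ t n : ℕ} (hr : 2 ≤ r) (hℓ : r ≤ ℓ) (ht : ℓ + t ≤ n) :
    Bal ℓ (fun x => x % ℓ) (Finset.Ico t n) := by
  have hc : (Finset.Ico t n).card = n - t := by simp
  refine (turan_max hr hℓ (Finset.Ico t n) (by omega) (fun x => x % ℓ)
    (fun v _ => Nat.mod_lt _ (by omega))).2 ?_
  rw [hc, tn]
  refine ks_bij _ _ _ _ (fun x => x - t) ⟨?_, ?_, ?_⟩ ?_ r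
  · intro x hx
    simp at hx ⊢
    omega
  · intro x hx y hy hxy
    simp at hx hy hxy
    omega
  · intro y hy
    simp at hy
    exact ⟨y + t, by simp; omega, by simp⟩
  · intro x hx y hy
    simp only [Finset.mem_Ico] at hx hy
    have h1 : x - t + t = x := by omega
    have h2 : y - t + t = y := by omega
    have := @mod_shift ℓ t (x-t) (y-t)
    rw [h1, h2] at this
    exact this

lemma str_JJ {ℓ t n : ℕ} (hr : 2 ≤ r) (hℓ : r ≤ ℓ) (ht : ℓ + t ≤ n) : Str ℓ t (JJ r ℓ t n) := by
  refine ⟨Finset.range t, ?_, Finset.card_range t, fun x => x % ℓ, ?_, ?_⟩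
  · rw [JJ_verts (by omega)]; exact Finset.range_mono (by omega)
  · rw [JJ_verts (by omega)]
    have : Finset.range n \ Finset.range t = Finset.Ico t n := by
      ext x; simp; omega
    rw [this]
    exact bal_Ico hr hℓ ht
  · intro e
    rw [mem_JJ hr (by omega), JJ_verts (by omega)]

lemma bal_bij {ℓ : ℕ} (p f : ℕ → ℕ) (V U : Finset ℕ) (hf : Set.BijOn f ↑V ↑U) (hB : Bal ℓ p U) :
    Bal ℓ (fun x => p (f x)) V := by
  have hc : ∀ i, (V.filter fun y => p (f y) = i).card = (U.filter fun y => p y = i).card := by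
    intro i
    rw [← Finset.card_image_of_injOn (f := f) (s := V.filter fun y => p (f y) = i)]
    · congr 1
      ext y
      simp only [Finset.mem_image, Finset.mem_filter]
      constructor
      · rintro ⟨x, ⟨h1, h2⟩, rfl⟩
        exact ⟨hf.mapsTo h1, h2⟩
      · rintro ⟨h1, h2⟩
        obtain ⟨x, hx, rfl⟩ := hf.surjOn h1
        exact ⟨x, ⟨hx, h2⟩, rfl⟩
    · exact hf.injOn.mono (by intro x hx; exact (Finset.mem_filter.1 hx).1)
  refine ⟨fun v hv => hB.1 _ (hf.mapsTo hv), fun i hi j hj => ?_⟩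
  rw [hc, hc]
  exact hB.2 i hi j hj

lemma str_of_iso {ℓ t : ℕ} (H G : HGraph r) (hI : H.Iso G) (hS : Str ℓ t G) : Str ℓ t H := by
  obtain ⟨f, hf, hE⟩ := hI
  obtain ⟨L, hL, hLt, p, hB, he⟩ := hS
  have hbL : Set.BijOn f ↑(H.verts.filter fun x => f x ∈ L) ↑L := by
    refine ⟨?_, hf.injOn.mono (by intro x hx; exact (Finset.mem_filter.1 hx).1), ?_⟩
    · intro x hx; exact (Finset.mem_filter.1 hx).2
    · intro y hy
      obtain ⟨x, hx, rfl⟩ := hf.surjOn (hL hy)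
      exact ⟨x, Finset.mem_coe.2 (Finset.mem_filter.2 ⟨hx, hy⟩), rfl⟩
  refine ⟨H.verts.filter fun x => f x ∈ L, Finset.filter_subset _ _, ?_, fun x => p (f x), ?_, ?_⟩
  · rw [← hLt]
    exact Finset.card_bij (fun x _ => f x) (fun x hx => hbL.mapsTo hx)
      (fun x hx y hy h => hbL.injOn hx hy h) (fun y hy => by
        obtain ⟨x, hx, h⟩ := hbL.surjOn hy
        exact ⟨x, hx, h⟩)
  · refine bal_bij p f _ (G.verts \ L) ⟨?_, hf.injOn.mono (by
      intro x hx; exact (Finset.mem_sdiff.1 hx).1), ?_⟩ hB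
    · intro x hx
      have := Finset.mem_sdiff.1 hx
      refine Finset.mem_coe.2 (Finset.mem_sdiff.2 ⟨hf.mapsTo this.1, fun h => this.2 ?_⟩)
      exact Finset.mem_filter.2 ⟨this.1, h⟩
    · intro y hy
      have hy' := Finset.mem_sdiff.1 hy
      obtain ⟨x, hx, rfl⟩ := hf.surjOn hy'.1
      refine ⟨x, Finset.mem_coe.2 (Finset.mem_sdiff.2 ⟨hx, fun h => hy'.2 ?_⟩), rfl⟩
      exact (Finset.mem_filter.1 h).2
  · intro e
    have key : e ⊆ H.verts → e.card = r → (e ∈ H.edges ↔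
        ((e ∩ (H.verts.filter fun x => f x ∈ L)).Nonempty ∨
          ∀ x ∈ e, ∀ y ∈ e, x ≠ y → p (f x) ≠ p (f y))) := by
      intro h1 h2
      have hinj : Set.InjOn f ↑e := hf.injOn.mono (by exact_mod_cast h1)
      rw [hE e (Finset.mem_powersetCard.2 ⟨h1, h2⟩), he]
      have h3 : e.image f ⊆ G.verts := by
        intro y hy
        obtain ⟨x, hx, rfl⟩ := Finset.mem_image.1 hy
        exact hf.mapsTo (h1 hx)
      have h4 : (e.image f).card = r := by rw [Finset.card_image_of_injOn hinj, h2]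
      have h5 : (e.image f ∩ L).Nonempty ↔ (e ∩ (H.verts.filter fun x => f x ∈ L)).Nonempty := by
        constructor
        · rintro ⟨y, hy⟩
          obtain ⟨hy1, hy2⟩ := Finset.mem_inter.1 hy
          obtain ⟨x, hx, rfl⟩ := Finset.mem_image.1 hy1
          exact ⟨x, Finset.mem_inter.2 ⟨hx, Finset.mem_filter.2 ⟨h1 hx, hy2⟩⟩⟩
        · rintro ⟨x, hx⟩
          obtain ⟨hx1, hx2⟩ := Finset.mem_inter.1 hx
          exact ⟨f x, Finset.mem_inter.2 ⟨Finset.mem_image_of_mem f hx1, (Finset.mem_filter.1 hx2).2⟩⟩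
      have h6 : (∀ x ∈ e.image f, ∀ y ∈ e.image f, x ≠ y → p x ≠ p y) ↔
          ∀ x ∈ e, ∀ y ∈ e, x ≠ y → p (f x) ≠ p (f y) := by
        constructor
        · intro h x hx y hy hxy
          exact h _ (Finset.mem_image_of_mem f hx) _ (Finset.mem_image_of_mem f hy)
            (fun hh => hxy (hinj hx hy hh))
        · intro h x hx y hy hxy
          obtain ⟨a, ha, rfl⟩ := Finset.mem_image.1 hx
          obtain ⟨b, hb, rfl⟩ := Finset.mem_image.1 hy
          exact h a ha b hb (fun hh => hxy (by rw [hh]))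
      rw [h5, h6]
      exact ⟨fun h => h.2.2, fun h => ⟨h3, h4, h⟩⟩
    constructor
    · intro h
      have h1 := H.edges_sub e h
      have h2 := H.edges_card e h
      exact ⟨h1, h2, (key h1 h2).1 h⟩
    · rintro ⟨h1, h2, h3⟩
      exact (key h1 h2).2 h3

lemma iso_of_str {ℓ t n : ℕ} (hr : 2 ≤ r) (hℓ : r ≤ ℓ) (ht : ℓ + t ≤ n) (H : HGraph r)
    (hV : H.verts.card = n) (hS : Str ℓ t H) : H.Iso (JJ r ℓ t n) := by
  obtain ⟨L, hL, hLt, p, hB, he⟩ := hS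
  have hc : (H.verts \ L).card = n - t := by rw [Finset.card_sdiff_of_subset hL]; omega
  obtain ⟨g, hg, hg2⟩ := bal_enum (by omega : 0 < ℓ) p _ (by omega) hB
  obtain ⟨h, hh⟩ := enum_exists L
  rw [hc] at hg
  rw [hLt] at hh
  obtain ⟨f, hfL, hfN⟩ : ∃ f : ℕ → ℕ, (∀ x ∈ L, f x = h x) ∧ ∀ x, x ∉ L → f x = g x + t :=
    ⟨fun x => if x ∈ L then h x else g x + t, fun x hx => by simp [hx], fun x hx => by simp [hx]⟩
  have hlt : ∀ x ∈ L, f x < t := by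
    intro x hx
    rw [hfL x hx]
    simpa using hh.mapsTo hx
  have hgm : ∀ x ∈ H.verts, x ∉ L → g x < n - t := by
    intro x hx hxL
    have := hg.mapsTo (Finset.mem_coe.2 (Finset.mem_sdiff.2 ⟨hx, hxL⟩))
    simpa using this
  have hbij : Set.BijOn f ↑H.verts ↑(JJ r ℓ t n).verts := by
    rw [JJ_verts (by omega)]
    refine ⟨?_, ?_, ?_⟩
    · intro x hx
      rw [Finset.mem_coe, Finset.mem_range]
      by_cases hxL : x ∈ L
      · have := hlt x hxL; omega
      · rw [hfN x hxL]
        have := hgm x hx hxL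
        omega
    · intro x hx y hy hxy
      by_cases hxL : x ∈ L <;> by_cases hyL : y ∈ L
      · rw [hfL x hxL, hfL y hyL] at hxy
        exact hh.injOn hxL hyL hxy
      · have := hlt x hxL
        rw [hfN y hyL] at hxy
        omega
      · have := hlt y hyL
        rw [hfN x hxL] at hxy
        omega
      · rw [hfN x hxL, hfN y hyL] at hxy
        exact hg.injOn (Finset.mem_coe.2 (Finset.mem_sdiff.2 ⟨hx, hxL⟩))
          (Finset.mem_coe.2 (Finset.mem_sdiff.2 ⟨hy, hyL⟩)) (by omega)
    · intro y hy
      rw [Finset.mem_coe, Finset.mem_range] at hy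
      by_cases hyt : y < t
      · obtain ⟨x, hx, rfl⟩ := hh.surjOn (Finset.mem_coe.2 (Finset.mem_range.2 hyt))
        exact ⟨x, hL hx, hfL x hx⟩
      · obtain ⟨x, hx, hxy⟩ := hg.surjOn
          (Finset.mem_coe.2 (Finset.mem_range.2 (by omega : y - t < n - t)))
        have hx' := Finset.mem_sdiff.1 hx
        exact ⟨x, hx'.1, by rw [hfN x hx'.2]; omega⟩
  refine ⟨f, hbij, ?_⟩
  intro e hep
  obtain ⟨h1, h2⟩ := Finset.mem_powersetCard.1 hep
  have hinj : Set.InjOn f ↑e := hbij.injOn.mono (by exact_mod_cast h1)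
  have h4 : (e.image f).card = r := by rw [Finset.card_image_of_injOn hinj, h2]
  have h3 : e.image f ⊆ Finset.range n := by
    rw [← JJ_verts (r := r) (ℓ := ℓ) (by omega : t ≤ n)]
    intro y hy
    obtain ⟨x, hx, rfl⟩ := Finset.mem_image.1 hy
    exact hbij.mapsTo (h1 hx)
  rw [he, mem_JJ hr (by omega)]
  have h5 : (e.image f ∩ Finset.range t).Nonempty ↔ (e ∩ L).Nonempty := by
    constructor
    · rintro ⟨y, hy⟩
      obtain ⟨hy1, hy2⟩ := Finset.mem_inter.1 hy
      obtain ⟨x, hx, rfl⟩ := Finset.mem_image.1 hy1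
      refine ⟨x, Finset.mem_inter.2 ⟨hx, ?_⟩⟩
      by_contra hxL
      rw [hfN x hxL, Finset.mem_range] at hy2
      omega
    · rintro ⟨x, hx⟩
      obtain ⟨hx1, hx2⟩ := Finset.mem_inter.1 hx
      exact ⟨f x, Finset.mem_inter.2 ⟨Finset.mem_image_of_mem f hx1,
        Finset.mem_range.2 (hlt x hx2)⟩⟩
  rw [h5]
  by_cases hne : (e ∩ L).Nonempty
  · simp only [hne, true_or, and_true]
    exact ⟨fun _ => ⟨h3, h4⟩, fun _ => ⟨h1, h2⟩⟩
  · have hnL : ∀ x ∈ e, x ∉ L := fun x hx hxL => hne ⟨x, Finset.mem_inter.2 ⟨hx, hxL⟩⟩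
    have hpf : ∀ x ∈ e, ∀ y ∈ e, (p x = p y ↔ f x % ℓ = f y % ℓ) := by
      intro x hx y hy
      rw [hfN x (hnL x hx), hfN y (hnL y hy), mod_shift]
      exact hg2 x (Finset.mem_sdiff.2 ⟨h1 hx, hnL x hx⟩) y (Finset.mem_sdiff.2 ⟨h1 hy, hnL y hy⟩)
    simp only [hne, false_or]
    constructor
    · rintro ⟨_, _, h7⟩
      refine ⟨h3, h4, ?_⟩
      intro x hx y hy hxy
      obtain ⟨a, ha, rfl⟩ := Finset.mem_image.1 hx
      obtain ⟨b, hb, rfl⟩ := Finset.mem_image.1 hy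
      exact fun hh => h7 a ha b hb (fun hab => hxy (by rw [hab])) ((hpf a ha b hb).2 hh)
    · rintro ⟨_, _, h7⟩
      refine ⟨h1, h2, ?_⟩
      intro x hx y hy hxy hh
      exact h7 _ (Finset.mem_image_of_mem f hx) _ (Finset.mem_image_of_mem f hy)
        (fun hab => hxy (hinj hx hy hab)) ((hpf x hx y hy).1 hh)

lemma final (ℓ r : ℕ) (hr : 2 ≤ r) (hℓ : r ≤ ℓ) :
    ∃ N₀ : ℕ, ∃ c : ℝ, 0 < c ∧ ∀ n : ℕ, N₀ ≤ n → ∀ t : ℕ, (t : ℝ) ≤ c * n →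
      ∀ H : HGraph r,
        IsExtremalMatchingFree r n t ((emptyOn r (Finset.Icc 1 (ℓ+1))).expansion) H ↔
        H.Iso ((completeOn r (Finset.range t)).join (turanOn r ℓ (Finset.Ico t n))) := by
  obtain ⟨N, c, hc, hmain⟩ := main_ind (r := r) hr hℓ
  refine ⟨2 * (N + ℓ), min (1/2) (c/2), by positivity, ?_⟩
  intro n hn t ht H
  have hn0 : (0:ℝ) ≤ n := by positivity
  have ht1 : (t:ℝ) ≤ 1/2 * n := ht.trans (mul_le_mul_of_nonneg_right (min_le_left _ _) hn0)
  have ht2 : (t:ℝ) ≤ c/2 * n := ht.trans (mul_le_mul_of_nonneg_right (min_le_right _ _) hn0)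
  have ht3 : 2 * t ≤ n := by
    have : (2:ℝ) * t ≤ n := by linarith
    exact_mod_cast this
  obtain ⟨m, hm⟩ : ∃ m, n = m + t := ⟨n - t, by omega⟩
  have hmN : N + ℓ ≤ m := by omega
  have htm : (t:ℝ) ≤ c * m := by
    have h1 : (n:ℝ) ≤ 2 * m := by exact_mod_cast (by omega : n ≤ 2 * m)
    nlinarith
  have hℓ0 : 0 < ℓ := by omega
  have hlow : ∀ G : HGraph r, G.verts.card = n → Str ℓ t G →
      G.edges.card + m.choose r = n.choose r + tn ℓ r m := by
    intro G hG hS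
    have := str_count hℓ0 G (by omega : ℓ ≤ m) (by omega) hS
    rw [hm]; exact this
  have hup : ∀ G : HGraph r, G.verts.card = n → ¬ (expF ℓ r).HasMatching G (t+1) →
      n.choose r + tn ℓ r m ≤ G.edges.card + m.choose r → Str ℓ t G := by
    intro G hG hnm h
    refine hmain t m (by omega) htm G (by omega) hnm ?_
    rw [← hm]; exact h
  have hJv : (JJ r ℓ t n).verts.card = n := by rw [JJ_verts (by omega), Finset.card_range]
  have hJS : Str ℓ t (JJ r ℓ t n) := str_JJ hr hℓ (by omega)
  have hJe := hlow _ hJv hJS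
  have hgr : IsGreatest {m | ∃ H : HGraph r, H.verts.card = n ∧
      ¬ (expF ℓ r).HasMatching H (t+1) ∧ H.edges.card = m} (JJ r ℓ t n).edges.card := by
    refine ⟨⟨_, hJv, str_no_match hr _ hJS, rfl⟩, ?_⟩
    rintro k ⟨G, hG, hGn, rfl⟩
    by_contra hlt
    push Not at hlt
    have := hlow G hG (hup G hG hGn (by omega))
    omega
  have hex : exMatchN r n t (expF ℓ r) = (JJ r ℓ t n).edges.card := hgr.csSup_eq
  change (H.verts.card = n ∧ ¬ (expF ℓ r).HasMatching H (t+1) ∧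
    H.edges.card = exMatchN r n t (expF ℓ r)) ↔ H.Iso (JJ r ℓ t n)
  rw [hex]
  constructor
  · rintro ⟨h1, h2, h3⟩
    exact iso_of_str hr hℓ (by omega) H h1 (hup H h1 h2 (by omega))
  · intro hI
    have hS := str_of_iso H _ hI hJS
    have hv : H.verts.card = n := by
      obtain ⟨f, hf, _⟩ := hI
      rw [← hJv]
      exact Finset.card_bij (fun x _ => f x) (fun x hx => hf.mapsTo hx)
        (fun x hx y hy h => hf.injOn hx hy h) (fun y hy => by
          obtain ⟨x, hx, h⟩ := hf.surjOn hy
          exact ⟨x, hx, h⟩)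
    have := hlow H hv hS
    exact ⟨hv, str_no_match hr H hS, by omega⟩

end P13

/-- the density Corrádi–Hajnal theorem for the expansion
`H_{ℓ+1}^r` of the complete graph `K_{ℓ+1}` (which is the expansion of the
empty `r`-graph on `ℓ+1` vertices: every pair of core vertices receives an
edge completed by `r−2` new vertices). -/
theorem statement_10 (ℓ r : ℕ) (hr : 2 ≤ r) (hℓ : r ≤ ℓ) :
    ∃ N₀ : ℕ, ∃ c : ℝ, 0 < c ∧ ∀ n : ℕ, N₀ ≤ n → ∀ t : ℕ, (t : ℝ) ≤ c * n →
      ∀ H : HGraph r,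
        IsExtremalMatchingFree r n t ((emptyOn r (Finset.Icc 1 (ℓ+1))).expansion) H ↔
        H.Iso ((completeOn r (Finset.range t)).join (turanOn r ℓ (Finset.Ico t n))) :=
  final ℓ r hr hℓ

end DensityCH
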